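/- Uniform central limit theorem replacing non-signal second-order chaos with Gaussians (Theorem 4.3). Suppose the scaling C₀^{−1} ≤ p/d² ≤ C₀, the genericity condition ‖β_{ki}‖₂ = 1 and E_x[⟨β_{ki},h_k(x)⟩⁴] ≤ 3 + d^{−c₃} for all 2 ≤ k ≤ D' and i ≤ s_k, and the activation condition (A8) hold with constants independent of d. Then for any constants C, K, ε₀ > 0 there exist constants c, C', d₀ > 0 (depending only on the assumption constants and C, K, ε₀) such that for all d ≥ d₀, with probability at least 1 − d^{−C} over W, the following holds simultaneously for every L > 0, every L-Lipschitz function φ : ℝ^{m+1} → ℝ, and every θ ∈ Θ^CG_W(ε₀, K): |E[φ(f^PG, ⟨θ, z^PG⟩)] − E[φ(f^CG, ⟨θ, z^CG⟩)]| ≤ C'·L/d^c, where the expectations are over the respective independent Gaussian variables defining the PGE and CGE models, conditional on W. -/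

import Mathlib

/-!
Uniform central limit theorem replacing non-signal second-order chaos with Gaussians
(Theorem 4.3).
-/

noncomputable section

open MeasureTheory ProbabilityTheory

/-- The degree-`k` orthonormal probabilist's Hermite polynomial. -/
def He (k : ℕ) (x : ℝ) : ℝ :=
  (Polynomial.aeval x (Polynomial.hermite k)) / Real.sqrt (Nat.factorial k)

/-- Multi-indices on `Fin d` of total degree `k`. -/
abbrev MIdx (d k : ℕ) : Type :=
  {κ : Fin d → ℕ // κ ∈ Finset.Nat.antidiagonalTuple d k}

/-- Euclidean dot product on `ι → ℝ`. -/
def dotp {ι : Type*} [Fintype ι] (u v : ι → ℝ) : ℝ := ∑ i, u i * v i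

/-- Euclidean norm on `ι → ℝ`. -/
def enorm2 {ι : Type*} [Fintype ι] (u : ι → ℝ) : ℝ := Real.sqrt (∑ i, (u i) ^ 2)

/-- The vector `h_k(x)` of all degree-`k` multivariate Hermite polynomials. -/
def hvec (d k : ℕ) (x : Fin d → ℝ) : MIdx d k → ℝ :=
  fun κ => ∏ i, He (κ.1 i) (x i)

/-- The vector `q_k(w)`. -/
def qvec (d k : ℕ) (w : Fin d → ℝ) : MIdx d k → ℝ :=
  fun κ => Real.sqrt ((Nat.factorial k : ℝ) / ∏ i, (Nat.factorial (κ.1 i) : ℝ)) *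
    ∏ i, (w i) ^ (κ.1 i)

/-- The standard Gaussian measure on `ι → ℝ`. -/
def stdG (ι : Type*) [Fintype ι] : Measure (ι → ℝ) :=
  Measure.pi fun _ => gaussianReal 0 1

/-- The uniform distribution on the unit sphere of `ι → ℝ`. -/
def unifSphere (ι : Type*) [Fintype ι] : Measure (ι → ℝ) :=
  (stdG ι).map fun x => (enorm2 x)⁻¹ • x

/-- The `k`-th Hermite coefficient `μ_k = E[σ(G) He_k(G)]` of the activation. -/
def hCoef (σa : Polynomial ℝ) (k : ℕ) : ℝ :=
  ∫ g, σa.eval g * He k g ∂(gaussianReal 0 1)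

/-- `μ_{>2} = (∑_{k=3}^{D} μ_k²)^{1/2}`. -/
def muHigh (σa : Polynomial ℝ) (Dσ : ℕ) : ℝ :=
  Real.sqrt (∑ k ∈ Finset.Icc 3 Dσ, (hCoef σa k) ^ 2)

/-- Index of the latent-signal coordinates: `s` linear coordinates together with the
degree-`k` chaos coordinates `ξ_{ki}`, `2 ≤ k ≤ D'`, `1 ≤ i ≤ s_k`; in total `m`. -/
abbrev SigIdx (s D' : ℕ) (sk : ℕ → ℕ) : Type :=
  Fin s ⊕ ((k : {k : ℕ // k ∈ Finset.Icc 2 D'}) × Fin (sk k.1))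

/-- First `s` coordinates of `x ∈ ℝ^d`. -/
def coordS (d s : ℕ) (x : Fin d → ℝ) (i : Fin s) : ℝ :=
  if h : (i : ℕ) < d then x ⟨i, h⟩ else 0

/-- The RF latent signal `f^RF = (x_S, ξ₂, …, ξ_{D'})`. -/
def fRF (d s D' : ℕ) (sk : ℕ → ℕ) (β : (k : ℕ) → Fin (sk k) → MIdx d k → ℝ)
    (x : Fin d → ℝ) : SigIdx s D' sk → ℝ :=
  fun idx => match idx with
  | Sum.inl i => coordS d s x i
  | Sum.inr ki => dotp (β ki.1.1 ki.2) (hvec d ki.1.1 x)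

/-- The RF features `z^RF = σ(Wx)`. -/
def zRF (d p : ℕ) (σa : Polynomial ℝ) (w : Fin p → Fin d → ℝ) (x : Fin d → ℝ) :
    Fin p → ℝ :=
  fun j => σa.eval (dotp (w j) x)

/-- Randomness of one PGE feature/signal sample: `(x, (g_k)_k, g_*)`. -/
abbrev PGfeat (d p D' : ℕ) : Type :=
  (Fin d → ℝ) × ((k : Fin (D' + 3)) → MIdx d k.1 → ℝ) × (Fin p → ℝ)

/-- The law of a PGE feature/signal sample. -/
def PGfeatMeas (d p D' : ℕ) : Measure (PGfeat d p D') :=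
  (stdG (Fin d)).prod
    ((Measure.pi fun k : Fin (D' + 3) => stdG (MIdx d k.1)).prod (stdG (Fin p)))

/-- The PGE latent signal `f^PG = (x_S, ξ₂, ξ̃₃, …, ξ̃_{D'})`. -/
def fPG (d s D' : ℕ) (sk : ℕ → ℕ) (β : (k : ℕ) → Fin (sk k) → MIdx d k → ℝ)
    (x : Fin d → ℝ) (g : (k : Fin (D' + 3)) → MIdx d k.1 → ℝ) : SigIdx s D' sk → ℝ :=
  fun idx => match idx with
  | Sum.inl i => coordS d s x i
  | Sum.inr ki =>
      if ki.1.1 ≤ 2 then dotp (β ki.1.1 ki.2) (hvec d ki.1.1 x)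
      else dotp (β ki.1.1 ki.2)
        (g ⟨ki.1.1, by have h := (Finset.mem_Icc.mp ki.1.2).2; omega⟩)

/-- The PGE features `z^PG = μ₀1_p + μ₁Wx + μ₂V₂h₂(x) + μ_{>2} g_*`. -/
def zPG (d p Dσ : ℕ) (σa : Polynomial ℝ) (w : Fin p → Fin d → ℝ)
    (x : Fin d → ℝ) (gst : Fin p → ℝ) : Fin p → ℝ :=
  fun j =>
    hCoef σa 0 + hCoef σa 1 * dotp (w j) x +
      hCoef σa 2 * dotp (qvec d 2 (w j)) (hvec d 2 x) + muHigh σa Dσ * gst j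

/-- The constrained parameter set `Θ^PG_W(K)`. -/
def ThetaPG (d p : ℕ) (K μ1 : ℝ) (w : Fin p → Fin d → ℝ) : Set (Fin p → ℝ) :=
  {θ | (∀ j, |θ j| ≤ Real.log d ^ K * (d : ℝ) ^ (-(1 / 4 : ℝ))) ∧
    enorm2 θ ≤ Real.log d ^ K ∧
    |∑ j, θ j| ≤ Real.log d ^ K ∧
    enorm2 (fun i : Fin d => μ1 * ∑ j, w j i * θ j) ≤ Real.log d ^ K}

/-- Extension of a vector on the first `s` coordinates by zero to `ℝ^d`. -/
def extend0 (d s : ℕ) (xS : Fin s → ℝ) : Fin d → ℝ :=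
  fun i => if h : (i : ℕ) < s then xS ⟨i, h⟩ else 0

/-- The CGE latent signal `f^CG = (x_S, ξ̃₂, (G_{ki})_{3≤k≤D'})`, realized via the
independent Gaussian family `(g_k)`. -/
def fCG (d s D' : ℕ) (sk : ℕ → ℕ) (β : (k : ℕ) → Fin (sk k) → MIdx d k → ℝ)
    (xS : Fin s → ℝ) (g : (k : Fin (D' + 3)) → MIdx d k.1 → ℝ) : SigIdx s D' sk → ℝ :=
  fun idx => match idx with
  | Sum.inl i => xS i
  | Sum.inr ki =>
      dotp (β ki.1.1 ki.2)
        (g ⟨ki.1.1, by have h := (Finset.mem_Icc.mp ki.1.2).2; omega⟩)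

open Classical in
/-- The CGE features
`z^CG = μ₀1_p + μ₁W_Sx_S + μ₂V_{2,S}h₂(x_S) + μ₁WP_{S,⊥}g₁ + μ₂V₂P_{S,⊥}g₂ + μ_{>2}g_*`,
where `g₂` is the `k = 2` member of the Gaussian family `g`. -/
def zCG (d p s Dσ D' : ℕ) (σa : Polynomial ℝ) (w : Fin p → Fin d → ℝ)
    (xS : Fin s → ℝ) (g : (k : Fin (D' + 3)) → MIdx d k.1 → ℝ)
    (g1 : Fin d → ℝ) (gst : Fin p → ℝ) : Fin p → ℝ :=
  fun j =>
    hCoef σa 0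
    + hCoef σa 1 * dotp (w j) (extend0 d s xS)
    + hCoef σa 2 * ∑ κ : MIdx d 2,
        (if ∀ i : Fin d, s ≤ (i : ℕ) → κ.1 i = 0 then
          qvec d 2 (w j) κ * hvec d 2 (extend0 d s xS) κ else 0)
    + hCoef σa 1 * ∑ i : Fin d, (if (i : ℕ) < s then 0 else w j i * g1 i)
    + hCoef σa 2 * ∑ κ : MIdx d 2,
        (if ∀ i : Fin d, s ≤ (i : ℕ) → κ.1 i = 0 then 0
         else qvec d 2 (w j) κ * g ⟨2, by omega⟩ κ)
    + muHigh σa Dσ * gst j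

/-- Randomness of one CGE feature/signal sample: `(x_S, (g_k)_k, g₁, g_*)`. -/
abbrev CGfeat (d p D' s : ℕ) : Type :=
  (Fin s → ℝ) × ((k : Fin (D' + 3)) → MIdx d k.1 → ℝ) × (Fin d → ℝ) × (Fin p → ℝ)

/-- The law of a CGE feature/signal sample. -/
def CGfeatMeas (d p D' s : ℕ) : Measure (CGfeat d p D' s) :=
  (stdG (Fin s)).prod
    ((Measure.pi fun k : Fin (D' + 3) => stdG (MIdx d k.1)).prod
      ((stdG (Fin d)).prod (stdG (Fin p))))

/-- The `ℓ² → ℓ²` operator norm of a matrix. -/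
def opNorm {ι κ : Type*} [Fintype ι] [Fintype κ] (A : ι → κ → ℝ) : ℝ :=
  ⨆ v : {v : κ → ℝ // (∑ j, (v j) ^ 2) ≤ 1},
    Real.sqrt (∑ i, (∑ j, A i j * v.1 j) ^ 2)

open Classical in
/-- The constrained parameter set `Θ^CG_W(ε₀, K)`. -/
def ThetaCG (d p s : ℕ) (ε0 K μ1 : ℝ) (w : Fin p → Fin d → ℝ) : Set (Fin p → ℝ) :=
  {θ | θ ∈ ThetaPG d p K μ1 w ∧
    opNorm (fun i i' : Fin d =>
        if s ≤ (i : ℕ) ∧ s ≤ (i' : ℕ) then ∑ j, θ j * w j i * w j i' else 0) ≤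
      (d : ℝ) ^ (-ε0) ∧
    Real.sqrt (∑ i : Fin d, ∑ i' : Fin d,
        (if (i : ℕ) < s ∧ s ≤ (i' : ℕ) then (∑ j, θ j * w j i * w j i') ^ 2 else 0)) ≤
      (d : ℝ) ^ (-ε0)}

/-- All moments finite. -/
def AllLp {Ω : Type*} [MeasurableSpace Ω] (f : Ω → ℝ) (μ : Measure Ω) : Prop :=
  ∀ p : ℕ, MemLp f p μ

namespace AllLp
variable {Ω Ω' : Type*} [MeasurableSpace Ω] [MeasurableSpace Ω'] {μ : Measure Ω} {ν : Measure Ω'}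
  {f g : Ω → ℝ}

lemma integrable (hf : AllLp f μ) : Integrable f μ := by
  have := hf 1
  rw [Nat.cast_one] at this
  exact memLp_one_iff_integrable.1 this

lemma aesm (hf : AllLp f μ) : AEStronglyMeasurable f μ := (hf 1).1

lemma add (hf : AllLp f μ) (hg : AllLp g μ) : AllLp (fun x => f x + g x) μ :=
  fun p => (hf p).add (hg p)

lemma sub (hf : AllLp f μ) (hg : AllLp g μ) : AllLp (fun x => f x - g x) μ :=
  fun p => (hf p).sub (hg p)

lemma abs (hf : AllLp f μ) : AllLp (fun x => |f x|) μ :=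
  fun p => (hf p).norm

lemma sum {ι : Type*} {s : Finset ι} {F : ι → Ω → ℝ} (h : ∀ i ∈ s, AllLp (F i) μ) :
    AllLp (fun x => ∑ i ∈ s, F i x) μ :=
  fun p => memLp_finsetSum s (fun i hi => h i hi p)

lemma mul (hf : AllLp f μ) (hg : AllLp g μ) : AllLp (fun x => f x * g x) μ := by
  intro p
  have : ENNReal.HolderTriple ((2 * p : ℕ) : ENNReal) ((2 * p : ℕ) : ENNReal) (p : ENNReal) := by
    constructor
    push_cast
    rw [ENNReal.mul_inv (by simp) (by simp), ← add_mul, ENNReal.inv_two_add_inv_two, one_mul]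
  exact (hg (2 * p)).mul' (hf (2 * p))

lemma const [IsFiniteMeasure μ] (c : ℝ) : AllLp (fun _ : Ω => c) μ := fun _ => memLp_const c

lemma const_mul (c : ℝ) (hf : AllLp f μ) : AllLp (fun x => c * f x) μ :=
  fun p => (hf p).const_mul c

lemma mono (hg : AllLp g μ) (hf : AEStronglyMeasurable f μ) (h : ∀ x, |f x| ≤ g x) : AllLp f μ :=
  fun p => (hg p).mono' hf (Filter.Eventually.of_forall h)

lemma bdd [IsFiniteMeasure μ] (hf : AEStronglyMeasurable f μ) (C : ℝ) (h : ∀ x, |f x| ≤ C) :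
    AllLp f μ := (const (μ := μ) C).mono hf h

lemma comp {h : Ω' → ℝ} (hh : AllLp h ν) {T : Ω → Ω'} (hT : MeasurePreserving T μ ν) :
    AllLp (fun x => h (T x)) μ := fun p => (hh p).comp_measurePreserving hT

lemma pow (hf : AllLp f μ) [IsFiniteMeasure μ] (n : ℕ) : AllLp (fun x => f x ^ n) μ := by
  induction n with
  | zero => simpa using const 1
  | succ k ih => simpa [pow_succ] using ih.mul hf

end AllLp

instance (ι : Type*) [Fintype ι] : IsProbabilityMeasure (stdG ι) := by unfold stdG; infer_instance

lemma allLp_coord {ι : Type*} [Fintype ι] (i : ι) : AllLp (fun x : ι → ℝ => x i) (stdG ι) := by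
  intro p
  have h : MemLp (id : ℝ → ℝ) p (gaussianReal 0 1) := memLp_id_gaussianReal' _ (by simp)
  exact h.comp_measurePreserving (measurePreserving_eval (fun _ : ι => gaussianReal 0 1) i)

lemma mp_update {ι : Type*} [Fintype ι] [DecidableEq ι] {X : ι → Type*}
    [∀ i, MeasurableSpace (X i)]
    (μ : (i : ι) → Measure (X i)) [∀ i, IsProbabilityMeasure (μ i)] (k : ι) :
    MeasurePreserving (fun z : ((i : ι) → X i) × X k => Function.update z.1 k z.2)
      ((Measure.pi μ).prod (μ k)) (Measure.pi μ) := by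
  have hm : Measurable (fun z : ((i : ι) → X i) × X k => Function.update z.1 k z.2) := by
    rw [measurable_pi_iff]
    intro j
    by_cases h : j = k
    · subst h; simpa using measurable_snd
    · simp only [Function.update_of_ne h]
      exact (measurable_pi_apply j).comp measurable_fst
  refine ⟨hm, ?_⟩
  symm
  apply Measure.pi_eq
  intro t ht
  rw [Measure.map_apply hm (MeasurableSet.univ_pi ht)]
  have : (fun z : ((i : ι) → X i) × X k => Function.update z.1 k z.2) ⁻¹' (Set.univ.pi t)
      = (Set.univ.pi (Function.update t k Set.univ)) ×ˢ (t k) := by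
    ext ⟨x, y⟩
    simp only [Set.mem_preimage, Set.mem_pi, Set.mem_univ, true_imp_iff, Set.mem_prod]
    constructor
    · intro h
      refine ⟨fun i => ?_, by simpa using h k⟩
      by_cases hi : i = k
      · subst hi; simp
      · simpa [hi] using h i
    · rintro ⟨h1, h2⟩ i
      by_cases hi : i = k
      · subst hi; simpa using h2
      · simpa [hi] using h1 i
  rw [this, Measure.prod_prod, Measure.pi_pi]
  rw [← Finset.mul_prod_erase Finset.univ _ (Finset.mem_univ k),
    ← Finset.mul_prod_erase Finset.univ (fun i => μ i (t i)) (Finset.mem_univ k)]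
  simp only [Function.update_self, measure_univ, one_mul]
  rw [mul_comm]
  congr 1
  apply Finset.prod_congr rfl
  intro i hi
  rw [Function.update_of_ne (Finset.ne_of_mem_erase hi)]

/-- One-dimensional Gaussian integration by parts. -/
lemma gauss_ibp1 (f f' : ℝ → ℝ) (hd : ∀ t, HasDerivAt f (f' t) t)
    (h1 : Integrable f (gaussianReal 0 1)) (h2 : Integrable (fun t => t * f t) (gaussianReal 0 1))
    (h3 : Integrable f' (gaussianReal 0 1)) :
    ∫ t, t * f t ∂(gaussianReal 0 1) = ∫ t, f' t ∂(gaussianReal 0 1) := by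
  have conv : ∀ h : ℝ → ℝ, Integrable h (gaussianReal 0 1) →
      Integrable (fun t => h t * gaussianPDFReal 0 1 t) := by
    intro h hh
    rw [gaussianReal_of_var_ne_zero 0 one_ne_zero] at hh
    have := (integrable_withDensity_iff (measurable_gaussianPDF 0 1)
      (Filter.Eventually.of_forall fun x => gaussianPDF_lt_top)).1 hh
    simpa [toReal_gaussianPDF] using this
  have hpdf : ∀ t, HasDerivAt (gaussianPDFReal 0 1) (-t * gaussianPDFReal 0 1 t) t := by
    intro t
    have e : gaussianPDFReal 0 1 = fun x => (Real.sqrt (2 * Real.pi * (1 : NNReal)))⁻¹ *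
      Real.exp (-(x - 0) ^ 2 / (2 * (1 : NNReal))) := rfl
    rw [e]
    have := ((((((hasDerivAt_id t).sub_const 0).pow 2).neg).div_const
      (2 * ((1 : NNReal) : ℝ))).exp).const_mul ((Real.sqrt (2 * Real.pi * (1 : NNReal)))⁻¹)
    refine HasDerivAt.congr_deriv this ?_
    simp
    ring
  have key := integral_mul_deriv_eq_deriv_mul_of_integrable (u := f) (u' := f')
    (v := gaussianPDFReal 0 1) (v' := fun t => -t * gaussianPDFReal 0 1 t) (fun t _ => hd t)
    (fun t _ => hpdf t) ?_ (conv _ h3) (conv _ h1)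
  · rw [integral_gaussianReal_eq_integral_smul one_ne_zero,
      integral_gaussianReal_eq_integral_smul one_ne_zero]
    simp only [smul_eq_mul]
    have e1 : ∀ t, gaussianPDFReal 0 1 t * (t * f t) = -(f t * (-t * gaussianPDFReal 0 1 t)) := by
      intro t; ring
    simp_rw [e1]
    rw [integral_neg, key, neg_neg]
    congr 1; ext t; ring
  · have := (conv _ h2).neg
    refine this.congr (Filter.Eventually.of_forall fun t => ?_)
    simp; ring

/-- Gaussian integration by parts, coordinate version. -/
lemma gauss_ibp {ι : Type*} [Fintype ι] [DecidableEq ι] (k : ι) (h h' : (ι → ℝ) → ℝ)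
    (hd : ∀ x, HasDerivAt (fun t => h (Function.update x k t)) (h' x) (x k))
    (h1 : AllLp h (stdG ι)) (h2 : AllLp h' (stdG ι)) :
    ∫ x, x k * h x ∂(stdG ι) = ∫ x, h' x ∂(stdG ι) := by
  have mp := mp_update (fun _ : ι => gaussianReal 0 1) k
  have mp' : MeasurePreserving (fun z : (ι → ℝ) × ℝ => Function.update z.1 k z.2)
      ((stdG ι).prod (gaussianReal 0 1)) (stdG ι) := mp
  have h3 : AllLp (fun x : ι → ℝ => x k * h x) (stdG ι) := (allLp_coord k).mul h1
  have tr : ∀ F : (ι → ℝ) → ℝ, AllLp F (stdG ι) → ∫ x, F x ∂(stdG ι) =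
      ∫ x, ∫ t, F (Function.update x k t) ∂(gaussianReal 0 1) ∂(stdG ι) := by
    intro F hF
    rw [← integral_prod (fun z : (ι → ℝ) × ℝ => F (Function.update z.1 k z.2))
      (hF.comp mp').integrable]
    have := integral_map mp'.measurable.aemeasurable (f := F) (by rw [mp'.map_eq]; exact hF.aesm)
    rw [mp'.map_eq] at this
    exact this
  rw [tr _ h3, tr _ h2]
  apply integral_congr_ae
  have i1 := (h1.comp mp').integrable.prod_right_ae
  have i2 := (h2.comp mp').integrable.prod_right_ae
  have i3 := (h3.comp mp').integrable.prod_right_ae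
  filter_upwards [i1, i2, i3] with x j1 j2 j3
  have := gauss_ibp1 (fun t => h (Function.update x k t)) (fun t => h' (Function.update x k t))
    (fun t => by simpa using hd (Function.update x k t)) j1 (by simpa using j3) j2
  simpa using this

set_option linter.unusedSectionVars false
set_option linter.unusedSimpArgs false
section quad
variable {I : Type*} [Fintype I] [DecidableEq I]

/-- matrix-vector product -/
def mv (P : I → I → ℝ) (y : I → ℝ) (k : I) : ℝ := ∑ l, P k l * y l

/-- centred quadratic form -/
def qf (P : I → I → ℝ) (y : I → ℝ) : ℝ :=
  ∑ k, ∑ l, P k l * (y k * y l - if k = l then 1 else 0)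

/-- transpose -/
def tp (P : I → I → ℝ) : I → I → ℝ := fun k l => P l k

/-- product -/
def mm (P Q : I → I → ℝ) : I → I → ℝ := fun k l => ∑ m, P k m * Q m l

lemma allLp_mv (P : I → I → ℝ) (k : I) : AllLp (fun y => mv P y k) (stdG I) :=
  AllLp.sum fun l _ => (allLp_coord l).const_mul _

lemma allLp_dotp (a : I → ℝ) : AllLp (fun y => dotp a y) (stdG I) :=
  AllLp.sum fun l _ => (allLp_coord l).const_mul _

lemma allLp_qf (P : I → I → ℝ) : AllLp (fun y => qf P y) (stdG I) :=
  AllLp.sum fun k _ => AllLp.sum fun l _ =>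
    (((allLp_coord k).mul (allLp_coord l)).sub (AllLp.const _)).const_mul _

lemma hd_coord (x : I → ℝ) (k l : I) :
    HasDerivAt (fun t => Function.update x k t l) (if l = k then 1 else 0) (x k) := by
  by_cases h : l = k
  · subst h; simp only [Function.update_self, if_true]; exact hasDerivAt_id _
  · simpa [h] using hasDerivAt_const _ _

lemma hd_dotp (a x : I → ℝ) (k : I) :
    HasDerivAt (fun t => dotp a (Function.update x k t)) (a k) (x k) := by
  have := HasDerivAt.fun_sum (u := Finset.univ) fun l _ => (hd_coord x k l).const_mul (a l)
  refine this.congr_deriv ?_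
  simp

lemma hd_mv (P : I → I → ℝ) (x : I → ℝ) (k l : I) :
    HasDerivAt (fun t => mv P (Function.update x k t) l) (P l k) (x k) :=
  hd_dotp (P l) x k

lemma hd_qf (P : I → I → ℝ) (x : I → ℝ) (k : I) :
    HasDerivAt (fun t => qf P (Function.update x k t)) (mv P x k + mv (tp P) x k) (x k) := by
  have := HasDerivAt.fun_sum (u := Finset.univ) fun i _ =>
    HasDerivAt.fun_sum (u := Finset.univ) fun l _ =>
      (((hd_coord x k i).mul (hd_coord x k l)).sub_const
        (if i = l then (1 : ℝ) else 0)).const_mul (P i l)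
  refine this.congr_deriv ?_
  simp [mv, tp, mul_add, Finset.sum_add_distrib]

lemma qf_ibp (P : I → I → ℝ) (h : (I → ℝ) → ℝ) (h' : I → (I → ℝ) → ℝ)
    (hd : ∀ k x, HasDerivAt (fun t => h (Function.update x k t)) (h' k x) (x k))
    (h1 : AllLp h (stdG I)) (h2 : ∀ k, AllLp (h' k) (stdG I)) :
    ∫ y, qf P y * h y ∂(stdG I) = ∑ k, ∫ y, mv P y k * h' k y ∂(stdG I) := by
  have e : ∀ y, qf P y * h y = ∑ k, (y k * (mv P y k * h y) - P k k * h y) := by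
    intro y
    simp only [qf, mv, Finset.sum_mul, Finset.mul_sum, ← Finset.sum_sub_distrib]
    rw [Finset.sum_comm' (t' := Finset.univ) (s' := fun _ => Finset.univ) (by simp)]
    rw [Finset.sum_comm]
    apply Finset.sum_congr rfl
    intro k _
    rw [eq_sub_iff_add_eq, ← Finset.sum_erase_add _ _ (Finset.mem_univ k),
      ← Finset.sum_erase_add _ _ (Finset.mem_univ k), add_assoc]
    congr 1
    · apply Finset.sum_congr rfl
      intro l hl
      simp [(Finset.ne_of_mem_erase hl).symm]; ring
    · simp; ring
  simp_rw [e]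
  have ik : ∀ k, AllLp (fun y : I → ℝ => y k * (mv P y k * h y)) (stdG I) :=
    fun k => (allLp_coord k).mul ((allLp_mv P k).mul h1)
  rw [integral_finsetSum _ fun k _ => ((ik k).sub (h1.const_mul (P k k))).integrable]
  apply Finset.sum_congr rfl
  intro k _
  rw [integral_sub (ik k).integrable (h1.const_mul (P k k)).integrable]
  rw [gauss_ibp k (fun y => mv P y k * h y) (fun y => P k k * h y + mv P y k * h' k y) ?_
    ((allLp_mv P k).mul h1) ((h1.const_mul _).add ((allLp_mv P k).mul (h2 k)))]
  · rw [integral_add (h1.const_mul _).integrable ((allLp_mv P k).mul (h2 k)).integrable]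
    ring
  · intro x
    have := (hd_mv P x k k).mul (hd k x)
    refine this.congr_deriv ?_
    simp

lemma int_coord2 (k l : I) : ∫ y : I → ℝ, y k * y l ∂(stdG I) = if l = k then 1 else 0 := by
  rw [gauss_ibp k (fun y => y l) (fun _ => if l = k then 1 else 0) (fun x => hd_coord x k l)
    (allLp_coord l) (AllLp.const _)]
  simp

lemma int_dotp2 (a b : I → ℝ) : ∫ y, dotp a y * dotp b y ∂(stdG I) = ∑ k, a k * b k := by
  simp only [dotp, Finset.sum_mul_sum]
  have al : ∀ k l, AllLp (fun y : I → ℝ => a k * y k * (b l * y l)) (stdG I) := fun k l =>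
    ((allLp_coord k).const_mul _).mul ((allLp_coord l).const_mul _)
  rw [integral_finsetSum _ fun k _ => (AllLp.sum fun l _ => al k l).integrable]
  apply Finset.sum_congr rfl
  intro k _
  rw [integral_finsetSum _ fun l _ => (al k l).integrable]
  have : ∀ l, ∫ y : I → ℝ, a k * y k * (b l * y l) ∂(stdG I) =
      a k * b l * if l = k then 1 else 0 := by
    intro l
    rw [← int_coord2 k l, ← integral_const_mul]
    congr 1; ext y; ring
  simp [this]

lemma int_qf (P : I → I → ℝ) : ∫ y, qf P y ∂(stdG I) = 0 := by
  have := qf_ibp P (fun _ => 1) (fun _ _ => 0) (fun k x => hasDerivAt_const _ _) (AllLp.const _)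
    (fun k => AllLp.const _)
  simpa using this

lemma int_qf2 (P Q : I → I → ℝ) :
    ∫ y, qf P y * qf Q y ∂(stdG I) = ∑ k, ∑ l, P k l * (Q k l + Q l k) := by
  rw [qf_ibp P (qf Q) (fun k x => mv Q x k + mv (tp Q) x k) (fun k x => hd_qf Q x k)
    (allLp_qf Q) (fun k => (allLp_mv _ k).add (allLp_mv _ k))]
  apply Finset.sum_congr rfl
  intro k _
  simp_rw [mul_add]
  rw [integral_add ((allLp_mv _ k).mul (allLp_mv _ k)).integrable
    ((allLp_mv _ k).mul (allLp_mv _ k)).integrable, Finset.sum_add_distrib]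
  congr 1
  · exact int_dotp2 (P k) (Q k)
  · exact int_dotp2 (P k) (tp Q k)

lemma int_qf_sq_le (P : I → I → ℝ) :
    ∫ y, qf P y ^ 2 ∂(stdG I) ≤ 2 * ∑ k, ∑ l, P k l ^ 2 := by
  simp_rw [pow_two (qf P _)]
  rw [int_qf2]
  have h1 : ∑ k, ∑ l, P k l * (P k l + P l k) ≤ ∑ k, ∑ l, (3 / 2 * P k l ^ 2 + 1 / 2 * P l k ^ 2) := by
    apply Finset.sum_le_sum; intro k _; apply Finset.sum_le_sum; intro l _
    nlinarith [sq_nonneg (P k l - P l k)]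
  refine h1.trans (le_of_eq ?_)
  simp_rw [Finset.sum_add_distrib, ← Finset.mul_sum]
  rw [Finset.sum_comm (f := fun k l => P l k ^ 2)]
  ring

lemma mv_mv (A B : I → I → ℝ) (y : I → ℝ) :
    ∑ k, mv A y k * mv B y k = qf (mm (tp A) B) y + ∑ k, ∑ l, A k l * B k l := by
  have h1 : ∑ k, mv A y k * mv B y k = ∑ k, ∑ l, ∑ m, A k l * B k m * (y l * y m) := by
    simp only [mv, Finset.sum_mul_sum]
    refine Finset.sum_congr rfl fun k _ => Finset.sum_congr rfl fun l _ =>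
      Finset.sum_congr rfl fun m _ => by ring
  rw [h1]
  simp only [qf, mm, tp, mul_sub, Finset.sum_sub_distrib, Finset.sum_mul]
  have h2 : ∑ x, ∑ x_1, ∑ i, A i x * B i x_1 * (y x * y x_1)
      = ∑ k, ∑ l, ∑ m, A k l * B k m * (y l * y m) := by
    rw [Finset.sum_comm' (t' := Finset.univ) (s' := fun _ => Finset.univ) (by simp)]
    rw [Finset.sum_comm]
    have : ∀ l : I, ∑ m, ∑ k, A k l * B k m * (y l * y m) = ∑ k, ∑ m, A k l * B k m * (y l * y m) :=
      fun l => Finset.sum_comm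
    simp_rw [this]
    rw [Finset.sum_comm]
  rw [h2]
  have h3 : ∑ x, ∑ x_1, ∑ i, A i x * B i x_1 * (if x = x_1 then (1 : ℝ) else 0) =
      ∑ k, ∑ l, A k l * B k l := by
    have : ∀ x : I, ∑ x_1, ∑ i, A i x * B i x_1 * (if x = x_1 then (1 : ℝ) else 0) =
        ∑ i, A i x * B i x := by
      intro x
      rw [Finset.sum_comm]
      simp
    simp_rw [this]
    rw [Finset.sum_comm]
  rw [h3]; ring

/-- The fourth moment of a normalized quadratic form. -/
lemma fourth_moment (M : I → I → ℝ) (hs : ∀ k l, M k l = M l k) (h1 : ∑ k, ∑ l, M k l ^ 2 = 1) :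
    ∫ y, qf M y ^ 4 ∂(stdG I) = 12 + 48 * ∑ k, ∑ l, (mm M M k l) ^ 2 := by
  have htp : tp M = M := by ext k l; exact hs l k
  set M2 := mm M M with hM2
  have hs2 : ∀ k l, M2 k l = M2 l k := by
    intro k l
    simp only [hM2, mm]
    refine Finset.sum_congr rfl fun m _ => ?_
    rw [hs k m, hs m l]; ring
  have htp2 : tp M2 = M2 := by ext k l; exact hs2 l k
  have hMM : ∀ y, ∑ k, mv M y k * mv M y k = qf M2 y + 1 := by
    intro y
    rw [mv_mv, htp, ← h1]
    simp_rw [pow_two]; rfl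
  have aQ := allLp_qf M
  have aq := allLp_qf M2
  have amv := fun k => allLp_mv M k
  have dQ : ∀ k x, HasDerivAt (fun t => qf M (Function.update x k t)) (2 * mv M x k) (x k) := by
    intro k x
    refine (hd_qf M x k).congr_deriv ?_
    rw [htp]; ring
  have dq : ∀ k x, HasDerivAt (fun t => qf M2 (Function.update x k t)) (2 * mv M2 x k) (x k) := by
    intro k x
    refine (hd_qf M2 x k).congr_deriv ?_
    rw [htp2]; ring
  have s1 : ∫ y, qf M y ^ 4 ∂(stdG I) = 6 * ∫ y, qf M y ^ 2 * (qf M2 y + 1) ∂(stdG I) := by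
    have := qf_ibp M (fun y => qf M y ^ 3) (fun k y => 3 * qf M y ^ 2 * (2 * mv M y k))
      (fun k x => by
        refine ((dQ k x).pow 3).congr_deriv ?_
        simp) (aQ.pow 3)
      (fun k => ((aQ.pow 2).const_mul 3).mul ((amv k).const_mul 2))
    calc ∫ y, qf M y ^ 4 ∂(stdG I) = ∫ y, qf M y * qf M y ^ 3 ∂(stdG I) := by
          congr 1; ext y; ring
      _ = _ := this
      _ = ∫ y, ∑ k, mv M y k * (3 * qf M y ^ 2 * (2 * mv M y k)) ∂(stdG I) := by
          rw [integral_finsetSum]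
          intro k _
          exact ((amv k).mul (((aQ.pow 2).const_mul 3).mul ((amv k).const_mul 2))).integrable
      _ = _ := by
          rw [← integral_const_mul]
          congr 1; ext y
          rw [← hMM, Finset.mul_sum, Finset.mul_sum]
          refine Finset.sum_congr rfl fun k _ => by ring
  have s2 : ∫ y, qf M y ^ 2 * (qf M2 y + 1) ∂(stdG I) =
      ∫ y, qf M y * (qf M y * qf M2 y) ∂(stdG I) + 2 := by
    have e2 : ∫ y, qf M y * qf M y ∂(stdG I) = 2 := by
      rw [int_qf2]
      calc ∑ k, ∑ l, M k l * (M k l + M l k) = ∑ k, ∑ l, 2 * M k l ^ 2 := by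
            refine Finset.sum_congr rfl fun k _ => Finset.sum_congr rfl fun l _ => ?_
            rw [hs l k]; ring
        _ = 2 := by simp_rw [← Finset.mul_sum]; rw [h1]; ring
    rw [← e2, ← integral_add (aQ.mul (aQ.mul aq)).integrable (aQ.mul aQ).integrable]
    congr 1; ext y; ring
  have s3 : ∫ y, qf M y * (qf M y * qf M2 y) ∂(stdG I) =
      2 * ∫ y, (qf M2 y + 1) * qf M2 y ∂(stdG I) +
      2 * ∫ y, qf M y * (∑ k, mv M y k * mv M2 y k) ∂(stdG I) := by
    have := qf_ibp M (fun y => qf M y * qf M2 y)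
      (fun k y => 2 * mv M y k * qf M2 y + qf M y * (2 * mv M2 y k))
      (fun k x => by
        refine ((dQ k x).mul (dq k x)).congr_deriv ?_
        simp) (aQ.mul aq)
      (fun k => (((amv k).const_mul 2).mul aq).add (aQ.mul ((allLp_mv M2 k).const_mul 2)))
    rw [this, ← integral_const_mul, ← integral_const_mul, ← integral_add, ← integral_finsetSum]
    · congr 1; ext y
      rw [← hMM, Finset.mul_sum, Finset.sum_mul, Finset.mul_sum, Finset.mul_sum,
        ← Finset.sum_add_distrib]
      refine Finset.sum_congr rfl fun k _ => by ring
    · intro k _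
      exact ((amv k).mul ((((amv k).const_mul 2).mul aq).add
        (aQ.mul ((allLp_mv M2 k).const_mul 2)))).integrable
    · exact (((aq.add (AllLp.const 1)).mul aq).const_mul 2).integrable
    · exact ((aQ.mul (AllLp.sum fun k _ => (amv k).mul (allLp_mv M2 k))).const_mul 2).integrable
  have s4 : ∫ y, (qf M2 y + 1) * qf M2 y ∂(stdG I) = 2 * ∑ k, ∑ l, (M2 k l) ^ 2 := by
    have : ∀ y, (qf M2 y + 1) * qf M2 y = qf M2 y * qf M2 y + qf M2 y := fun y => by ring
    simp_rw [this]
    rw [integral_add (aq.mul aq).integrable aq.integrable, int_qf, int_qf2, add_zero]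
    simp_rw [Finset.mul_sum]
    refine Finset.sum_congr rfl fun k _ => Finset.sum_congr rfl fun l _ => ?_
    rw [hs2 l k]; ring
  have s5 : ∫ y, qf M y * (∑ k, mv M y k * mv M2 y k) ∂(stdG I) = 2 * ∑ k, ∑ l, (M2 k l) ^ 2 := by
    simp_rw [mv_mv, htp, mul_add]
    rw [integral_add (aQ.mul (allLp_qf _)).integrable (aQ.mul (AllLp.const _)).integrable,
      integral_mul_const, int_qf, zero_mul, add_zero, int_qf2]
    have key : ∑ k, ∑ l, M k l * mm M M2 k l = ∑ k, ∑ l, (M2 k l) ^ 2 := by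
      simp only [mm, Finset.mul_sum]
      have : ∀ m l, M2 m l = ∑ k, M k m * M k l := by
        intro m l
        simp only [hM2, mm]
        refine Finset.sum_congr rfl fun k _ => by rw [hs m k]
      calc ∑ k, ∑ l, ∑ m, M k l * (M k m * M2 m l)
          = ∑ l, ∑ m, ∑ k, M k l * (M k m * M2 m l) := by
            rw [Finset.sum_comm]
            refine Finset.sum_congr rfl fun l _ => ?_
            rw [Finset.sum_comm]
        _ = ∑ l, ∑ m, M2 m l ^ 2 := by
            refine Finset.sum_congr rfl fun l _ => Finset.sum_congr rfl fun m _ => ?_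
            rw [pow_two]
            nth_rewrite 2 [this m l]
            rw [Finset.sum_mul]
            refine Finset.sum_congr rfl fun k _ => by ring
        _ = _ := Finset.sum_comm
    have key2 : ∑ k, ∑ l, M k l * mm M M2 l k = ∑ k, ∑ l, (M2 k l) ^ 2 := by
      rw [← key, Finset.sum_comm]
      refine Finset.sum_congr rfl fun k _ => Finset.sum_congr rfl fun l _ => by rw [hs l k]
    simp_rw [mul_add, Finset.sum_add_distrib]
    rw [key, key2]; ring
  rw [s1, s2, s3, s4, s5]; ring

/-- `E|f| ≤ √(E f²)`. -/
lemma int_abs_le_sqrt {Ω : Type*} [MeasurableSpace Ω] {μ : Measure Ω} [IsProbabilityMeasure μ]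
    {f : Ω → ℝ} (hf : AllLp f μ) : ∫ x, |f x| ∂μ ≤ Real.sqrt (∫ x, f x ^ 2 ∂μ) := by
  apply Real.le_sqrt_of_sq_le
  set m := ∫ x, |f x| ∂μ with hm
  have h0 : 0 ≤ ∫ x, (|f x| - m) ^ 2 ∂μ := integral_nonneg fun x => sq_nonneg _
  have e : ∀ x, (|f x| - m) ^ 2 = f x ^ 2 - 2 * m * |f x| + m ^ 2 := by
    intro x; rw [sub_sq, sq_abs]; ring
  simp_rw [e] at h0
  rw [integral_add ((hf.pow 2).sub ((hf.abs).const_mul _)).integrable (integrable_const _),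
    integral_sub (hf.pow 2).integrable ((hf.abs).const_mul _).integrable, integral_const_mul,
    ← hm] at h0
  simp at h0
  nlinarith

lemma int_abs_dotp_le (a : I → ℝ) : ∫ y, |dotp a y| ∂(stdG I) ≤ Real.sqrt (∑ k, a k ^ 2) := by
  refine (int_abs_le_sqrt (allLp_dotp a)).trans (le_of_eq ?_)
  congr 1
  simp_rw [pow_two]
  exact int_dotp2 a a

lemma int_abs_qf_le (P : I → I → ℝ) :
    ∫ y, |qf P y| ∂(stdG I) ≤ Real.sqrt (2 * ∑ k, ∑ l, P k l ^ 2) :=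
  (int_abs_le_sqrt (allLp_qf P)).trans (Real.sqrt_le_sqrt (int_qf_sq_le P))

end quad

set_option linter.unusedSectionVars false

section moll
open scoped ContDiff
variable {ι : Type*} [Fintype ι] [DecidableEq ι]

/-- Assemble a linear form from partial derivatives. -/
def asm (p : ι → ℝ) : (ι → ℝ) →L[ℝ] ℝ :=
  ∑ i, p i • (ContinuousLinearMap.proj i : (ι → ℝ) →L[ℝ] ℝ)

lemma asm_apply (p v : ι → ℝ) : asm p v = ∑ i, p i * v i := by
  simp [asm]

lemma asm_single (p : ι → ℝ) (i : ι) : asm p (Pi.single i 1) = p i := by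
  simp [asm_apply, Pi.single_apply]

lemma clm_eq_asm (D : (ι → ℝ) →L[ℝ] ℝ) : D = asm (fun i => D (Pi.single i 1)) := by
  ext v
  rw [asm_apply]
  have := LinearMap.pi_apply_eq_sum_univ D.toLinearMap v
  have e : ∀ i : ι, (fun j => if i = j then (1 : ℝ) else 0) = Pi.single i 1 := by
    intro i; ext j; simp [Pi.single_apply, eq_comm]
  simp only [e] at this
  refine this.trans (Finset.sum_congr rfl fun i _ => ?_)
  rw [smul_eq_mul, mul_comm]; rfl

/-- Convolution of `f` with `Ψ`. -/
def cv (f Ψ : (ι → ℝ) → ℝ) (x : ι → ℝ) : ℝ := ∫ t, f t * Ψ (x - t)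

/-- partial derivative -/
def pd (f : (ι → ℝ) → ℝ) (i : ι) (x : ι → ℝ) : ℝ := fderiv ℝ f x (Pi.single i 1)

lemma cv_hasFDerivAt (f Ψ : (ι → ℝ) → ℝ) (hf : ContDiff ℝ ∞ f) (hc : HasCompactSupport f)
    (hΨ : Continuous Ψ) (x : ι → ℝ) :
    HasFDerivAt (cv f Ψ) (asm fun i => cv (pd f i) Ψ x) x := by
  have h := hc.hasFDerivAt_convolution_left (ContinuousLinearMap.lsmul ℝ ℝ)
    (hf.of_le (by simp)) (hΨ.locallyIntegrable (μ := volume)) x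
  have hcf : Continuous (fderiv ℝ f) := hf.continuous_fderiv (by simp)
  have hex := (hc.fderiv ℝ).convolutionExists_left
    ((ContinuousLinearMap.lsmul ℝ ℝ).precompL (ι → ℝ)) hcf (hΨ.locallyIntegrable (μ := volume)) x
  rw [clm_eq_asm (convolution (fderiv ℝ f) Ψ ((ContinuousLinearMap.lsmul ℝ ℝ).precompL (ι → ℝ)) volume x)] at h
  refine HasFDerivAt.congr_fderiv h ?_
  congr 1
  ext i
  rw [convolution, ContinuousLinearMap.integral_apply hex]
  rfl

lemma pd_smooth (f : (ι → ℝ) → ℝ) (hf : ContDiff ℝ ∞ f) (i : ι) : ContDiff ℝ ∞ (pd f i) := by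
  have : ContDiff ℝ ∞ (fderiv ℝ f) := hf.fderiv_right (by simp)
  exact this.clm_apply contDiff_const

lemma pd_compact (f : (ι → ℝ) → ℝ) (hc : HasCompactSupport f) (i : ι) :
    HasCompactSupport (pd f i) :=
  (hc.fderiv ℝ).comp_left (g := fun D : (ι → ℝ) →L[ℝ] ℝ => D (Pi.single i 1)) (by simp)

lemma cv_integrable (f Ψ : (ι → ℝ) → ℝ) (hf : Continuous f) (hc : HasCompactSupport f)
    (hΨ : Continuous Ψ) (x : ι → ℝ) : Integrable (fun t => f t * Ψ (x - t)) := by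
  apply Continuous.integrable_of_hasCompactSupport
  · exact hf.mul (hΨ.comp (continuous_const.sub continuous_id))
  · exact hc.mul_right

lemma cv_lip (f Ψ : (ι → ℝ) → ℝ) (hf : Continuous f) (hc : HasCompactSupport f) (L : ℝ)
    (hΨ : Continuous Ψ) (hL : ∀ u v, |Ψ u - Ψ v| ≤ L * ‖u - v‖) (u v : ι → ℝ) :
    |cv f Ψ u - cv f Ψ v| ≤ (∫ t, |f t|) * L * ‖u - v‖ := by
  unfold cv
  rw [← integral_sub (cv_integrable f Ψ hf hc hΨ u) (cv_integrable f Ψ hf hc hΨ v)]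
  rw [mul_assoc, ← integral_mul_const]
  rw [← Real.norm_eq_abs]
  refine norm_integral_le_of_norm_le ?_ (Filter.Eventually.of_forall fun t => ?_)
  · exact ((hf.integrable_of_hasCompactSupport hc).abs).mul_const _
  · rw [← mul_sub, Real.norm_eq_abs, abs_mul]
    refine mul_le_mul_of_nonneg_left ?_ (abs_nonneg _)
    simpa using hL (u - t) (v - t)

lemma cv_cont (f Ψ : (ι → ℝ) → ℝ) (hf : ContDiff ℝ ∞ f) (hc : HasCompactSupport f)
    (hΨ : Continuous Ψ) : Continuous (cv f Ψ) :=
  continuous_iff_continuousAt.2 fun x => (cv_hasFDerivAt f Ψ hf hc hΨ x).continuousAt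

lemma asm_bound {f : (ι → ℝ) → ℝ} {p : ι → ℝ} {x : ι → ℝ} (h : HasFDerivAt f (asm p) x) (L : ℝ)
    (hL0 : 0 ≤ L) (hL : ∀ u v, |f u - f v| ≤ L * ‖u - v‖) (i : ι) : |p i| ≤ L := by
  have h1 : ‖asm p‖ ≤ L := h.le_of_lip' hL0 (Filter.Eventually.of_forall fun u => hL u x)
  have h2 := (asm p).le_opNorm (Pi.single i 1)
  rw [asm_single] at h2
  have h3 : ‖(Pi.single i 1 : ι → ℝ)‖ = 1 := by rw [Pi.norm_single]; simp
  rw [h3, mul_one] at h2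
  exact h2.trans h1

/-- `ψ` is twice differentiable with gradient `P` and Hessian `H`. -/
structure C2 (ψ : (ι → ℝ) → ℝ) (P : ι → (ι → ℝ) → ℝ) (H : ι → ι → (ι → ℝ) → ℝ) (L1 L2 : ℝ) :
    Prop where
  d1 : ∀ v, HasFDerivAt ψ (asm fun i => P i v) v
  d2 : ∀ i v, HasFDerivAt (P i) (asm fun j => H i j v) v
  cH : ∀ i j, Continuous (H i j)
  b1 : ∀ i v, |P i v| ≤ L1
  b2 : ∀ i j v, |H i j v| ≤ L2
  lip : ∀ u v, |ψ u - ψ v| ≤ L1 * ‖u - v‖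

lemma C2.symm {ψ : (ι → ℝ) → ℝ} {P : ι → (ι → ℝ) → ℝ} {H : ι → ι → (ι → ℝ) → ℝ} {L1 L2 : ℝ}
    (h : C2 ψ P H L1 L2) (i j : ι) (v : ι → ℝ) : H i j v = H j i v := by
  have hx : HasFDerivAt (fun v => asm fun i => P i v)
      (∑ i, (asm fun j => H i j v).smulRight
        (ContinuousLinearMap.proj i : (ι → ℝ) →L[ℝ] ℝ)) v := by
    unfold asm
    apply HasFDerivAt.fun_sum
    intro i _
    exact (h.d2 i v).smul_const (ContinuousLinearMap.proj i : (ι → ℝ) →L[ℝ] ℝ)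
  have := second_derivative_symmetric (𝕜 := ℝ) (fun y => h.d1 y) hx (Pi.single i 1) (Pi.single j 1)
  simp [asm_single, Pi.single_apply] at this
  exact this.symm

lemma mollify1 (ι : Type*) [Fintype ι] [DecidableEq ι] : ∃ C : ℝ, 0 < C ∧ ∀ L : ℝ, 0 ≤ L → ∀ Ψ : (ι → ℝ) → ℝ,
    (∀ u v, |Ψ u - Ψ v| ≤ L * ‖u - v‖) → ∃ ψ P H, C2 (ι := ι) ψ P H L (C * L) ∧
      ∀ v, |ψ v - Ψ v| ≤ C * L := by
  let b : ContDiffBump (0 : ι → ℝ) := ⟨1, 2, by norm_num, by norm_num⟩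
  let ρ : (ι → ℝ) → ℝ := b.normed volume
  have hρ : ContDiff ℝ ∞ ρ := b.contDiff_normed
  have hcρ : HasCompactSupport ρ := b.hasCompactSupport_normed
  have hρ0 : ∀ t, 0 ≤ ρ t := b.nonneg_normed
  have hρ1 : ∫ t, ρ t = 1 := b.integral_normed
  have hi : ∀ i, 0 ≤ ∫ t, |pd ρ i t| := fun i => integral_nonneg fun t => abs_nonneg _
  refine ⟨2 + ∑ i, ∫ t, |pd ρ i t|, by
    have := Finset.sum_nonneg (s := Finset.univ) fun i _ => hi i
    linarith, ?_⟩
  intro L hL Ψ hΨL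
  have hΨ : Continuous Ψ := by
    have : LipschitzWith L.toNNReal Ψ := LipschitzWith.of_dist_le_mul fun u v => by
      rw [Real.dist_eq, dist_eq_norm, Real.coe_toNNReal _ hL]; exact hΨL u v
    exact this.continuous
  have hd1 := cv_hasFDerivAt ρ Ψ hρ hcρ hΨ
  have hd2 := fun i => cv_hasFDerivAt (pd ρ i) Ψ (pd_smooth ρ hρ i) (pd_compact ρ hcρ i) hΨ
  have hl1 : ∀ u v, |cv ρ Ψ u - cv ρ Ψ v| ≤ L * ‖u - v‖ := by
    intro u v
    have := cv_lip ρ Ψ hρ.continuous hcρ L hΨ hΨL u v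
    simp_rw [abs_of_nonneg (hρ0 _)] at this
    rwa [hρ1, one_mul] at this
  have hl2 := fun i => cv_lip (pd ρ i) Ψ (pd_smooth ρ hρ i).continuous (pd_compact ρ hcρ i) L hΨ hΨL
  refine ⟨cv ρ Ψ, fun i => cv (pd ρ i) Ψ, fun i j => cv (pd (pd ρ i) j) Ψ,
    ⟨hd1, hd2, ?_, ?_, ?_, hl1⟩, ?_⟩
  · intro i j
    exact cv_cont _ _ (pd_smooth _ (pd_smooth ρ hρ i) j) (pd_compact _ (pd_compact ρ hcρ i) j) hΨ
  · intro i v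
    exact asm_bound (hd1 v) L hL hl1 i
  · intro i j v
    refine (asm_bound (hd2 i v) _ (mul_nonneg (hi i) hL) (hl2 i) j).trans ?_
    refine mul_le_mul_of_nonneg_right ?_ hL
    have := Finset.single_le_sum (f := fun i => ∫ t, |pd ρ i t|) (s := Finset.univ) (fun i _ => hi i)
      (Finset.mem_univ i)
    linarith
  · intro v
    have e : cv ρ Ψ v - Ψ v = ∫ t, (ρ t * Ψ (v - t) - ρ t * Ψ v) := by
      rw [integral_sub (cv_integrable ρ Ψ hρ.continuous hcρ hΨ v)
        ((hρ.continuous.integrable_of_hasCompactSupport hcρ).mul_const _), integral_mul_const, hρ1,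
        one_mul]
      rfl
    rw [e]
    have hb : ∀ t, ‖ρ t * Ψ (v - t) - ρ t * Ψ v‖ ≤ ρ t * (2 * L) := by
      intro t
      rw [← mul_sub, Real.norm_eq_abs, abs_mul, abs_of_nonneg (hρ0 t)]
      by_cases ht : t ∈ Function.support ρ
      · refine mul_le_mul_of_nonneg_left ?_ (hρ0 t)
        refine (hΨL _ _).trans ?_
        have h2 : ‖t‖ < 2 := by
          have : Function.support ρ = Metric.ball 0 b.rOut := b.support_normed_eq
          rw [this] at ht
          simpa using ht
        have : ‖v - t - v‖ = ‖t‖ := by rw [sub_sub_cancel_left, norm_neg]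
        rw [this]
        nlinarith
      · have : ρ t = 0 := by simpa using ht
        simp [this]
    refine (norm_integral_le_of_norm_le
      ((hρ.continuous.integrable_of_hasCompactSupport hcρ).mul_const _)
      (Filter.Eventually.of_forall hb)).trans ?_
    rw [integral_mul_const, hρ1, one_mul]
    refine mul_le_mul_of_nonneg_right ?_ hL
    have := Finset.sum_nonneg (s := Finset.univ) fun i _ => hi i
    linarith

lemma mollify (ι : Type*) [Fintype ι] [DecidableEq ι] : ∃ C : ℝ, 0 < C ∧ ∀ L : ℝ, 0 ≤ L → ∀ Ψ : (ι → ℝ) → ℝ,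
    (∀ u v, |Ψ u - Ψ v| ≤ L * ‖u - v‖) → ∀ δ : ℝ, 0 < δ →
      ∃ ψ P H, C2 (ι := ι) ψ P H L (C * L / δ) ∧ ∀ v, |ψ v - Ψ v| ≤ C * L * δ := by
  obtain ⟨C, hC, h⟩ := mollify1 ι
  refine ⟨C, hC, ?_⟩
  intro L hL Ψ hΨ δ hδ
  obtain ⟨ψ, P, H, hc2, hap⟩ := h L hL (fun v => δ⁻¹ * Ψ (δ • v)) (by
    intro u v
    rw [← mul_sub, abs_mul, abs_of_pos (inv_pos.2 hδ)]
    calc δ⁻¹ * |Ψ (δ • u) - Ψ (δ • v)| ≤ δ⁻¹ * (L * ‖δ • u - δ • v‖) :=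
          mul_le_mul_of_nonneg_left (hΨ _ _) (inv_pos.2 hδ).le
      _ = L * ‖u - v‖ := by
          rw [← smul_sub, norm_smul, Real.norm_eq_abs, abs_of_pos hδ]; field_simp)
  have hsc : ∀ (f : (ι → ℝ) → ℝ) (p : (ι → ℝ) → ι → ℝ), (∀ v, HasFDerivAt f (asm (p v)) v) →
      ∀ v, HasFDerivAt (fun v => f (δ⁻¹ • v)) (asm (fun i => δ⁻¹ * p (δ⁻¹ • v) i)) v := by
    intro f p hf v
    have h1 : HasFDerivAt (fun v : ι → ℝ => δ⁻¹ • v) (δ⁻¹ • ContinuousLinearMap.id ℝ (ι → ℝ)) v :=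
      (hasFDerivAt_id v).const_smul δ⁻¹
    have := (hf (δ⁻¹ • v)).comp v h1
    refine this.congr_fderiv ?_
    ext w
    simp [asm_apply, Finset.mul_sum, mul_assoc]
  refine ⟨fun v => δ * ψ (δ⁻¹ • v), fun i v => P i (δ⁻¹ • v), fun i j v => δ⁻¹ * H i j (δ⁻¹ • v),
    ⟨?_, ?_, ?_, ?_, ?_, ?_⟩, ?_⟩
  · intro v
    have := (hsc ψ (fun v i => P i v) hc2.d1 v).const_mul δ
    refine this.congr_fderiv ?_
    ext w
    simp [asm_apply, Finset.mul_sum, mul_assoc]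
    refine Finset.sum_congr rfl fun i _ => by field_simp
  · intro i v
    exact hsc (P i) (fun v j => H i j v) (hc2.d2 i) v
  · intro i j
    exact continuous_const.mul ((hc2.cH i j).comp (continuous_const_smul _))
  · intro i v
    exact hc2.b1 i _
  · intro i j v
    rw [abs_mul, abs_of_pos (inv_pos.2 hδ), div_eq_inv_mul]
    exact mul_le_mul_of_nonneg_left (hc2.b2 i j _) (inv_pos.2 hδ).le
  · intro u v
    rw [← mul_sub, abs_mul, abs_of_pos hδ]
    calc δ * |ψ (δ⁻¹ • u) - ψ (δ⁻¹ • v)| ≤ δ * (L * ‖δ⁻¹ • u - δ⁻¹ • v‖) :=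
          mul_le_mul_of_nonneg_left (hc2.lip _ _) hδ.le
      _ = L * ‖u - v‖ := by
          rw [← smul_sub, norm_smul, Real.norm_eq_abs, abs_of_pos (inv_pos.2 hδ)]; field_simp
  · intro v
    have := hap (δ⁻¹ • v)
    rw [smul_inv_smul₀ hδ.ne'] at this
    have e : δ * ψ (δ⁻¹ • v) - Ψ v = δ * (ψ (δ⁻¹ • v) - δ⁻¹ * Ψ v) := by
      field_simp
    rw [e, abs_mul, abs_of_pos hδ, mul_comm (C * L) δ]
    exact mul_le_mul_of_nonneg_left this hδ.le

end moll

set_option linter.unusedSectionVars false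

section core
variable {ι I J : Type*} [Fintype ι] [DecidableEq ι] [Fintype I] [DecidableEq I] [Fintype J]
  [DecidableEq J]

/-- Second-order chaos vector. -/
def Fv (a : ι → I → ℝ) (M : ι → I → I → ℝ) (y : I → ℝ) : ι → ℝ :=
  fun i => dotp (a i) y + qf (M i) y / Real.sqrt 2

/-- Gaussian vector. -/
def Nv (c : ι → J → ℝ) (g : J → ℝ) : ι → ℝ := fun i => dotp (c i) g

/-- Interpolation. -/
def Zv (a : ι → I → ℝ) (M : ι → I → I → ℝ) (c : ι → J → ℝ) (r q : ℝ) (y : I → ℝ) (g : J → ℝ) :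
    ι → ℝ := fun i => r * Fv a M y i + q * Nv c g i

/-- Covariance. -/
def Sg (a : ι → I → ℝ) (M : ι → I → I → ℝ) (i j : ι) : ℝ :=
  ∑ k, a i k * a j k + ∑ k, ∑ l, M i k l * M j k l

/-- Fluctuation of the carre du champ. -/
def Xf (a : ι → I → ℝ) (M : ι → I → I → ℝ) (i j : ι) (y : I → ℝ) : ℝ :=
  Real.sqrt 2 * dotp (fun l => ∑ k, a i k * M j k l) y
    + dotp (fun l => ∑ k, a j k * M i k l) y / Real.sqrt 2
    + qf (mm (tp (M i)) (M j)) y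

lemma hd_curve {P : (ι → ℝ) → ℝ} {p : ι → ℝ} {v : ℝ → ι → ℝ} {v' : ι → ℝ} {t : ℝ}
    (hP : HasFDerivAt P (asm p) (v t)) (hv : ∀ i, HasDerivAt (fun t => v t i) (v' i) t) :
    HasDerivAt (fun t => P (v t)) (∑ i, p i * v' i) t := by
  have h1 : HasDerivAt v v' t := hasDerivAt_pi.2 hv
  have h2 := hP.comp_hasDerivAt t h1
  rw [asm_apply] at h2
  exact h2

lemma allLp_Fv (a : ι → I → ℝ) (M : ι → I → I → ℝ) (i : ι) :
    AllLp (fun y => Fv a M y i) (stdG I) := by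
  unfold Fv
  simp_rw [div_eq_inv_mul]
  exact (allLp_dotp _).add ((allLp_qf _).const_mul _)

lemma allLp_Nv (c : ι → J → ℝ) (i : ι) : AllLp (fun y => Nv c y i) (stdG J) := allLp_dotp _

lemma allLp_Xf (a : ι → I → ℝ) (M : ι → I → I → ℝ) (i j : ι) :
    AllLp (fun y => Xf a M i j y) (stdG I) := by
  unfold Xf
  simp_rw [div_eq_inv_mul]
  exact (((allLp_dotp _).const_mul _).add ((allLp_dotp _).const_mul _)).add (allLp_qf _)

lemma cont_dotp (a : I → ℝ) : Continuous (fun y => dotp a y) := by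
  unfold dotp; fun_prop

lemma cont_qf (P : I → I → ℝ) : Continuous (fun y => qf P y) := by
  unfold qf; fun_prop

lemma cont_Fv (a : ι → I → ℝ) (M : ι → I → I → ℝ) : Continuous (fun y => Fv a M y) := by
  refine continuous_pi fun i => ?_
  exact (cont_dotp _).add ((cont_qf _).div_const _)

lemma cont_Nv (c : ι → J → ℝ) : Continuous (fun y => Nv c y) :=
  continuous_pi fun _ => cont_dotp _

lemma cont_Zv (a : ι → I → ℝ) (M : ι → I → I → ℝ) (c : ι → J → ℝ) (r q : ℝ) :
    Continuous (fun z : (I → ℝ) × (J → ℝ) => Zv a M c r q z.1 z.2) := by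
  refine continuous_pi fun i => ?_
  have h1 := (continuous_apply i).comp ((cont_Fv a M).comp (continuous_fst (Y := J → ℝ)))
  have h2 := (continuous_apply i).comp ((cont_Nv c).comp (continuous_snd (X := I → ℝ)))
  exact (continuous_const.mul h1).add (continuous_const.mul h2)

/-- IBP in the chaos variable. -/
lemma ibp_y (a : ι → I → ℝ) (M : ι → I → I → ℝ) (hs : ∀ i k l, M i k l = M i l k)
    (P : (ι → ℝ) → ℝ) (H : ι → (ι → ℝ) → ℝ) (hd : ∀ v, HasFDerivAt P (asm fun j => H j v) v)
    (hH : ∀ j, Continuous (H j)) (L1 L2 : ℝ) (b1 : ∀ v, |P v| ≤ L1) (b2 : ∀ j v, |H j v| ≤ L2)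
    (r : ℝ) (n : ι → ℝ) (i : ι) :
    ∫ y, Fv a M y i * P (fun j => r * Fv a M y j + n j) ∂(stdG I)
      = r * ∑ j, ∫ y, H j (fun j => r * Fv a M y j + n j) * (Sg a M i j + Xf a M i j y) ∂(stdG I) := by
  have hs2 : Real.sqrt 2 * Real.sqrt 2 = 2 := Real.mul_self_sqrt (by norm_num)
  have hs0 : Real.sqrt 2 ≠ 0 := by positivity
  have hPc : Continuous P := continuous_iff_continuousAt.2 fun x => (hd x).continuousAt
  have hvc : Continuous (fun y => (fun j => r * Fv a M y j + n j : ι → ℝ)) := by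
    refine continuous_pi fun j => ?_
    exact (continuous_const.mul ((continuous_apply j).comp (cont_Fv a M))).add continuous_const
  set v : (I → ℝ) → ι → ℝ := fun y j => r * Fv a M y j + n j with hv
  have aP : AllLp (fun y => P (v y)) (stdG I) :=
    AllLp.bdd (hPc.comp hvc).aestronglyMeasurable L1 fun y => b1 _
  have aH : ∀ j, AllLp (fun y => H j (v y)) (stdG I) := fun j =>
    AllLp.bdd ((hH j).comp hvc).aestronglyMeasurable L2 fun y => b2 _ _
  let h' : I → (I → ℝ) → ℝ := fun k y =>
    ∑ j, H j (v y) * (r * (a j k + Real.sqrt 2 * mv (M j) y k))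
  have ah' : ∀ k, AllLp (h' k) (stdG I) := fun k => AllLp.sum fun j _ =>
    (aH j).mul (((AllLp.const _).add ((allLp_mv _ _).const_mul _)).const_mul _)
  have hdd : ∀ k y, HasDerivAt (fun t => P (v (Function.update y k t))) (h' k y) (y k) := by
    intro k y
    have hP := hd (v (Function.update y k (y k)))
    have := hd_curve (v := fun t => v (Function.update y k t))
      (v' := fun j => r * (a j k + Real.sqrt 2 * mv (M j) y k)) hP ?_
    · refine this.congr_deriv ?_
      simp only [Function.update_eq_self, h']
    · intro j
      have h1 := (((hd_dotp (a j) y k).add ((hd_qf (M j) y k).div_const (Real.sqrt 2))).const_mul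
        r).add_const (n j)
      refine h1.congr_deriv ?_
      have : tp (M j) = M j := by ext k l; exact hs j l k
      rw [this]
      have : mv (M j) y k + mv (M j) y k = Real.sqrt 2 * Real.sqrt 2 * mv (M j) y k := by
        rw [hs2]; ring
      rw [this]
      field_simp
  have e1 : ∫ y, dotp (a i) y * P (v y) ∂(stdG I) = ∑ k, ∫ y, a i k * h' k y ∂(stdG I) := by
    simp only [dotp, Finset.sum_mul]
    rw [integral_finsetSum _ fun k _ => (((allLp_coord k).const_mul _).mul aP).integrable]
    refine Finset.sum_congr rfl fun k _ => ?_
    simp_rw [mul_assoc]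
    rw [integral_const_mul, integral_const_mul, gauss_ibp k (fun y => P (v y)) (h' k) (hdd k) aP (ah' k)]
  have e2 := qf_ibp (M i) (fun y => P (v y)) h' hdd aP ah'
  have e3 : ∫ y, Fv a M y i * P (v y) ∂(stdG I) =
      ∑ k, ∫ y, (a i k + mv (M i) y k / Real.sqrt 2) * h' k y ∂(stdG I) := by
    have : ∀ y, Fv a M y i * P (v y) = dotp (a i) y * P (v y)
        + (Real.sqrt 2)⁻¹ * (qf (M i) y * P (v y)) := by
      intro y; simp only [Fv]; ring
    simp_rw [this]
    rw [integral_add ((allLp_dotp _).mul aP).integrable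
      (((allLp_qf _).mul aP).const_mul _).integrable, integral_const_mul, e1, e2, Finset.mul_sum,
      ← Finset.sum_add_distrib]
    refine Finset.sum_congr rfl fun k _ => ?_
    rw [← integral_const_mul, ← integral_add ((ah' k).const_mul _).integrable
      (((allLp_mv _ _).mul (ah' k)).const_mul _).integrable]
    congr 1; ext y; ring
  rw [e3, Finset.mul_sum]
  have ak : ∀ k, AllLp (fun y => (a i k + mv (M i) y k / Real.sqrt 2) * h' k y) (stdG I) := by
    intro k
    simp_rw [div_eq_inv_mul]
    exact ((AllLp.const _).add ((allLp_mv _ _).const_mul _)).mul (ah' k)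
  rw [← integral_finsetSum _ fun k _ => (ak k).integrable]
  simp_rw [← integral_const_mul]
  rw [← integral_finsetSum _ fun j _ =>
    (((aH j).mul ((AllLp.const _).add (allLp_Xf a M i j))).const_mul r).integrable]
  congr 1; ext y
  simp only [h', Finset.mul_sum]
  rw [Finset.sum_comm]
  refine Finset.sum_congr rfl fun j _ => ?_
  have key : ∑ k, (a i k + mv (M i) y k / Real.sqrt 2) * (a j k + Real.sqrt 2 * mv (M j) y k)
      = Sg a M i j + Xf a M i j y := by
    have h1 : ∀ k, (a i k + mv (M i) y k / Real.sqrt 2) * (a j k + Real.sqrt 2 * mv (M j) y k)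
      = a i k * a j k + Real.sqrt 2 * (a i k * mv (M j) y k) + (a j k * mv (M i) y k) / Real.sqrt 2
        + mv (M i) y k * mv (M j) y k := by
      intro k; field_simp; ring
    have h2 : ∀ i j, dotp (fun l => ∑ k, a i k * M j k l) y = ∑ k, a i k * mv (M j) y k := by
      intro i j
      simp only [dotp, mv, Finset.sum_mul, Finset.mul_sum]
      rw [Finset.sum_comm]
      refine Finset.sum_congr rfl fun k _ => Finset.sum_congr rfl fun l _ => by ring
    simp_rw [h1]
    rw [Finset.sum_add_distrib, Finset.sum_add_distrib, Finset.sum_add_distrib, mv_mv,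
      ← Finset.mul_sum, ← Finset.sum_div]
    unfold Xf Sg
    rw [h2, h2]; ring
  rw [← key]
  simp only [Finset.mul_sum]
  refine Finset.sum_congr rfl fun k _ => by ring

/-- IBP in the Gaussian variable. -/
lemma ibp_g (c : ι → J → ℝ)
    (P : (ι → ℝ) → ℝ) (H : ι → (ι → ℝ) → ℝ) (hd : ∀ v, HasFDerivAt P (asm fun j => H j v) v)
    (hH : ∀ j, Continuous (H j)) (L1 L2 : ℝ) (b1 : ∀ v, |P v| ≤ L1) (b2 : ∀ j v, |H j v| ≤ L2)
    (q : ℝ) (n : ι → ℝ) (i : ι) :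
    ∫ g, Nv c g i * P (fun j => n j + q * Nv c g j) ∂(stdG J)
      = q * ∑ j, (∑ k, c i k * c j k) * ∫ g, H j (fun j => n j + q * Nv c g j) ∂(stdG J) := by
  have hPc : Continuous P := continuous_iff_continuousAt.2 fun x => (hd x).continuousAt
  have hvc : Continuous (fun y => (fun j => n j + q * Nv c y j : ι → ℝ)) := by
    refine continuous_pi fun j => ?_
    exact continuous_const.add (continuous_const.mul ((continuous_apply j).comp (cont_Nv c)))
  set v : (J → ℝ) → ι → ℝ := fun y j => n j + q * Nv c y j with hv
  have aP : AllLp (fun y => P (v y)) (stdG J) :=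
    AllLp.bdd (hPc.comp hvc).aestronglyMeasurable L1 fun y => b1 _
  have aH : ∀ j, AllLp (fun y => H j (v y)) (stdG J) := fun j =>
    AllLp.bdd ((hH j).comp hvc).aestronglyMeasurable L2 fun y => b2 _ _
  let h' : J → (J → ℝ) → ℝ := fun k y => ∑ j, H j (v y) * (q * c j k)
  have ah' : ∀ k, AllLp (h' k) (stdG J) := fun k => AllLp.sum fun j _ =>
    (aH j).mul (AllLp.const _)
  have hdd : ∀ k y, HasDerivAt (fun t => P (v (Function.update y k t))) (h' k y) (y k) := by
    intro k y
    have hP := hd (v (Function.update y k (y k)))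
    have := hd_curve (v := fun t => v (Function.update y k t))
      (v' := fun j => q * c j k) hP ?_
    · refine this.congr_deriv ?_
      simp only [Function.update_eq_self, h']
    · intro j
      exact ((hd_dotp (c j) y k).const_mul q).const_add (n j)
  have e1 : ∫ y, Nv c y i * P (v y) ∂(stdG J) = ∑ k, ∫ y, c i k * h' k y ∂(stdG J) := by
    simp only [Nv, dotp, Finset.sum_mul]
    rw [integral_finsetSum _ fun k _ => (((allLp_coord k).const_mul _).mul aP).integrable]
    refine Finset.sum_congr rfl fun k _ => ?_
    simp_rw [mul_assoc]
    rw [integral_const_mul, integral_const_mul, gauss_ibp k (fun y => P (v y)) (h' k) (hdd k) aP (ah' k)]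
  rw [e1, ← integral_finsetSum _ fun k _ => ((ah' k).const_mul _).integrable, Finset.mul_sum]
  simp_rw [← integral_const_mul]
  rw [← integral_finsetSum _ fun j _ => (((aH j).const_mul _).const_mul q).integrable]
  congr 1; ext y
  simp only [h', Finset.mul_sum, Finset.sum_mul]
  rw [Finset.sum_comm]
  refine Finset.sum_congr rfl fun j _ => Finset.sum_congr rfl fun k _ => by ring

/-- op-norm bound gives a bound for the transposed action and the product. -/
def OpB (M : I → I → ℝ) (κ : ℝ) : Prop := ∀ v : I → ℝ, ∑ k, mv M v k ^ 2 ≤ κ ^ 2 * ∑ k, v k ^ 2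

lemma int_abs_Xf (a : ι → I → ℝ) (M : ι → I → I → ℝ) (hs : ∀ i k l, M i k l = M i l k) (κ : ℝ)
    (hκ : 0 ≤ κ) (hop : ∀ i, OpB (M i) κ) (i j : ι) (t : ℝ) (ht : 0 ≤ t)
    (hi : Sg a M i i ≤ t ^ 2) (hj : Sg a M j j ≤ t ^ 2) :
    ∫ y, |Xf a M i j y| ∂(stdG I) ≤ 4 * (κ * t) := by
  have hκt : 0 ≤ κ * t := mul_nonneg hκ ht
  have sa : ∀ i, Sg a M i i ≤ t ^ 2 → ∑ k, a i k ^ 2 ≤ t ^ 2 ∧ ∑ k, ∑ l, M i k l ^ 2 ≤ t ^ 2 := by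
    intro i h
    unfold Sg at h
    simp_rw [← pow_two] at h
    have h1 : 0 ≤ ∑ k, a i k ^ 2 := Finset.sum_nonneg fun k _ => sq_nonneg _
    have h2 : 0 ≤ ∑ k, ∑ l, M i k l ^ 2 := Finset.sum_nonneg fun k _ =>
      Finset.sum_nonneg fun k _ => sq_nonneg _
    constructor <;> linarith
  have d : ∀ i j, ∑ k, a i k ^ 2 ≤ t ^ 2 →
      ∫ y, |dotp (fun l => ∑ k, a i k * M j k l) y| ∂(stdG I) ≤ κ * t := by
    intro i j h
    refine (int_abs_dotp_le _).trans ?_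
    rw [← Real.sqrt_sq hκt]
    apply Real.sqrt_le_sqrt
    have := hop j (a i)
    have e : ∀ l, mv (M j) (a i) l = ∑ k, a i k * M j k l := by
      intro l; unfold mv
      refine Finset.sum_congr rfl fun k _ => by rw [hs j l k]; ring
    simp_rw [e] at this
    refine this.trans ?_
    rw [mul_pow]
    exact mul_le_mul_of_nonneg_left h (sq_nonneg _)
  have dq : ∫ y, |qf (mm (tp (M i)) (M j)) y| ∂(stdG I) ≤ Real.sqrt 2 * (κ * t) := by
    refine (int_abs_qf_le _).trans ?_
    rw [Real.sqrt_mul (by norm_num)]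
    refine mul_le_mul_of_nonneg_left ?_ (Real.sqrt_nonneg _)
    rw [← Real.sqrt_sq hκt]
    apply Real.sqrt_le_sqrt
    rw [Finset.sum_comm]
    calc ∑ l, ∑ k, mm (tp (M i)) (M j) k l ^ 2
        = ∑ l, ∑ k, mv (M i) (fun m => M j m l) k ^ 2 := by
          refine Finset.sum_congr rfl fun l _ => Finset.sum_congr rfl fun k _ => ?_
          unfold mm mv tp
          simp_rw [hs i _ k]
      _ ≤ ∑ l, κ ^ 2 * ∑ k, M j k l ^ 2 := Finset.sum_le_sum fun l _ => hop i _
      _ = κ ^ 2 * ∑ k, ∑ l, M j k l ^ 2 := by rw [← Finset.mul_sum, Finset.sum_comm]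
      _ ≤ κ ^ 2 * t ^ 2 := mul_le_mul_of_nonneg_left (sa j hj).2 (sq_nonneg _)
      _ = _ := by ring
  have h1 := d i j (sa i hi).1
  have h2 := d j i (sa j hj).1
  have s2 : Real.sqrt 2 ≤ 1.5 := by
    rw [Real.sqrt_le_left (by norm_num)]; norm_num
  have s1 : 1 ≤ Real.sqrt 2 := by
    rw [Real.one_le_sqrt]; norm_num
  have i1 := (allLp_dotp (fun l => ∑ k, a i k * M j k l)).abs.integrable
  have i2 := (allLp_dotp (fun l => ∑ k, a j k * M i k l)).abs.integrable
  have i12 := (((allLp_dotp (fun l => ∑ k, a i k * M j k l)).abs.const_mul (Real.sqrt 2)).add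
    (allLp_dotp (fun l => ∑ k, a j k * M i k l)).abs).integrable
  have i3 := (allLp_qf (mm (tp (M i)) (M j))).abs.integrable
  calc ∫ y, |Xf a M i j y| ∂(stdG I)
      ≤ ∫ y, (Real.sqrt 2 * |dotp (fun l => ∑ k, a i k * M j k l) y|
          + |dotp (fun l => ∑ k, a j k * M i k l) y| + |qf (mm (tp (M i)) (M j)) y|) ∂(stdG I) := by
        refine integral_mono (allLp_Xf a M i j).abs.integrable
          (((i1.const_mul _).add i2).add i3) fun y => ?_
        unfold Xf
        refine (abs_add_le _ _).trans (add_le_add_left ((abs_add_le _ _).trans (add_le_add ?_ ?_)) _)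
        · rw [abs_mul, abs_of_nonneg (Real.sqrt_nonneg 2)]
        · rw [abs_div, abs_of_nonneg (Real.sqrt_nonneg 2)]
          exact div_le_self (abs_nonneg _) s1
    _ = Real.sqrt 2 * ∫ y, |dotp (fun l => ∑ k, a i k * M j k l) y| ∂(stdG I)
          + ∫ y, |dotp (fun l => ∑ k, a j k * M i k l) y| ∂(stdG I)
          + ∫ y, |qf (mm (tp (M i)) (M j)) y| ∂(stdG I) := by
        rw [integral_add i12 i3, integral_add (i1.const_mul _) i2,
          integral_const_mul]
    _ ≤ Real.sqrt 2 * (κ * t) + κ * t + Real.sqrt 2 * (κ * t) :=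
        add_le_add (add_le_add (mul_le_mul_of_nonneg_left h1 (Real.sqrt_nonneg _)) h2) dq
    _ ≤ 4 * (κ * t) := by nlinarith

end core

set_option linter.unusedSectionVars false

section core2
variable {ι I J : Type*} [Fintype ι] [DecidableEq ι] [Fintype I] [DecidableEq I] [Fintype J]
  [DecidableEq J]

lemma allLp_fst {Ω Ω' : Type*} [MeasurableSpace Ω] [MeasurableSpace Ω'] {μ : Measure Ω}
    {ν : Measure Ω'} [IsProbabilityMeasure μ] [IsProbabilityMeasure ν] {f : Ω → ℝ} (hf : AllLp f μ) :
    AllLp (fun z : Ω × Ω' => f z.1) (μ.prod ν) := hf.comp measurePreserving_fst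

lemma allLp_snd {Ω Ω' : Type*} [MeasurableSpace Ω] [MeasurableSpace Ω'] {μ : Measure Ω}
    {ν : Measure Ω'} [IsProbabilityMeasure μ] [IsProbabilityMeasure ν] {f : Ω' → ℝ} (hf : AllLp f ν) :
    AllLp (fun z : Ω × Ω' => f z.2) (μ.prod ν) := hf.comp measurePreserving_snd

/-- Abbreviation: expectation of `H(Z) X(y)`. -/
def EHX (a : ι → I → ℝ) (M : ι → I → I → ℝ) (c : ι → J → ℝ) (r q : ℝ) (h : (ι → ℝ) → ℝ)
    (X : (I → ℝ) → ℝ) : ℝ :=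
  ∫ z : (I → ℝ) × (J → ℝ), h (Zv a M c r q z.1 z.2) * X z.1 ∂((stdG I).prod (stdG J))

lemma allLp_hZ (a : ι → I → ℝ) (M : ι → I → I → ℝ) (c : ι → J → ℝ) (r q : ℝ) {h : (ι → ℝ) → ℝ}
    (hc : Continuous h) (L : ℝ) (hb : ∀ v, |h v| ≤ L) :
    AllLp (fun z : (I → ℝ) × (J → ℝ) => h (Zv a M c r q z.1 z.2)) ((stdG I).prod (stdG J)) :=
  AllLp.bdd (hc.comp (cont_Zv a M c r q)).aestronglyMeasurable L fun _ => hb _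

lemma EHX_le (a : ι → I → ℝ) (M : ι → I → I → ℝ) (c : ι → J → ℝ) (r q : ℝ) {h : (ι → ℝ) → ℝ}
    (L : ℝ) (hb : ∀ v, |h v| ≤ L) {X : (I → ℝ) → ℝ}
    (hX : AllLp X (stdG I)) : |EHX a M c r q h X| ≤ L * ∫ y, |X y| ∂(stdG I) := by
  have e : ∫ y, |X y| ∂(stdG I) = ∫ z : (I → ℝ) × (J → ℝ), |X z.1| ∂((stdG I).prod (stdG J)) := by
    have := integral_fun_fst (μ := stdG I) (ν := stdG J) (fun y => |X y|)
    simpa using this.symm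
  unfold EHX
  rw [e, ← integral_const_mul, ← Real.norm_eq_abs]
  refine norm_integral_le_of_norm_le ((allLp_fst hX).abs.integrable.const_mul L)
    (Filter.Eventually.of_forall fun z => ?_)
  rw [Real.norm_eq_abs, abs_mul]
  exact mul_le_mul_of_nonneg_right (hb _) (abs_nonneg _)

/-- The `i0` trick. -/
lemma EHX_trick (a : ι → I → ℝ) (M : ι → I → I → ℝ) (c : ι → J → ℝ) (r q : ℝ)
    (P : (ι → ℝ) → ℝ) (H : ι → (ι → ℝ) → ℝ) (hd : ∀ v, HasFDerivAt P (asm fun j => H j v) v)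
    (hH : ∀ j, Continuous (H j)) (L1 L2 : ℝ) (b1 : ∀ v, |P v| ≤ L1) (b2 : ∀ j v, |H j v| ≤ L2)
    {X : (I → ℝ) → ℝ} (hX : AllLp X (stdG I)) (i : ι) :
    ∫ z : (I → ℝ) × (J → ℝ), Nv c z.2 i * P (Zv a M c r q z.1 z.2) * X z.1 ∂((stdG I).prod (stdG J))
     = q * ∑ j, (∑ k, c i k * c j k) * EHX a M c r q (H j) X := by
  have hPc : Continuous P := continuous_iff_continuousAt.2 fun x => (hd x).continuousAt
  have aP := allLp_hZ a M c r q hPc L1 b1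
  have aH := fun j => allLp_hZ a M c r q (hH j) L2 (b2 j)
  rw [integral_prod _ (((allLp_snd (allLp_Nv c i)).mul aP).mul (allLp_fst hX)).integrable]
  simp only [integral_mul_const]
  have e1 : ∀ y, ∫ g, Nv c g i * P (Zv a M c r q y g) ∂(stdG J) = q * ∑ j, (∑ k, c i k * c j k) *
      ∫ g, H j (Zv a M c r q y g) ∂(stdG J) := fun y =>
    ibp_g c P H hd hH L1 L2 b1 b2 q (fun j => r * Fv a M y j) i
  simp_rw [e1]
  have e2 : ∀ j, EHX a M c r q (H j) X =
      ∫ y, (∫ g, H j (Zv a M c r q y g) ∂(stdG J)) * X y ∂(stdG I) := by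
    intro j
    unfold EHX
    rw [integral_prod _ ((aH j).mul (allLp_fst hX)).integrable]
    simp only [integral_mul_const]
  have e3 : ∀ j, Integrable (fun y => (∫ g, H j (Zv a M c r q y g) ∂(stdG J)) * X y) (stdG I) := by
    intro j
    have := ((aH j).mul (allLp_fst hX)).integrable.integral_prod_left
    simpa only [integral_mul_const] using this
  simp_rw [e2, ← integral_const_mul]
  rw [← integral_finsetSum _ fun j _ => (e3 j).const_mul _, ← integral_const_mul]
  congr 1; ext y
  rw [mul_assoc, Finset.sum_mul]
  congr 1
  refine Finset.sum_congr rfl fun j _ => by rw [integral_const_mul]; ring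

/-- Derivative integral in closed form. -/
lemma path_deriv_eq (a : ι → I → ℝ) (M : ι → I → I → ℝ) (hs : ∀ i k l, M i k l = M i l k) (c : ι → J → ℝ)
    (hcov : ∀ i j, ∑ k, c i k * c j k = Sg a M i j) (r q : ℝ)
    {ψ : (ι → ℝ) → ℝ} {P : ι → (ι → ℝ) → ℝ} {H : ι → ι → (ι → ℝ) → ℝ} {L1 L2 : ℝ}
    (hC : C2 ψ P H L1 L2) :
    ∫ z : (I → ℝ) × (J → ℝ), ∑ i, P i (Zv a M c r q z.1 z.2) * (q * Fv a M z.1 i - r * Nv c z.2 i)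
      ∂((stdG I).prod (stdG J)) = r * q * ∑ i, ∑ j, EHX a M c r q (H i j) (Xf a M i j) := by
  have hPc : ∀ i, Continuous (P i) := fun i =>
    continuous_iff_continuousAt.2 fun x => (hC.d2 i x).continuousAt
  have aP := fun i => allLp_hZ a M c r q (hPc i) L1 (hC.b1 i)
  have aH := fun i j => allLp_hZ a M c r q (hC.cH i j) L2 (hC.b2 i j)
  have aF := fun i => allLp_fst (ν := stdG J) (allLp_Fv a M i)
  have aN := fun i => allLp_snd (μ := stdG I) (allLp_Nv c i)
  have aX := fun i j => allLp_fst (ν := stdG J) (allLp_Xf a M i j)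
  have e0 : ∀ z : (I → ℝ) × (J → ℝ), ∀ i,
      P i (Zv a M c r q z.1 z.2) * (q * Fv a M z.1 i - r * Nv c z.2 i) =
      q * (Fv a M z.1 i * P i (Zv a M c r q z.1 z.2)) - r * (Nv c z.2 i * P i (Zv a M c r q z.1 z.2)) := by
    intro z i; ring
  simp_rw [e0]
  rw [integral_finsetSum _ fun i _ =>
    ((((aF i).mul (aP i)).const_mul q).sub (((aN i).mul (aP i)).const_mul r)).integrable, Finset.mul_sum]
  refine Finset.sum_congr rfl fun i _ => ?_
  rw [integral_sub (((aF i).mul (aP i)).const_mul q).integrable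
    (((aN i).mul (aP i)).const_mul r).integrable, integral_const_mul, integral_const_mul]
  have hN := EHX_trick a M c r q (P i) (H i) (hC.d2 i) (hC.cH i) L1 L2 (hC.b1 i) (hC.b2 i)
    (X := fun _ => 1) (AllLp.const 1) i
  simp only [mul_one] at hN
  rw [hN]
  have hF : ∫ z : (I → ℝ) × (J → ℝ), Fv a M z.1 i * P i (Zv a M c r q z.1 z.2)
      ∂((stdG I).prod (stdG J)) = r * ∑ j, (Sg a M i j * EHX a M c r q (H i j) (fun _ => 1)
        + EHX a M c r q (H i j) (Xf a M i j)) := by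
    rw [integral_prod_symm _ ((aF i).mul (aP i)).integrable]
    have e1 : ∀ g : J → ℝ, ∫ y, Fv a M y i * P i (Zv a M c r q y g) ∂(stdG I) = r * ∑ j,
        ∫ y, H i j (Zv a M c r q y g) * (Sg a M i j + Xf a M i j y) ∂(stdG I) := fun g =>
      ibp_y a M hs (P i) (H i) (hC.d2 i) (hC.cH i) L1 L2 (hC.b1 i) (hC.b2 i) r
        (fun j => q * Nv c g j) i
    simp_rw [e1]
    have e2 := fun j => (((aH i j).mul ((AllLp.const (Sg a M i j)).add (aX i j))).integrable)
    rw [integral_const_mul, integral_finsetSum _ fun j _ => (e2 j).integral_prod_right]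
    congr 1
    refine Finset.sum_congr rfl fun j _ => ?_
    rw [← integral_prod_symm _ (e2 j)]
    unfold EHX
    simp only [mul_one]
    rw [← integral_const_mul, ← integral_add ((aH i j).const_mul _).integrable
      ((aH i j).mul (aX i j)).integrable]
    congr 1; ext z; ring
  rw [hF]
  simp_rw [hcov]
  rw [Finset.sum_add_distrib]
  ring

/-- Bound on one entry. -/
lemma entry_bound (a : ι → I → ℝ) (M : ι → I → I → ℝ) (hs : ∀ i k l, M i k l = M i l k) (c : ι → J → ℝ)
    (hcov : ∀ i j, ∑ k, c i k * c j k = Sg a M i j) (r q : ℝ) (hq0 : 0 ≤ q) (hq1 : q ≤ 1)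
    {ψ : (ι → ℝ) → ℝ} {P : ι → (ι → ℝ) → ℝ} {H : ι → ι → (ι → ℝ) → ℝ} {L1 L2 : ℝ}
    (hL1 : 0 ≤ L1) (hL2 : 0 ≤ L2)
    (hC : C2 ψ P H L1 L2) (κ : ℝ) (hκ : 0 ≤ κ) (hop : ∀ i, OpB (M i) κ) (i0 : ι)
    (h1 : ∀ i, i ≠ i0 → Sg a M i i ≤ 1) (i j : ι) :
    q * |EHX a M c r q (H i j) (Xf a M i j)| ≤ 4 * κ * (L1 + (Fintype.card ι + 1) * L2) := by
  have hr : (0 : ℝ) ≤ Fintype.card ι := Nat.cast_nonneg _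
  have simple : ∀ t, 0 ≤ t → t ≤ 1 → Sg a M i i ≤ t ^ 2 → Sg a M j j ≤ t ^ 2 →
      q * |EHX a M c r q (H i j) (Xf a M i j)| ≤ 4 * κ * (L1 + (Fintype.card ι + 1) * L2) := by
    intro t ht ht1 hi hj
    have hX := int_abs_Xf a M hs κ hκ hop i j t ht hi hj
    have := EHX_le a M c r q L2 (hC.b2 i j) (allLp_Xf a M i j)
    have h3 : L2 * ∫ y, |Xf a M i j y| ∂(stdG I) ≤ L2 * (4 * κ) :=
      mul_le_mul_of_nonneg_left (hX.trans (by nlinarith)) hL2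
    have h4 : q * |EHX a M c r q (H i j) (Xf a M i j)| ≤ |EHX a M c r q (H i j) (Xf a M i j)| :=
      mul_le_of_le_one_left (abs_nonneg _) hq1
    have h5 : 0 ≤ κ * L2 := mul_nonneg hκ hL2
    have h6 : 0 ≤ κ * L1 := mul_nonneg hκ hL1
    have h7 := mul_nonneg hr h5
    nlinarith
  by_cases hs0 : Sg a M i0 i0 ≤ 1
  · have : ∀ i, Sg a M i i ≤ 1 ^ 2 := by
      intro i
      by_cases h : i = i0
      · rw [h]; simpa using hs0
      · simpa using h1 i h
    exact simple 1 zero_le_one le_rfl (this i) (this j)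
  by_cases hij : i ≠ i0 ∧ j ≠ i0
  · exact simple 1 zero_le_one le_rfl (by simpa using h1 i hij.1) (by simpa using h1 j hij.2)
  push Not at hs0
  set T := Real.sqrt (Sg a M i0 i0) with hT
  have hT2 : T ^ 2 = Sg a M i0 i0 := Real.sq_sqrt (by linarith)
  have hT1 : 1 ≤ T := by rw [hT, Real.one_le_sqrt]; exact hs0.le
  have hle : ∀ i, Sg a M i i ≤ T ^ 2 := by
    intro i
    by_cases h : i = i0
    · rw [h, hT2]
    · rw [hT2]; exact (h1 i h).trans hs0.le
  have hX := int_abs_Xf a M hs κ hκ hop i j T (by linarith) (hle i) (hle j)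
  set X := Xf a M i j with hXd
  set EX := ∫ y, |X y| ∂(stdG I) with hEX
  have hEX0 : 0 ≤ EX := integral_nonneg fun _ => abs_nonneg _
  have aX : AllLp X (stdG I) := allLp_Xf a M i j
  -- the index k with H i j = H k i0
  have claim : ∀ k, q * T * |EHX a M c r q (H k i0) X| ≤ (L1 + Fintype.card ι * L2) * EX := by
    intro k
    have htr := EHX_trick a M c r q (P k) (H k) (hC.d2 k) (hC.cH k) L1 L2 (hC.b1 k) (hC.b2 k)
      aX i0
    have hPc : Continuous (P k) := continuous_iff_continuousAt.2 fun x => (hC.d2 k x).continuousAt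
    have hN : ∫ g, |Nv c g i0| ∂(stdG J) ≤ T := by
      refine (int_abs_dotp_le _).trans ?_
      rw [hT, ← hcov]
      simp_rw [pow_two]; exact le_rfl
    have hlhs : |∫ z : (I → ℝ) × (J → ℝ), Nv c z.2 i0 * P k (Zv a M c r q z.1 z.2) * X z.1
        ∂((stdG I).prod (stdG J))| ≤ L1 * T * EX := by
      calc _ ≤ ∫ z : (I → ℝ) × (J → ℝ), |X z.1| * (L1 * |Nv c z.2 i0|) ∂((stdG I).prod (stdG J)) := by
            rw [← Real.norm_eq_abs]
            refine norm_integral_le_of_norm_le ((allLp_fst aX).abs.mul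
              ((allLp_snd (allLp_Nv c i0)).abs.const_mul L1)).integrable
              (Filter.Eventually.of_forall fun z => ?_)
            rw [Real.norm_eq_abs, abs_mul, abs_mul, mul_comm]
            refine mul_le_mul_of_nonneg_left ?_ (abs_nonneg _)
            rw [mul_comm]
            exact mul_le_mul_of_nonneg_right (hC.b1 _ _) (abs_nonneg _)
        _ = EX * (L1 * ∫ g, |Nv c g i0| ∂(stdG J)) := by
            rw [integral_prod_mul (fun y => |X y|) (fun g => L1 * |Nv c g i0|), integral_const_mul]
        _ ≤ EX * (L1 * T) := by gcongr
        _ = _ := by ring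
    rw [htr] at hlhs
    have hcs : ∀ j, j ≠ i0 → |∑ k, c i0 k * c j k| ≤ T := by
      intro j hj
      apply abs_le_of_sq_le_sq _ (by linarith)
      have := Finset.sum_mul_sq_le_sq_mul_sq Finset.univ (c i0) (c j)
      refine this.trans ?_
      simp_rw [pow_two (c _ _)]
      rw [hcov, hcov, ← hT2]
      exact mul_le_of_le_one_right (sq_nonneg _) (h1 j hj)
    rw [← Finset.add_sum_erase _ _ (Finset.mem_univ i0), hcov, ← hT2] at hlhs
    have hrest : |∑ j ∈ Finset.univ.erase i0, (∑ k, c i0 k * c j k) * EHX a M c r q (H k j) X| ≤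
        Fintype.card ι * (T * (L2 * EX)) := by
      refine (Finset.abs_sum_le_sum_abs _ _).trans ?_
      refine (Finset.sum_le_card_nsmul _ _ (T * (L2 * EX)) ?_).trans ?_
      · intro j hj
        rw [abs_mul]
        refine mul_le_mul (hcs j (Finset.ne_of_mem_erase hj))
          (EHX_le a M c r q L2 (hC.b2 k j) aX) (abs_nonneg _) (by linarith)
      · rw [nsmul_eq_mul]
        refine mul_le_mul_of_nonneg_right ?_ (by positivity)
        exact_mod_cast Finset.card_le_univ _
    set R := ∑ j ∈ Finset.univ.erase i0, (∑ k, c i0 k * c j k) * EHX a M c r q (H k j) X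
    set E := EHX a M c r q (H k i0) X
    have h8 : q * T ^ 2 * |E| ≤ L1 * T * EX + q * |R| := by
      have e : q * T ^ 2 * |E| = |q * (T ^ 2 * E + R) - q * R| := by
        rw [mul_add, add_sub_cancel_right, abs_mul, abs_mul, abs_of_nonneg hq0,
          abs_of_nonneg (sq_nonneg T)]; ring
      rw [e]
      refine (abs_sub _ _).trans (add_le_add hlhs ?_)
      rw [abs_mul, abs_of_nonneg hq0]
    have h9 : q * |R| ≤ Fintype.card ι * (T * (L2 * EX)) :=
      (mul_le_of_le_one_left (abs_nonneg _) hq1).trans hrest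
    have h10 : T * (q * T * |E|) ≤ T * ((L1 + Fintype.card ι * L2) * EX) := by nlinarith
    exact le_of_mul_le_mul_left h10 (by linarith)
  have fin : ∀ k, q * |EHX a M c r q (H k i0) X| ≤ 4 * κ * (L1 + (Fintype.card ι + 1) * L2) := by
    intro k
    have h2 := claim k
    have hA : 0 ≤ L1 + Fintype.card ι * L2 := by positivity
    have h3 : (L1 + Fintype.card ι * L2) * EX ≤ (L1 + Fintype.card ι * L2) * (4 * (κ * T)) :=
      mul_le_mul_of_nonneg_left hX hA
    have h4 : T * (q * |EHX a M c r q (H k i0) X|) ≤ T * ((L1 + Fintype.card ι * L2) * (4 * κ)) := by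
      nlinarith
    have h5 := le_of_mul_le_mul_left h4 (by linarith)
    have h6 := mul_nonneg hκ hL2
    nlinarith
  by_cases hj : j = i0
  · rw [hj]; exact fin i
  · have hi : i = i0 := by
      by_contra h; exact hij ⟨h, hj⟩
    have : H i j = H j i0 := by rw [hi]; ext v; exact hC.symm i0 j v
    rw [this]; exact fin j

end core2

set_option linter.unusedSectionVars false

section core3
variable {ι I J : Type*} [Fintype ι] [DecidableEq ι] [Fintype I] [DecidableEq I] [Fintype J]
  [DecidableEq J]

lemma norm_le_sum (v : ι → ℝ) : ‖v‖ ≤ ∑ i, |v i| := by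
  rw [pi_norm_le_iff_of_nonneg (Finset.sum_nonneg fun i _ => abs_nonneg _)]
  intro i
  exact Finset.single_le_sum (f := fun i => |v i|) (fun i _ => abs_nonneg _) (Finset.mem_univ i)

lemma lip_cont {Ψ : (ι → ℝ) → ℝ} {L : ℝ} (hL : 0 ≤ L) (h : ∀ u v, |Ψ u - Ψ v| ≤ L * ‖u - v‖) :
    Continuous Ψ := by
  have : LipschitzWith L.toNNReal Ψ := LipschitzWith.of_dist_le_mul fun u v => by
    rw [Real.dist_eq, dist_eq_norm, Real.coe_toNNReal _ hL]; exact h u v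
  exact this.continuous

lemma lip_growth {Ψ : (ι → ℝ) → ℝ} {L : ℝ} (hL : 0 ≤ L) (h : ∀ u v, |Ψ u - Ψ v| ≤ L * ‖u - v‖)
    (v : ι → ℝ) : |Ψ v| ≤ |Ψ 0| + L * ∑ i, |v i| := by
  have h1 := h v 0
  rw [sub_zero] at h1
  have h2 := mul_le_mul_of_nonneg_left (norm_le_sum v) hL
  have h3 : |Ψ v| ≤ |Ψ 0| + |Ψ v - Ψ 0| := by
    have := abs_add_le (Ψ 0) (Ψ v - Ψ 0)
    rwa [add_sub_cancel] at this
  linarith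

lemma allLp_lip {Ω : Type*} [MeasurableSpace Ω] {μ : Measure Ω} [IsProbabilityMeasure μ]
    {Ψ : (ι → ℝ) → ℝ} {L : ℝ} (hL : 0 ≤ L) (h : ∀ u v, |Ψ u - Ψ v| ≤ L * ‖u - v‖)
    {v : Ω → ι → ℝ} (hv : ∀ i, AllLp (fun x => v x i) μ) : AllLp (fun x => Ψ (v x)) μ := by
  have hm : AEStronglyMeasurable v μ := by
    have : AEMeasurable v μ := aemeasurable_pi_lambda _ fun i => (hv i).aesm.aemeasurable
    exact this.aestronglyMeasurable
  refine AllLp.mono (g := fun x => |Ψ 0| + L * ∑ i, |v x i|) ?_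
    ((lip_cont hL h).comp_aestronglyMeasurable hm) fun x => lip_growth hL h _
  exact (AllLp.const _).add (AllLp.const_mul _ (AllLp.sum fun i _ => (hv i).abs))

/-- Smooth version of the core comparison. -/
lemma core_smooth (a : ι → I → ℝ) (M : ι → I → I → ℝ) (hs : ∀ i k l, M i k l = M i l k)
    (c : ι → J → ℝ) (hcov : ∀ i j, ∑ k, c i k * c j k = Sg a M i j)
    {ψ : (ι → ℝ) → ℝ} {P : ι → (ι → ℝ) → ℝ} {H : ι → ι → (ι → ℝ) → ℝ} {L1 L2 : ℝ}
    (hL1 : 0 ≤ L1) (hL2 : 0 ≤ L2)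
    (hC : C2 ψ P H L1 L2) (κ : ℝ) (hκ : 0 ≤ κ) (hop : ∀ i, OpB (M i) κ) (i0 : ι)
    (h1 : ∀ i, i ≠ i0 → Sg a M i i ≤ 1) :
    |∫ y, ψ (Fv a M y) ∂(stdG I) - ∫ g, ψ (Nv c g) ∂(stdG J)| ≤
      8 * (Fintype.card ι) ^ 2 * κ * (L1 + (Fintype.card ι + 1) * L2) := by
  set μ := (stdG I).prod (stdG J) with hμ
  set B := 4 * κ * (L1 + (Fintype.card ι + 1) * L2) with hB
  have hB0 : 0 ≤ B := by positivity
  let u : ℝ → ℝ := fun α => ∫ z : (I → ℝ) × (J → ℝ),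
    ψ (Zv a M c (Real.sin α) (Real.cos α) z.1 z.2) ∂μ
  let u' : ℝ → ℝ := fun α => ∫ z : (I → ℝ) × (J → ℝ),
    ∑ i, P i (Zv a M c (Real.sin α) (Real.cos α) z.1 z.2) *
      (Real.cos α * Fv a M z.1 i - Real.sin α * Nv c z.2 i) ∂μ
  have hPc : ∀ i, Continuous (P i) := fun i =>
    continuous_iff_continuousAt.2 fun x => (hC.d2 i x).continuousAt
  have hψc : Continuous ψ := lip_cont hL1 hC.lip
  have aF := fun i => allLp_fst (ν := stdG J) (allLp_Fv a M i)
  have aN := fun i => allLp_snd (μ := stdG I) (allLp_Nv c i)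
  have aP := fun α i => allLp_hZ a M c (Real.sin α) (Real.cos α) (hPc i) L1 (hC.b1 i)
  have aψ : ∀ α, AllLp (fun z : (I → ℝ) × (J → ℝ) =>
      ψ (Zv a M c (Real.sin α) (Real.cos α) z.1 z.2)) μ := fun α =>
    allLp_lip hL1 hC.lip fun i => ((aF i).const_mul _).add ((aN i).const_mul _)
  have hder : ∀ α, HasDerivAt u (u' α) α := by
    intro α
    have key := hasDerivAt_integral_of_dominated_loc_of_deriv_le (μ := μ) (x₀ := α)
      (F := fun α z => ψ (Zv a M c (Real.sin α) (Real.cos α) z.1 z.2))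
      (bound := fun z => ∑ i, L1 * (|Fv a M z.1 i| + |Nv c z.2 i|))
      (F' := fun α z => ∑ i, P i (Zv a M c (Real.sin α) (Real.cos α) z.1 z.2) *
        (Real.cos α * Fv a M z.1 i - Real.sin α * Nv c z.2 i))
      (s := Set.univ) Filter.univ_mem ?_ (aψ α).integrable ?_ ?_ ?_ ?_
    · exact key.2
    · exact Filter.Eventually.of_forall fun α => (aψ α).aesm
    · exact (AllLp.sum fun i _ => (aP α i).mul (((aF i).const_mul _).sub ((aN i).const_mul _))).aesm
    · refine Filter.Eventually.of_forall fun z α _ => ?_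
      refine (norm_sum_le _ _).trans (Finset.sum_le_sum fun i _ => ?_)
      rw [Real.norm_eq_abs, abs_mul]
      refine mul_le_mul (hC.b1 _ _) ?_ (abs_nonneg _) hL1
      refine (abs_sub _ _).trans (add_le_add ?_ ?_)
      · rw [abs_mul]; exact mul_le_of_le_one_left (abs_nonneg _) (Real.abs_cos_le_one _)
      · rw [abs_mul]; exact mul_le_of_le_one_left (abs_nonneg _) (Real.abs_sin_le_one _)
    · exact (AllLp.sum fun i _ => ((aF i).abs.add (aN i).abs).const_mul L1).integrable
    · refine Filter.Eventually.of_forall fun z α _ => ?_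
      refine hd_curve (v := fun α => Zv a M c (Real.sin α) (Real.cos α) z.1 z.2) (hC.d1 _) fun i => ?_
      have := ((Real.hasDerivAt_sin α).mul_const (Fv a M z.1 i)).add
        ((Real.hasDerivAt_cos α).mul_const (Nv c z.2 i))
      refine this.congr_deriv ?_
      ring
  have hbd : ∀ α ∈ Set.Ico (0 : ℝ) (Real.pi / 2), ‖u' α‖ ≤ (Fintype.card ι) ^ 2 * B := by
    intro α hα
    have hc0 : 0 ≤ Real.cos α := Real.cos_nonneg_of_mem_Icc ⟨by linarith [hα.1, Real.pi_pos], hα.2.le⟩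
    have hs0 : |Real.sin α| ≤ 1 := Real.abs_sin_le_one _
    have e : u' α = _ := path_deriv_eq a M hs c hcov (Real.sin α) (Real.cos α) hC
    rw [e, Real.norm_eq_abs, mul_assoc, abs_mul]
    refine (mul_le_of_le_one_left (abs_nonneg _) hs0).trans ?_
    rw [Finset.mul_sum]
    refine (Finset.abs_sum_le_sum_abs _ _).trans ?_
    refine (Finset.sum_le_card_nsmul _ _ (Fintype.card ι * B) ?_).trans ?_
    · intro i _
      rw [Finset.mul_sum]
      refine (Finset.abs_sum_le_sum_abs _ _).trans ?_
      refine (Finset.sum_le_card_nsmul _ _ B ?_).trans ?_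
      · intro j _
        rw [abs_mul, abs_of_nonneg hc0]
        exact entry_bound a M hs c hcov _ _ hc0 (Real.cos_le_one _) hL1 hL2 hC κ hκ hop i0 h1 i j
      · rw [nsmul_eq_mul]; rfl
    · rw [nsmul_eq_mul, pow_two, mul_assoc]; rfl
  have hfin := norm_image_sub_le_of_norm_deriv_le_segment' (f := u) (f' := u') (a := 0) (b := Real.pi / 2)
    (fun x _ => (hder x).hasDerivWithinAt) hbd (Real.pi / 2) ⟨by positivity, le_rfl⟩
  have u1 : u (Real.pi / 2) = ∫ y, ψ (Fv a M y) ∂(stdG I) := by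
    have h2 := integral_fun_fst (μ := stdG I) (ν := stdG J) (fun y => ψ (Fv a M y))
    simp only [u, Real.sin_pi_div_two, Real.cos_pi_div_two]
    simp only [probReal_univ, one_smul] at h2
    rw [← h2]
    congr 1; ext z; congr 1; ext i; simp [Zv]
  have u0 : u 0 = ∫ y, ψ (Nv c y) ∂(stdG J) := by
    have h2 := integral_fun_snd (μ := stdG I) (ν := stdG J) (fun y => ψ (Nv c y))
    simp only [u, Real.sin_zero, Real.cos_zero]
    simp only [probReal_univ, one_smul] at h2
    rw [← h2]
    congr 1; ext z; congr 1; ext i; simp [Zv]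
  rw [u1, u0, Real.norm_eq_abs, sub_zero] at hfin
  refine hfin.trans ?_
  have hpi : Real.pi / 2 ≤ 2 := by linarith [Real.pi_le_four]
  have : (Fintype.card ι : ℝ) ^ 2 * B * (Real.pi / 2) ≤ (Fintype.card ι : ℝ) ^ 2 * B * 2 :=
    mul_le_mul_of_nonneg_left hpi (by positivity)
  refine this.trans (le_of_eq ?_)
  rw [hB]; ring

/-- Core quantitative CLT. -/
lemma core_clt (ι : Type*) [Fintype ι] [DecidableEq ι] : ∃ C : ℝ, 0 < C ∧
    ∀ (I J : Type) [Fintype I] [DecidableEq I] [Fintype J] [DecidableEq J]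
    (a : ι → I → ℝ) (M : ι → I → I → ℝ) (_ : ∀ i k l, M i k l = M i l k)
    (c : ι → J → ℝ) (_ : ∀ i j, ∑ k, c i k * c j k = Sg a M i j)
    (κ : ℝ) (_ : 0 ≤ κ) (_ : ∀ i, OpB (M i) κ) (i0 : ι)
    (_ : ∀ i, i ≠ i0 → Sg a M i i ≤ 1) (L : ℝ) (_ : 0 ≤ L) (Ψ : (ι → ℝ) → ℝ)
    (_ : ∀ u v, |Ψ u - Ψ v| ≤ L * ‖u - v‖) (δ : ℝ) (_ : 0 < δ),
    |∫ y, Ψ (Fv a M y) ∂(stdG I) - ∫ g, Ψ (Nv c g) ∂(stdG J)| ≤ C * L * (κ / δ + κ + δ) := by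
  obtain ⟨C, hC, hm⟩ := mollify ι
  set r : ℝ := ((Fintype.card ι : ℕ) : ℝ) with hr
  have hr0 : 0 ≤ r := Nat.cast_nonneg _
  refine ⟨2 * C + 8 * r ^ 2 + 8 * r ^ 2 * (r + 1) * C, by positivity, ?_⟩
  intro I J _ _ _ _ a M hs c hcov κ hκ hop i0 h1 L hL Ψ hΨ δ hδ
  obtain ⟨ψ, P, H, hC2, hap⟩ := hm L hL Ψ hΨ δ hδ
  have hsm := core_smooth a M hs c hcov hL (by positivity) hC2 κ hκ hop i0 h1
  have d1 : |∫ y, Ψ (Fv a M y) ∂(stdG I) - ∫ y, ψ (Fv a M y) ∂(stdG I)| ≤ C * L * δ := by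
    rw [← integral_sub (allLp_lip hL hΨ (allLp_Fv a M)).integrable
      (allLp_lip hL hC2.lip (allLp_Fv a M)).integrable, ← Real.norm_eq_abs]
    refine (norm_integral_le_of_norm_le_const (C := C * L * δ)
      (Filter.Eventually.of_forall fun y => ?_)).trans ?_
    · rw [norm_sub_rev]; exact hap _
    · simp
  have d2 : |∫ y, ψ (Nv c y) ∂(stdG J) - ∫ y, Ψ (Nv c y) ∂(stdG J)| ≤ C * L * δ := by
    rw [← integral_sub (allLp_lip hL hC2.lip (allLp_Nv c)).integrable
      (allLp_lip hL hΨ (allLp_Nv c)).integrable, ← Real.norm_eq_abs]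
    refine (norm_integral_le_of_norm_le_const (C := C * L * δ)
      (Filter.Eventually.of_forall fun y => ?_)).trans ?_
    · exact hap _
    · simp
  have t1 := abs_sub_le (∫ y, Ψ (Fv a M y) ∂(stdG I)) (∫ y, ψ (Fv a M y) ∂(stdG I))
    (∫ g, Ψ (Nv c g) ∂(stdG J))
  have t2 := abs_sub_le (∫ y, ψ (Fv a M y) ∂(stdG I)) (∫ g, ψ (Nv c g) ∂(stdG J))
    (∫ g, Ψ (Nv c g) ∂(stdG J))
  have h3 : |∫ y, Ψ (Fv a M y) ∂(stdG I) - ∫ g, Ψ (Nv c g) ∂(stdG J)| ≤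
      2 * (C * L * δ) + 8 * r ^ 2 * κ * (L + (r + 1) * (C * L / δ)) := by
    linarith
  refine h3.trans ?_
  have e : (2 * C + 8 * r ^ 2 + 8 * r ^ 2 * (r + 1) * C) * L * (κ / δ + κ + δ) =
    2 * (C * L * δ) + 8 * r ^ 2 * κ * (L + (r + 1) * (C * L / δ)) +
      (2 * C * L * (κ / δ + κ) + 8 * r ^ 2 * L * (κ / δ + δ) + 8 * r ^ 2 * (r + 1) * C * L * (κ + δ)) := by
    ring
  rw [e]
  have : 0 ≤ 2 * C * L * (κ / δ + κ) + 8 * r ^ 2 * L * (κ / δ + δ)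
    + 8 * r ^ 2 * (r + 1) * C * L * (κ + δ) := by positivity
  linarith

end core3

set_option linter.unusedSectionVars false

section midx
variable {d : ℕ}

/-- The multi-index `e_i + e_j`. -/
def mi (i j : Fin d) : MIdx d 2 := ⟨fun a => (if a = i then 1 else 0) + (if a = j then 1 else 0), by
  rw [Finset.Nat.mem_antidiagonalTuple, Finset.sum_add_distrib]
  simp⟩

lemma mi_apply (i j a : Fin d) :
    (mi i j).1 a = (if a = i then 1 else 0) + (if a = j then 1 else 0) := rfl

lemma mi_comm (i j : Fin d) : mi i j = mi j i := by
  apply Subtype.ext; funext a; rw [mi_apply, mi_apply, add_comm]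

lemma mi_inj {i j k l : Fin d} (h : mi i j = mi k l) : (i = k ∧ j = l) ∨ (i = l ∧ j = k) := by
  have h1 : ∀ a, (mi i j).1 a = (mi k l).1 a := fun a => by rw [h]
  simp only [mi_apply] at h1
  have hi := h1 i
  have hj := h1 j
  have hk := h1 k
  have hl := h1 l
  by_cases c1 : i = k
  · left; refine ⟨c1, ?_⟩
    subst c1
    by_contra c2
    have := fun h : l = j => c2 h.symm
    simp_all
  · right
    by_cases c2 : i = l
    · refine ⟨c2, ?_⟩
      subst c2
      by_contra c3
      have := fun h : k = j => c3 h.symm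
      simp_all
    · simp_all

lemma mi_surj (κ : MIdx d 2) : ∃ i j, κ = mi i j := by
  obtain ⟨κ, hκ⟩ := κ
  rw [Finset.Nat.mem_antidiagonalTuple] at hκ
  have step : ∀ (n : ℕ) (f : Fin d → ℕ), ∑ i, f i = n + 1 →
      ∃ i, ∃ f' : Fin d → ℕ, (∑ a, f' a = n) ∧ ∀ a, f a = f' a + if a = i then 1 else 0 := by
    intro n f hf
    have : ∃ i, f i ≠ 0 := by
      by_contra h
      push Not at h
      simp [h] at hf
    obtain ⟨i, hi⟩ := this
    have h2 : ∀ a, f a = (f a - if a = i then 1 else 0) + if a = i then 1 else 0 := by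
      intro a
      split_ifs with h
      · subst h; omega
      · simp
    refine ⟨i, fun a => f a - if a = i then 1 else 0, ?_, h2⟩
    have h3 : ∑ a, f a = ∑ a, (f a - if a = i then 1 else 0) + 1 := by
      conv_lhs => rw [Finset.sum_congr rfl fun a _ => h2 a]
      rw [Finset.sum_add_distrib]; simp
    show ∑ a, (f a - if a = i then 1 else 0) = n
    omega
  obtain ⟨i, f', hf', e1⟩ := step 1 κ hκ
  obtain ⟨j, f'', hf'', e2⟩ := step 0 f' hf'
  refine ⟨i, j, Subtype.ext (funext fun a => ?_)⟩
  have : f'' a = 0 := by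
    rw [Finset.sum_eq_zero_iff] at hf''
    exact hf'' a (Finset.mem_univ _)
  rw [mi_apply]
  change κ a = _
  rw [e1, e2, this]; ring

/-- Sum over degree-two multi-indices as a weighted sum over pairs. -/
lemma sum_midx (f : MIdx d 2 → ℝ) :
    ∑ κ, f κ = ∑ i, ∑ j, f (mi i j) * (if i = j then 1 else 1 / 2) := by
  have h1 : ∀ κ : MIdx d 2, ∑ p : Fin d × Fin d,
      (if mi p.1 p.2 = κ then (if p.1 = p.2 then (1 : ℝ) else 1 / 2) else 0) = 1 := by
    intro κ
    obtain ⟨k, l, rfl⟩ := mi_surj κ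
    by_cases h : k = l
    · subst h
      rw [Finset.sum_eq_single (k, k)]
      · simp
      · rintro ⟨i, j⟩ _ hne
        rw [if_neg]
        intro h
        rcases mi_inj h with ⟨h1, h2⟩ | ⟨h1, h2⟩ <;> (simp only at h1 h2; subst h1; subst h2; exact hne rfl)
      · simp
    · have hne : ((k, l) : Fin d × Fin d) ≠ (l, k) := by
        intro h'; exact h (congrArg Prod.fst h')
      rw [← Finset.sum_subset (Finset.subset_univ {(k, l), (l, k)})]
      · rw [Finset.sum_pair hne]
        simp only [mi_comm l k, if_true, if_neg h, if_neg (Ne.symm h)]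
        norm_num
      · rintro ⟨i, j⟩ _ hn
        rw [if_neg]
        intro h
        apply hn
        rcases mi_inj h with ⟨h1, h2⟩ | ⟨h1, h2⟩ <;> (simp only at h1 h2; subst h1; subst h2; simp)
  calc ∑ κ, f κ = ∑ κ, f κ * ∑ p : Fin d × Fin d,
        (if mi p.1 p.2 = κ then (if p.1 = p.2 then (1 : ℝ) else 1 / 2) else 0) := by
        simp_rw [h1, mul_one]
    _ = ∑ p : Fin d × Fin d, f (mi p.1 p.2) * (if p.1 = p.2 then 1 else 1 / 2) := by
        simp_rw [Finset.mul_sum]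
        rw [Finset.sum_comm]
        refine Finset.sum_congr rfl fun p _ => ?_
        simp_rw [mul_ite, mul_zero]
        rw [Finset.sum_ite_eq]
        simp
    _ = _ := by rw [Fintype.sum_prod_type]

/-- Symmetric matrix of a degree-two coefficient vector. -/
def Mat (β : MIdx d 2 → ℝ) (i j : Fin d) : ℝ :=
  β (mi i j) * (if i = j then 1 else (Real.sqrt 2)⁻¹)

lemma Mat_symm (β : MIdx d 2 → ℝ) (i j : Fin d) : Mat β i j = Mat β j i := by
  unfold Mat; rw [mi_comm]; simp [eq_comm]

lemma sqrt2_inv_sq : (Real.sqrt 2)⁻¹ * (Real.sqrt 2)⁻¹ = 1 / 2 := by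
  rw [← mul_inv, Real.mul_self_sqrt (by norm_num)]; norm_num

lemma Mat_iso (β γ : MIdx d 2 → ℝ) : ∑ κ, β κ * γ κ = ∑ i, ∑ j, Mat β i j * Mat γ i j := by
  rw [sum_midx]
  refine Finset.sum_congr rfl fun i _ => Finset.sum_congr rfl fun j _ => ?_
  unfold Mat
  split_ifs
  · ring
  · rw [← sqrt2_inv_sq]; ring

lemma He_zero (x : ℝ) : He 0 x = 1 := by simp [He]
lemma He_one (x : ℝ) : He 1 x = x := by simp [He]
lemma He_two (x : ℝ) : He 2 x = (x ^ 2 - 1) * (Real.sqrt 2)⁻¹ := by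
  have : Polynomial.hermite 2 = Polynomial.X * Polynomial.X - 1 := by
    rw [Polynomial.hermite_succ, Polynomial.hermite_one]; simp
  unfold He
  rw [this]
  simp [div_eq_mul_inv, Nat.factorial, pow_two]

lemma Mat_hvec (x : Fin d → ℝ) (i j : Fin d) :
    Mat (hvec d 2 x) i j = (x i * x j - if i = j then 1 else 0) * (Real.sqrt 2)⁻¹ := by
  unfold Mat hvec
  by_cases h : i = j
  · subst h
    simp only [if_true, mul_one]
    rw [Finset.prod_eq_single i]
    · rw [mi_apply]; simp only [if_true]; rw [He_two]; ring
    · intro b _ hb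
      rw [mi_apply, if_neg hb]; exact He_zero _
    · simp
  · simp only [if_neg h, sub_zero]
    congr 1
    have e : ∀ a, He ((mi i j).1 a) (x a) = (if a = i then x a else 1) * (if a = j then x a else 1) := by
      intro a
      rw [mi_apply]
      by_cases h1 : a = i
      · have h2 : a ≠ j := fun h2 => h (h1.symm.trans h2)
        simp [h1, h2, h, He_one]
      · by_cases h2 : a = j
        · simp [h2, Ne.symm h, He_one]
        · simp [h1, h2, He_zero]
    simp_rw [e]
    rw [Finset.prod_mul_distrib]
    simp

lemma dotp_hvec (β : MIdx d 2 → ℝ) (x : Fin d → ℝ) :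
    dotp β (hvec d 2 x) = qf (Mat β) x / Real.sqrt 2 := by
  unfold dotp qf
  rw [Mat_iso, Finset.sum_div]
  refine Finset.sum_congr rfl fun i _ => ?_
  rw [Finset.sum_div]
  refine Finset.sum_congr rfl fun j _ => ?_
  rw [Mat_hvec]; ring

lemma Mat_qvec (w : Fin d → ℝ) (i j : Fin d) : Mat (qvec d 2 w) i j = w i * w j := by
  unfold Mat qvec
  have hp : ∏ a, w a ^ (mi i j).1 a = w i * w j := by
    simp_rw [mi_apply, pow_add]
    rw [Finset.prod_mul_distrib]
    simp
  rw [hp]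
  by_cases h : i = j
  · subst h
    have : ∏ a, ((Nat.factorial ((mi i i).1 a) : ℕ) : ℝ) = 2 := by
      rw [Finset.prod_eq_single i]
      · rw [mi_apply]; simp [Nat.factorial]
      · intro b _ hb
        rw [mi_apply, if_neg hb]; simp
      · simp
    rw [this]; simp [Nat.factorial]
  · have : ∏ a, ((Nat.factorial ((mi i j).1 a) : ℕ) : ℝ) = 1 := by
      apply Finset.prod_eq_one
      intro a _
      rw [mi_apply]
      by_cases h1 : a = i
      · have h2 : a ≠ j := fun h2 => h (h1.symm.trans h2)
        simp [h1, h]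
      · by_cases h2 : a = j
        · simp [h2, Ne.symm h]
        · simp [h1, h2]
    rw [this]
    simp only [if_neg h]
    have h2 : Real.sqrt ((Nat.factorial 2 : ℕ) / 1 : ℝ) = Real.sqrt 2 := by simp [Nat.factorial]
    rw [h2]
    field_simp

lemma Mat_sum {p : ℕ} (θ : Fin p → ℝ) (q : Fin p → MIdx d 2 → ℝ) (i j : Fin d) :
    Mat (fun κ => ∑ n, θ n * q n κ) i j = ∑ n, θ n * Mat (q n) i j := by
  unfold Mat
  rw [Finset.sum_mul]
  refine Finset.sum_congr rfl fun n _ => by ring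

lemma allLp_hv (β : MIdx d 2 → ℝ) : AllLp (fun x => dotp β (hvec d 2 x)) (stdG (Fin d)) := by
  simp_rw [dotp_hvec, div_eq_inv_mul]
  exact (allLp_qf _).const_mul _

lemma int_abs_hv_le (β : MIdx d 2 → ℝ) :
    ∫ x, |dotp β (hvec d 2 x)| ∂(stdG (Fin d)) ≤ Real.sqrt (∑ κ, β κ ^ 2) := by
  simp_rw [dotp_hvec, abs_div, abs_of_nonneg (Real.sqrt_nonneg 2)]
  rw [integral_div]
  have h := int_abs_qf_le (Mat β)
  have e : ∑ κ, β κ ^ 2 = ∑ k, ∑ l, Mat β k l ^ 2 := by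
    simp_rw [pow_two]; exact Mat_iso β β
  rw [Real.sqrt_mul (by norm_num)] at h
  rw [div_le_iff₀ (by positivity), e, mul_comm]
  exact h

/-- Operator bound from the genericity condition. -/
lemma opB_of_fourth (β : MIdx d 2 → ℝ) (h1 : enorm2 β = 1) (τ : ℝ) (hτ : 0 ≤ τ)
    (h4 : ∫ x, (dotp β (hvec d 2 x)) ^ 4 ∂(stdG (Fin d)) ≤ 3 + τ ^ 4) : OpB (Mat β) τ := by
  have hn : ∑ k, ∑ l, Mat β k l ^ 2 = 1 := by
    have : ∑ κ, β κ ^ 2 = 1 := by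
      unfold enorm2 at h1
      rwa [Real.sqrt_eq_one] at h1
    rw [← this]
    simp_rw [pow_two]; exact (Mat_iso β β).symm
  have hf := fourth_moment (Mat β) (Mat_symm β) hn
  have e : ∀ x, (dotp β (hvec d 2 x)) ^ 4 = (1 / 4) * qf (Mat β) x ^ 4 := by
    intro x
    rw [dotp_hvec, div_pow]
    have : Real.sqrt 2 ^ 4 = 4 := by
      rw [show (4 : ℕ) = 2 * 2 from rfl, pow_mul, Real.sq_sqrt (by norm_num)]; norm_num
    rw [this]; ring
  simp_rw [e] at h4
  rw [integral_const_mul, hf] at h4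
  have hM : ∑ k, ∑ l, (mm (Mat β) (Mat β) k l) ^ 2 ≤ (τ ^ 2) ^ 2 := by
    have : 0 ≤ τ ^ 4 := by positivity
    have e : (τ ^ 2) ^ 2 = τ ^ 4 := by ring
    rw [e]
    linarith
  intro v
  set V := ∑ k, v k ^ 2 with hV
  have hV0 : 0 ≤ V := Finset.sum_nonneg fun _ _ => sq_nonneg _
  have e1 : ∑ k, mv (Mat β) v k ^ 2 = ∑ k, v k * mv (mm (Mat β) (Mat β)) v k := by
    have h1 : ∀ k, mv (mm (Mat β) (Mat β)) v k = ∑ l, Mat β k l * mv (Mat β) v l := by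
      intro k
      simp only [mv, mm, Finset.sum_mul, Finset.mul_sum]
      rw [Finset.sum_comm]
      refine Finset.sum_congr rfl fun a _ => Finset.sum_congr rfl fun b _ => by ring
    simp_rw [h1, Finset.mul_sum]
    rw [Finset.sum_comm]
    refine Finset.sum_congr rfl fun l _ => ?_
    rw [pow_two]
    nth_rw 1 [mv]
    rw [Finset.sum_mul]
    refine Finset.sum_congr rfl fun k _ => ?_
    rw [Mat_symm β l k]; ring
  have e2 : ∑ k, mv (mm (Mat β) (Mat β)) v k ^ 2 ≤ (τ ^ 2) ^ 2 * V := by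
    calc _ ≤ ∑ k, (∑ l, (mm (Mat β) (Mat β) k l) ^ 2) * V := Finset.sum_le_sum fun k _ =>
          Finset.sum_mul_sq_le_sq_mul_sq _ _ _
      _ = (∑ k, ∑ l, (mm (Mat β) (Mat β) k l) ^ 2) * V := by rw [Finset.sum_mul]
      _ ≤ _ := mul_le_mul_of_nonneg_right hM hV0
  rw [e1]
  apply le_of_abs_le
  apply abs_le_of_sq_le_sq _ (by positivity)
  calc _ ≤ V * ∑ k, mv (mm (Mat β) (Mat β)) v k ^ 2 := Finset.sum_mul_sq_le_sq_mul_sq _ _ _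
    _ ≤ V * ((τ ^ 2) ^ 2 * V) := mul_le_mul_of_nonneg_left e2 hV0
    _ = _ := by ring

/-- Keep only the coefficients not touching the first `s` coordinates. -/
def msk (s : ℕ) (β : MIdx d 2 → ℝ) (κ : MIdx d 2) : ℝ :=
  if ∀ i : Fin d, (i : ℕ) < s → κ.1 i = 0 then β κ else 0

/-- Keep only the coefficients supported on the first `s` coordinates. -/
def mskS (s : ℕ) (β : MIdx d 2 → ℝ) (κ : MIdx d 2) : ℝ :=
  if ∀ i : Fin d, s ≤ (i : ℕ) → κ.1 i = 0 then β κ else 0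

lemma mi_perp (s : ℕ) (i j : Fin d) :
    (∀ a : Fin d, (a : ℕ) < s → (mi i j).1 a = 0) ↔ s ≤ (i : ℕ) ∧ s ≤ (j : ℕ) := by
  constructor
  · intro h
    constructor
    · by_contra hc
      have := h i (by omega)
      rw [mi_apply] at this; simp at this
    · by_contra hc
      have := h j (by omega)
      rw [mi_apply] at this; simp at this
  · rintro ⟨h1, h2⟩ a ha
    rw [mi_apply, if_neg (by rintro rfl; omega), if_neg (by rintro rfl; omega)]

lemma mi_par (s : ℕ) (i j : Fin d) :
    (∀ a : Fin d, s ≤ (a : ℕ) → (mi i j).1 a = 0) ↔ (i : ℕ) < s ∧ (j : ℕ) < s := by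
  constructor
  · intro h
    constructor
    · by_contra hc
      have := h i (by omega)
      rw [mi_apply] at this; simp at this
    · by_contra hc
      have := h j (by omega)
      rw [mi_apply] at this; simp at this
  · rintro ⟨h1, h2⟩ a ha
    rw [mi_apply, if_neg (by rintro rfl; omega), if_neg (by rintro rfl; omega)]

lemma Mat_msk (s : ℕ) (β : MIdx d 2 → ℝ) (i j : Fin d) :
    Mat (msk s β) i j = if s ≤ (i : ℕ) ∧ s ≤ (j : ℕ) then Mat β i j else 0 := by
  unfold Mat msk
  simp_rw [mi_perp]
  split_ifs <;> simp

lemma Mat_mskS (s : ℕ) (β : MIdx d 2 → ℝ) (i j : Fin d) :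
    Mat (mskS s β) i j = if (i : ℕ) < s ∧ (j : ℕ) < s then Mat β i j else 0 := by
  unfold Mat mskS
  simp_rw [mi_par]
  split_ifs <;> simp

lemma OpB.msk {s : ℕ} {β : MIdx d 2 → ℝ} {τ : ℝ} (h : OpB (Mat β) τ) : OpB (Mat (msk s β)) τ := by
  intro v
  have h1 := h (fun k => if s ≤ (k : ℕ) then v k else 0)
  calc ∑ k, mv (Mat (_root_.msk s β)) v k ^ 2
      ≤ ∑ k, mv (Mat β) (fun k => if s ≤ (k : ℕ) then v k else 0) k ^ 2 := by
        refine Finset.sum_le_sum fun k _ => ?_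
        by_cases hk : s ≤ (k : ℕ)
        · apply le_of_eq; congr 1
          unfold mv
          refine Finset.sum_congr rfl fun l _ => ?_
          rw [Mat_msk]
          by_cases hl : s ≤ (l : ℕ) <;> simp [hk, hl]
        · have : mv (Mat (_root_.msk s β)) v k = 0 := by
            unfold mv
            apply Finset.sum_eq_zero
            intro l _
            rw [Mat_msk, if_neg (fun h => hk h.1), zero_mul]
          rw [this]; simp [sq_nonneg]
    _ ≤ _ := h1
    _ ≤ _ := by
        refine mul_le_mul_of_nonneg_left (Finset.sum_le_sum fun k _ => ?_) (sq_nonneg _)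
        split_ifs
        · exact le_rfl
        · simp [sq_nonneg]

lemma msk_sum_sq_le (s : ℕ) (β : MIdx d 2 → ℝ) : ∑ κ, msk s β κ ^ 2 ≤ ∑ κ, β κ ^ 2 := by
  refine Finset.sum_le_sum fun κ _ => ?_
  unfold msk
  split_ifs
  · exact le_rfl
  · simp [sq_nonneg]

lemma Mat_sub (β γ : MIdx d 2 → ℝ) (i j : Fin d) :
    Mat (fun κ => β κ - γ κ) i j = Mat β i j - Mat γ i j := by unfold Mat; ring

lemma card_lt (s : ℕ) : ∑ i : Fin d, (if (i : ℕ) < s then (1 : ℝ) else 0) ≤ s := by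
  rw [Finset.sum_boole]
  have : (Finset.univ.filter fun i : Fin d => (i : ℕ) < s).card ≤ (Finset.range s).card := by
    refine Finset.card_le_card_of_injOn (fun i => (i : ℕ)) ?_ ?_
    · intro i hi; simpa using hi
    · intro i _ j _ h; exact Fin.ext h
  rw [Finset.card_range] at this
  exact_mod_cast this

/-- Mass of the coefficients touching the first `s` coordinates. -/
lemma trunc_bound (s : ℕ) (β : MIdx d 2 → ℝ) (τ : ℝ) (h : OpB (Mat β) τ) :
    ∑ κ, (β κ - msk s β κ) ^ 2 ≤ 2 * s * τ ^ 2 := by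
  have e : ∑ κ, (β κ - msk s β κ) ^ 2 = ∑ i, ∑ j, (Mat (fun κ => β κ - msk s β κ) i j) ^ 2 := by
    simp_rw [pow_two]; exact Mat_iso _ _
  have row : ∀ i, ∑ j, Mat β i j ^ 2 ≤ τ ^ 2 := by
    intro i
    have := h (fun k => if k = i then 1 else 0)
    simp only [mv, mul_ite, mul_one, mul_zero, ite_pow, one_pow, ne_eq, OfNat.ofNat_ne_zero,
      not_false_eq_true, zero_pow, Finset.sum_ite_eq', Finset.mem_univ, if_true] at this
    simp_rw [Mat_symm β i _]
    exact this
  rw [e]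
  have pt : ∀ i j, (Mat (fun κ => β κ - msk s β κ) i j) ^ 2 ≤
      (if (i : ℕ) < s then 1 else 0) * Mat β i j ^ 2 + (if (j : ℕ) < s then 1 else 0) * Mat β j i ^ 2 := by
    intro i j
    rw [Mat_sub, Mat_msk, Mat_symm β j i]
    by_cases hi : (i : ℕ) < s
    · have : ¬ (s ≤ (i : ℕ) ∧ s ≤ (j : ℕ)) := by omega
      simp only [if_neg this, if_pos hi, sub_zero, one_mul]
      split_ifs <;> nlinarith [sq_nonneg (Mat β i j)]
    · by_cases hj : (j : ℕ) < s
      · have : ¬ (s ≤ (i : ℕ) ∧ s ≤ (j : ℕ)) := by omega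
        simp [this, hi, hj]
      · have : (s ≤ (i : ℕ) ∧ s ≤ (j : ℕ)) := by omega
        simp [this, hi, hj]
  have half : ∑ i : Fin d, ∑ j, (if (i : ℕ) < s then 1 else 0) * Mat β i j ^ 2 ≤ s * τ ^ 2 := by
    simp_rw [← Finset.mul_sum]
    calc _ ≤ ∑ i : Fin d, (if (i : ℕ) < s then (1 : ℝ) else 0) * τ ^ 2 :=
          Finset.sum_le_sum fun i _ => mul_le_mul_of_nonneg_left (row i) (by split_ifs <;> norm_num)
      _ ≤ _ := by
          rw [← Finset.sum_mul]
          exact mul_le_mul_of_nonneg_right (card_lt s) (sq_nonneg _)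
  calc _ ≤ ∑ i : Fin d, ∑ j : Fin d, ((if (i : ℕ) < s then 1 else 0) * Mat β i j ^ 2
          + (if (j : ℕ) < s then 1 else 0) * Mat β j i ^ 2) :=
        Finset.sum_le_sum fun i _ => Finset.sum_le_sum fun j _ => pt i j
    _ = ∑ i : Fin d, ∑ j, (if (i : ℕ) < s then 1 else 0) * Mat β i j ^ 2
          + ∑ i : Fin d, ∑ j, (if (i : ℕ) < s then 1 else 0) * Mat β i j ^ 2 := by
        simp_rw [Finset.sum_add_distrib]
        congr 1
        rw [Finset.sum_comm]
    _ ≤ _ := by linarith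

/-- Mass of the cross coefficients. -/
lemma cross_bound (s : ℕ) (β : MIdx d 2 → ℝ) :
    ∑ κ, (β κ - msk s β κ - mskS s β κ) ^ 2 =
      2 * ∑ i : Fin d, ∑ j : Fin d, (if (i : ℕ) < s ∧ s ≤ (j : ℕ) then Mat β i j ^ 2 else 0) := by
  have e : ∑ κ, (β κ - msk s β κ - mskS s β κ) ^ 2 =
      ∑ i, ∑ j, (Mat (fun κ => β κ - msk s β κ - mskS s β κ) i j) ^ 2 := by
    simp_rw [pow_two]; exact Mat_iso _ _
  have pt : ∀ i j, (Mat (fun κ => β κ - msk s β κ - mskS s β κ) i j) ^ 2 =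
      (if (i : ℕ) < s ∧ s ≤ (j : ℕ) then Mat β i j ^ 2 else 0)
       + (if (j : ℕ) < s ∧ s ≤ (i : ℕ) then Mat β j i ^ 2 else 0) := by
    intro i j
    rw [Mat_sub, Mat_sub, Mat_msk, Mat_mskS, Mat_symm β j i]
    by_cases hi : (i : ℕ) < s <;> by_cases hj : (j : ℕ) < s
    · simp [hi, hj, not_le.2 hi, not_le.2 hj]
    · simp [hi, hj, not_le.2 hi, not_lt.1 hj]
    · simp [hi, hj, not_lt.1 hi, not_le.2 hj]
    · simp [hi, hj, not_lt.1 hi, not_lt.1 hj]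
  rw [e]
  simp_rw [pt, Finset.sum_add_distrib]
  rw [two_mul]
  congr 1
  rw [Finset.sum_comm]

end midx

set_option linter.unusedSectionVars false

section cond
variable {ι : Type*} [Fintype ι] [DecidableEq ι]

lemma integral_mp {Ω Ω' : Type*} [MeasurableSpace Ω] [MeasurableSpace Ω'] {μ : Measure Ω}
    {ν : Measure Ω'} {T : Ω → Ω'} (hT : MeasurePreserving T μ ν) {f : Ω' → ℝ}
    (hf : AEStronglyMeasurable f ν) : ∫ x, f (T x) ∂μ = ∫ y, f y ∂ν := by
  have h := integral_map (μ := μ) hT.measurable.aemeasurable (f := f) (by rw [hT.map_eq]; exact hf)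
  rw [hT.map_eq] at h
  exact h.symm

lemma lip_diff {Ω : Type*} [MeasurableSpace Ω] {μ : Measure Ω} [IsProbabilityMeasure μ]
    {Ψ : (ι → ℝ) → ℝ} {L : ℝ} (hL : 0 ≤ L) (h : ∀ u v, |Ψ u - Ψ v| ≤ L * ‖u - v‖)
    {U V : Ω → ι → ℝ} (hU : ∀ i, AllLp (fun x => U x i) μ) (hV : ∀ i, AllLp (fun x => V x i) μ) :
    |∫ x, Ψ (U x) ∂μ - ∫ x, Ψ (V x) ∂μ| ≤ L * ∑ i, ∫ x, |U x i - V x i| ∂μ := by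
  rw [← integral_sub (allLp_lip hL h hU).integrable (allLp_lip hL h hV).integrable]
  have hd : ∀ i, AllLp (fun x => |U x i - V x i|) μ := fun i => ((hU i).sub (hV i)).abs
  rw [← integral_finsetSum _ fun i _ => (hd i).integrable, ← integral_const_mul, ← Real.norm_eq_abs]
  refine norm_integral_le_of_norm_le
    (((AllLp.sum fun i (_ : i ∈ Finset.univ) => hd i).const_mul L).integrable)
    (Filter.Eventually.of_forall fun x => ?_)
  rw [Real.norm_eq_abs]
  refine (h _ _).trans (mul_le_mul_of_nonneg_left ?_ hL)
  exact norm_le_sum (U x - V x)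

/-- Conditional version of the core comparison. -/
lemma cond_clt (ι : Type*) [Fintype ι] [DecidableEq ι] : ∃ C : ℝ, 0 < C ∧
    ∀ (I J : Type) [Fintype I] [DecidableEq I] [Fintype J] [DecidableEq J]
      (R Ω1 Ω2 : Type) [MeasurableSpace R] [MeasurableSpace Ω1] [MeasurableSpace Ω2]
      (ρ : Measure R) (P1 : Measure Ω1) (P2 : Measure Ω2) [IsProbabilityMeasure ρ]
      [IsProbabilityMeasure P1] [IsProbabilityMeasure P2]
      (a : ι → I → ℝ) (M : ι → I → I → ℝ), (∀ i k l, M i k l = M i l k) →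
      ∀ (c : ι → J → ℝ), (∀ i j, ∑ k, c i k * c j k = Sg a M i j) →
      ∀ κ : ℝ, 0 ≤ κ → (∀ i, OpB (M i) κ) → ∀ i0 : ι, (∀ i, i ≠ i0 → Sg a M i i ≤ 1) →
      ∀ (b : R → ι → ℝ), (∀ i, AllLp (fun r => b r i) ρ) →
      ∀ (T1 : R × (I → ℝ) → Ω1), MeasurePreserving T1 (ρ.prod (stdG I)) P1 →
      ∀ (T2 : R × (J → ℝ) → Ω2), MeasurePreserving T2 (ρ.prod (stdG J)) P2 →
      ∀ (U1 : Ω1 → ι → ℝ), (∀ i, AllLp (fun r => U1 r i) P1) →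
      ∀ (U2 : Ω2 → ι → ℝ), (∀ i, AllLp (fun r => U2 r i) P2) →
      ∀ η : ℝ, (∀ i, ∫ z, |U1 (T1 z) i - (b z.1 i + Fv a M z.2 i)| ∂(ρ.prod (stdG I)) ≤ η) →
      (∀ i, ∫ z, |U2 (T2 z) i - (b z.1 i + Nv c z.2 i)| ∂(ρ.prod (stdG J)) ≤ η) →
      ∀ L : ℝ, 0 ≤ L → ∀ Ψ : (ι → ℝ) → ℝ, (∀ u v, |Ψ u - Ψ v| ≤ L * ‖u - v‖) →
      ∀ δ : ℝ, 0 < δ →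
      |∫ x, Ψ (U1 x) ∂P1 - ∫ x, Ψ (U2 x) ∂P2| ≤ C * L * (κ / δ + κ + δ + η) := by
  obtain ⟨C, hC, H⟩ := core_clt ι
  refine ⟨C + 2 * Fintype.card ι, by positivity, ?_⟩
  intro I J _ _ _ _ R Ω1 Ω2 _ _ _ ρ P1 P2 _ _ _ a M hs c hcov κ hκ hop i0 h1 b hb T1 hT1 T2 hT2
    U1 hU1 U2 hU2 η he1 he2 L hL Ψ hΨ δ hδ
  have hF : ∀ i, AllLp (fun z : R × (I → ℝ) => b z.1 i + Fv a M z.2 i) (ρ.prod (stdG I)) := fun i =>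
    (allLp_fst (hb i)).add (allLp_snd (allLp_Fv a M i))
  have hN : ∀ i, AllLp (fun z : R × (J → ℝ) => b z.1 i + Nv c z.2 i) (ρ.prod (stdG J)) := fun i =>
    (allLp_fst (hb i)).add (allLp_snd (allLp_Nv c i))
  have e1 := lip_diff hL hΨ (U := fun z => U1 (T1 z)) (V := fun z i => b z.1 i + Fv a M z.2 i)
    (fun i => (hU1 i).comp hT1) hF
  have e2 := lip_diff hL hΨ (U := fun z => U2 (T2 z)) (V := fun z i => b z.1 i + Nv c z.2 i)
    (fun i => (hU2 i).comp hT2) hN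
  rw [integral_mp hT1 (f := fun x => Ψ (U1 x)) (allLp_lip hL hΨ hU1).aesm] at e1
  rw [integral_mp hT2 (f := fun x => Ψ (U2 x)) (allLp_lip hL hΨ hU2).aesm] at e2
  have s1 : ∑ i, ∫ z, |U1 (T1 z) i - (b z.1 i + Fv a M z.2 i)| ∂(ρ.prod (stdG I)) ≤
      Fintype.card ι * η := by
    refine (Finset.sum_le_sum fun i _ => he1 i).trans ?_
    simp
  have s2 : ∑ i, ∫ z, |U2 (T2 z) i - (b z.1 i + Nv c z.2 i)| ∂(ρ.prod (stdG J)) ≤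
      Fintype.card ι * η := by
    refine (Finset.sum_le_sum fun i _ => he2 i).trans ?_
    simp
  have hη : 0 ≤ η := (integral_nonneg fun _ => abs_nonneg _).trans (he1 i0)
  have iF := (allLp_lip hL hΨ hF).integrable
  have iN := (allLp_lip hL hΨ hN).integrable
  have e3 : |∫ z : R × (I → ℝ), Ψ (fun i => b z.1 i + Fv a M z.2 i) ∂(ρ.prod (stdG I)) -
      ∫ z : R × (J → ℝ), Ψ (fun i => b z.1 i + Nv c z.2 i) ∂(ρ.prod (stdG J))| ≤
      C * L * (κ / δ + κ + δ) := by
    rw [integral_prod _ iF, integral_prod _ iN, ← integral_sub iF.integral_prod_left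
      iN.integral_prod_left, ← Real.norm_eq_abs]
    refine (norm_integral_le_of_norm_le_const (C := C * L * (κ / δ + κ + δ))
      (Filter.Eventually.of_forall fun r => ?_)).trans (by simp)
    rw [Real.norm_eq_abs]
    refine H I J a M hs c hcov κ hκ hop i0 h1 L hL (fun u => Ψ (fun i => b r i + u i)) ?_ δ hδ
    intro u v
    refine (hΨ _ _).trans (le_of_eq ?_)
    congr 2
    funext i
    simp
  have m1 := e1.trans (mul_le_mul_of_nonneg_left s1 hL)
  have m2 := e2.trans (mul_le_mul_of_nonneg_left s2 hL)
  have hk : (0 : ℝ) ≤ Fintype.card ι := by positivity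
  have hq : 0 ≤ κ / δ + κ + δ := by positivity
  have hz : 0 ≤ Fintype.card ι * L * (κ / δ + κ + δ) := by positivity
  have hz2 : 0 ≤ C * L * η := by positivity
  rw [abs_le] at *
  constructor <;> nlinarith [m1.1, m1.2, m2.1, m2.2, e3.1, e3.2]

end cond

set_option linter.unusedSectionVars false

section maps

lemma sfin_of_prob {Ω : Type*} [MeasurableSpace Ω] (μ : Measure Ω) [IsProbabilityMeasure μ] :
    SFinite μ := inferInstance

/-- Glue the first `s` coordinates and the remaining coordinates. -/
def glue (d s : ℕ) (xS : Fin s → ℝ) (x : Fin d → ℝ) : Fin d → ℝ :=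
  fun i => if h : (i : ℕ) < s then xS ⟨i, h⟩ else x i

lemma mp_glue (d s : ℕ) (hs : s ≤ d) :
    MeasurePreserving (fun z : (Fin s → ℝ) × (Fin d → ℝ) => glue d s z.1 z.2)
      ((stdG (Fin s)).prod (stdG (Fin d))) (stdG (Fin d)) := by
  obtain ⟨e, rfl⟩ := Nat.exists_eq_add_of_le hs
  have hm : Measurable (fun z : (Fin s → ℝ) × (Fin (s + e) → ℝ) => glue (s + e) s z.1 z.2) := by
    rw [measurable_pi_iff]
    intro i
    unfold glue
    by_cases h : (i : ℕ) < s
    · simp only [dif_pos h]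
      exact (measurable_pi_apply _).comp measurable_fst
    · simp only [dif_neg h]
      exact (measurable_pi_apply _).comp measurable_snd
  refine ⟨hm, ?_⟩
  symm
  apply Measure.pi_eq
  intro t ht
  rw [Measure.map_apply hm (MeasurableSet.univ_pi ht)]
  have : (fun z : (Fin s → ℝ) × (Fin (s + e) → ℝ) => glue (s + e) s z.1 z.2) ⁻¹' (Set.univ.pi t)
      = (Set.univ.pi fun i : Fin s => t (Fin.castAdd e i)) ×ˢ
        (Set.univ.pi fun i : Fin (s + e) => if (i : ℕ) < s then Set.univ else t i) := by
    ext ⟨x, y⟩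
    simp only [Set.mem_preimage, Set.mem_pi, Set.mem_univ, true_imp_iff, Set.mem_prod, glue]
    constructor
    · intro h
      refine ⟨fun i => ?_, fun i => ?_⟩
      · have := h (Fin.castAdd e i)
        simpa using this
      · have := h i
        by_cases hi : (i : ℕ) < s
        · simp [hi]
        · simpa [hi] using this
    · rintro ⟨h1, h2⟩ i
      by_cases hi : (i : ℕ) < s
      · simp only [dif_pos hi]
        exact h1 ⟨i, hi⟩
      · simpa [hi] using h2 i
  rw [this, Measure.prod_prod]
  unfold stdG
  rw [Measure.pi_pi, Measure.pi_pi, Fin.prod_univ_add, Fin.prod_univ_add]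
  simp

variable {A R X G S H : Type*} [MeasurableSpace A] [MeasurableSpace R] [MeasurableSpace X]
  [MeasurableSpace G] [MeasurableSpace S] [MeasurableSpace H]

lemma mp_rr3 (μa : Measure A) (μr : Measure R) (μx : Measure X) [IsProbabilityMeasure μa]
    [IsProbabilityMeasure μr] [IsProbabilityMeasure μx] :
    MeasurePreserving (fun z : (A × R) × X => ((z.1.1, z.2), z.1.2))
      ((μa.prod μr).prod μx) ((μa.prod μx).prod μr) := by
  have h1 := measurePreserving_prodAssoc μa μr μx
  have h2 := (MeasurePreserving.id μa).prod (Measure.measurePreserving_swap (μ := μr) (ν := μx))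
  have h3 := (measurePreserving_prodAssoc μa μx μr).symm
  exact h3.comp (h2.comp h1)

lemma mp_rr4 (μg : Measure G) (μs : Measure S) (μx : Measure X) (μh : Measure H)
    [IsProbabilityMeasure μg] [IsProbabilityMeasure μs] [IsProbabilityMeasure μx]
    [IsProbabilityMeasure μh] :
    MeasurePreserving (fun z : (G × S) × (X × H) => ((z.1.1, z.2.2), (z.2.1, z.1.2)))
      ((μg.prod μs).prod (μx.prod μh)) ((μg.prod μh).prod (μx.prod μs)) := by
  have h1 := measurePreserving_prodAssoc μg μs (μx.prod μh)
  have k1 := Measure.measurePreserving_swap (μ := μs) (ν := μx.prod μh)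
  have k2 := (Measure.measurePreserving_swap (μ := μx) (ν := μh)).prod (MeasurePreserving.id μs)
  have k3 := measurePreserving_prodAssoc μh μx μs
  have h2 := (MeasurePreserving.id μg).prod (k3.comp (k2.comp k1))
  have h3 := (measurePreserving_prodAssoc μg μh (μx.prod μs)).symm
  exact h3.comp (h2.comp h1)

/-- Auxiliary randomness on which we condition. -/
abbrev RR (d p D' s : ℕ) : Type :=
  (Fin s → ℝ) × (((k : Fin (D' + 3)) → MIdx d k.1 → ℝ) × (Fin p → ℝ))

/-- Law of the auxiliary randomness. -/
def rrMeas (d p D' s : ℕ) : Measure (RR d p D' s) :=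
  (stdG (Fin s)).prod
    ((Measure.pi fun k : Fin (D' + 3) => stdG (MIdx d k.1)).prod (stdG (Fin p)))

instance (d p D' s : ℕ) : IsProbabilityMeasure (rrMeas d p D' s) := by
  unfold rrMeas; infer_instance
instance (d p D' : ℕ) : IsProbabilityMeasure (PGfeatMeas d p D') := by
  unfold PGfeatMeas; infer_instance
instance (d p D' s : ℕ) : IsProbabilityMeasure (CGfeatMeas d p D' s) := by
  unfold CGfeatMeas; infer_instance

/-- Reparametrization of the PGE randomness. -/
def TT1 (d p D' s : ℕ) (z : RR d p D' s × (Fin d → ℝ)) : PGfeat d p D' :=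
  (glue d s z.1.1 z.2, z.1.2)

lemma mp_TT1 (d p D' s : ℕ) (hs : s ≤ d) :
    MeasurePreserving (TT1 d p D' s) ((rrMeas d p D' s).prod (stdG (Fin d)))
      (PGfeatMeas d p D') := by
  have i1 : IsProbabilityMeasure (Measure.pi fun k : Fin (D' + 3) => stdG (MIdx d k.1)) :=
    inferInstance
  have i2 : IsProbabilityMeasure
    ((Measure.pi fun k : Fin (D' + 3) => stdG (MIdx d k.1)).prod (stdG (Fin p))) := inferInstance
  have i3 : SFinite
    ((Measure.pi fun k : Fin (D' + 3) => stdG (MIdx d k.1)).prod (stdG (Fin p))) :=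
    sfin_of_prob _
  have h1 := mp_rr3 (stdG (Fin s))
    ((Measure.pi fun k : Fin (D' + 3) => stdG (MIdx d k.1)).prod (stdG (Fin p))) (stdG (Fin d))
  have h2 := (mp_glue d s hs).prod (MeasurePreserving.id
    ((Measure.pi fun k : Fin (D' + 3) => stdG (MIdx d k.1)).prod (stdG (Fin p))))
  exact h2.comp h1

/-- Reparametrization of the CGE randomness. -/
def TT2 (d p D' s : ℕ) (z : RR d p D' s × (Fin d ⊕ MIdx d 2 → ℝ)) : CGfeat d p D' s :=
  (z.1.1, Function.update z.1.2.1 (⟨2, by omega⟩ : Fin (D' + 3)) (fun κ => z.2 (Sum.inr κ)),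
    (fun i => z.2 (Sum.inl i)), z.1.2.2)

lemma mp_TT2 (d p D' s : ℕ) :
    MeasurePreserving (TT2 d p D' s) ((rrMeas d p D' s).prod (stdG (Fin d ⊕ MIdx d 2)))
      (CGfeatMeas d p D' s) := by
  have i1 : IsProbabilityMeasure (Measure.pi fun k : Fin (D' + 3) => stdG (MIdx d k.1)) :=
    inferInstance
  have i2 : IsProbabilityMeasure
    ((Measure.pi fun k : Fin (D' + 3) => stdG (MIdx d k.1)).prod (stdG (Fin p))) := inferInstance
  have i3 : SFinite
    ((Measure.pi fun k : Fin (D' + 3) => stdG (MIdx d k.1)).prod (stdG (Fin p))) :=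
    sfin_of_prob _
  have i4 : IsProbabilityMeasure
    ((Measure.pi fun k : Fin (D' + 3) => stdG (MIdx d k.1)).prod (stdG (MIdx d 2))) := inferInstance
  have i5 : SFinite
    ((Measure.pi fun k : Fin (D' + 3) => stdG (MIdx d k.1)).prod (stdG (MIdx d 2))) :=
    sfin_of_prob _
  have h0 := measurePreserving_sumPiEquivProdPi
    (X := fun _ : Fin d ⊕ MIdx d 2 => ℝ) (fun _ => gaussianReal 0 1)
  have h1 := (MeasurePreserving.id (rrMeas d p D' s)).prod h0
  have h2 := measurePreserving_prodAssoc (stdG (Fin s))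
    ((Measure.pi fun k : Fin (D' + 3) => stdG (MIdx d k.1)).prod (stdG (Fin p)))
    ((stdG (Fin d)).prod (stdG (MIdx d 2)))
  have h3 := mp_rr4 (Measure.pi fun k : Fin (D' + 3) => stdG (MIdx d k.1)) (stdG (Fin p))
    (stdG (Fin d)) (stdG (MIdx d 2))
  have h4 := (mp_update (fun k : Fin (D' + 3) => stdG (MIdx d k.1)) ⟨2, by omega⟩).prod
    (μa := (Measure.pi fun k : Fin (D' + 3) => stdG (MIdx d k.1)).prod (stdG (MIdx d 2)))
    (MeasurePreserving.id ((stdG (Fin d)).prod (stdG (Fin p))))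
  have h5 := (MeasurePreserving.id (stdG (Fin s))).prod (h4.comp h3)
  exact h5.comp (h2.comp h1)

lemma coordS_glue (d s : ℕ) (hs : s ≤ d) (xS : Fin s → ℝ) (x : Fin d → ℝ) (i : Fin s) :
    coordS d s (glue d s xS x) i = xS i := by
  unfold coordS glue
  have : (i : ℕ) < d := lt_of_lt_of_le i.2 hs
  simp [this]

lemma hvec_glue_perp (d s : ℕ) (xS : Fin s → ℝ) (x : Fin d → ℝ) (κ : MIdx d 2)
    (h : ∀ i : Fin d, (i : ℕ) < s → κ.1 i = 0) : hvec d 2 (glue d s xS x) κ = hvec d 2 x κ := by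
  unfold hvec
  refine Finset.prod_congr rfl fun i _ => ?_
  by_cases hi : (i : ℕ) < s
  · rw [h i hi, He_zero, He_zero]
  · simp [glue, hi]

lemma hvec_glue_par (d s : ℕ) (xS : Fin s → ℝ) (x : Fin d → ℝ) (κ : MIdx d 2)
    (h : ∀ i : Fin d, s ≤ (i : ℕ) → κ.1 i = 0) :
    hvec d 2 (glue d s xS x) κ = hvec d 2 (extend0 d s xS) κ := by
  unfold hvec
  refine Finset.prod_congr rfl fun i _ => ?_
  by_cases hi : (i : ℕ) < s
  · simp [glue, extend0, hi]
  · rw [h i (by omega), He_zero, He_zero]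

lemma dotp_msk_glue (d s : ℕ) (xS : Fin s → ℝ) (x : Fin d → ℝ) (β : MIdx d 2 → ℝ) :
    dotp (msk s β) (hvec d 2 (glue d s xS x)) = dotp (msk s β) (hvec d 2 x) := by
  unfold dotp
  refine Finset.sum_congr rfl fun κ _ => ?_
  unfold msk
  split_ifs with h
  · rw [hvec_glue_perp d s xS x κ h]
  · simp

lemma dotp_mskS_glue (d s : ℕ) (xS : Fin s → ℝ) (x : Fin d → ℝ) (β : MIdx d 2 → ℝ) :
    dotp (mskS s β) (hvec d 2 (glue d s xS x)) = dotp (mskS s β) (hvec d 2 (extend0 d s xS)) := by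
  unfold dotp
  refine Finset.sum_congr rfl fun κ _ => ?_
  unfold mskS
  split_ifs with h
  · rw [hvec_glue_par d s xS x κ h]
  · simp

lemma allLp_hv_comp {Ω : Type*} [MeasurableSpace Ω] {μ : Measure Ω} [IsProbabilityMeasure μ] {d : ℕ}
    (β : MIdx d 2 → ℝ) {X : Ω → Fin d → ℝ} (hX : ∀ i, AllLp (fun ω => X ω i) μ) :
    AllLp (fun ω => dotp β (hvec d 2 (X ω))) μ := by
  simp_rw [dotp_hvec, div_eq_inv_mul]
  refine AllLp.const_mul _ ?_
  exact AllLp.sum fun k _ => AllLp.sum fun l _ =>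
    (((hX k).mul (hX l)).sub (AllLp.const _)).const_mul _

lemma allLp_dotp_comp {Ω : Type*} [MeasurableSpace Ω] {μ : Measure Ω} {ι : Type*} [Fintype ι]
    (β : ι → ℝ) {X : Ω → ι → ℝ} (hX : ∀ i, AllLp (fun ω => X ω i) μ) :
    AllLp (fun ω => dotp β (X ω)) μ :=
  AllLp.sum fun k _ => (hX k).const_mul _

lemma allLp_extend0 (d s : ℕ) (i : Fin d) :
    AllLp (fun xS : Fin s → ℝ => extend0 d s xS i) (stdG (Fin s)) := by
  unfold extend0
  by_cases h : (i : ℕ) < s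
  · simp only [dif_pos h]; exact allLp_coord _
  · simp only [dif_neg h]; exact AllLp.const _

end maps

set_option linter.unusedSectionVars false

section asmb

/-- Degree-two part of a chaos coefficient vector. -/
def res {d : ℕ} (k : ℕ) (β : MIdx d k → ℝ) : MIdx d 2 → ℝ :=
  if h : k = 2 then h ▸ β else fun _ => 0

lemma res_two {d : ℕ} (β : MIdx d 2 → ℝ) : res 2 β = β := by simp [res]
lemma res_ne {d k : ℕ} (h : k ≠ 2) (β : MIdx d k → ℝ) : res k β = fun _ => 0 := by simp [res, h]

variable {d s D' : ℕ} {sk : ℕ → ℕ}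

/-- Degree-two coefficients of the non-signal part. -/
def vv (β : (k : ℕ) → Fin (sk k) → MIdx d k → ℝ) (Q : MIdx d 2 → ℝ) :
    Option (SigIdx s D' sk) → MIdx d 2 → ℝ
  | none => msk s Q
  | some (Sum.inl _) => fun _ => 0
  | some (Sum.inr ki) => msk s (res ki.1.1 (β ki.1.1 ki.2))

/-- Linear coefficients of the non-signal part. -/
def aa (A : Fin d → ℝ) : Option (SigIdx s D' sk) → Fin d → ℝ
  | none => fun i => if (i : ℕ) < s then 0 else A i
  | some _ => fun _ => 0

/-- Coefficients of the Gaussian surrogate. -/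
def cc (β : (k : ℕ) → Fin (sk k) → MIdx d k → ℝ) (Q : MIdx d 2 → ℝ) (A : Fin d → ℝ)
    (i : Option (SigIdx s D' sk)) : Fin d ⊕ MIdx d 2 → ℝ :=
  Sum.elim (aa A i) (vv β Q i)

/-- The part of the observables that is measurable with respect to the conditioning. -/
def bb {p : ℕ} (β : (k : ℕ) → Fin (sk k) → MIdx d k → ℝ) (Q : MIdx d 2 → ℝ) (A : Fin d → ℝ)
    (m0 mh : ℝ) (θ : Fin p → ℝ) (r : RR d p D' s) : Option (SigIdx s D' sk) → ℝ
  | none => m0 + dotp A (extend0 d s r.1) + dotp (mskS s Q) (hvec d 2 (extend0 d s r.1))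
      + mh * dotp θ r.2.2
  | some (Sum.inl i) => r.1 i
  | some (Sum.inr ki) => if ki.1.1 ≤ 2 then 0 else dotp (β ki.1.1 ki.2)
        (r.2.1 ⟨ki.1.1, by have h := (Finset.mem_Icc.mp ki.1.2).2; omega⟩)

/-- Observables: signal together with the scalar output. -/
def obs (f : SigIdx s D' sk → ℝ) (t : ℝ) : Option (SigIdx s D' sk) → ℝ
  | none => t
  | some i => f i

lemma Fv_eq (β : (k : ℕ) → Fin (sk k) → MIdx d k → ℝ) (Q : MIdx d 2 → ℝ) (A : Fin d → ℝ)
    (x : Fin d → ℝ) (i : Option (SigIdx s D' sk)) :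
    Fv (aa A) (fun i => Mat (vv β Q i)) x i = dotp (aa A i) x + dotp (vv β Q i) (hvec d 2 x) := by
  rw [dotp_hvec]; rfl

lemma Nv_eq (β : (k : ℕ) → Fin (sk k) → MIdx d k → ℝ) (Q : MIdx d 2 → ℝ) (A : Fin d → ℝ)
    (y : Fin d ⊕ MIdx d 2 → ℝ) (i : Option (SigIdx s D' sk)) :
    Nv (cc β Q A) y i = dotp (aa A i) (fun k => y (Sum.inl k)) +
      dotp (vv β Q i) (fun κ => y (Sum.inr κ)) := by
  unfold Nv dotp
  rw [Fintype.sum_sum_type]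
  rfl

lemma cc_cov (β : (k : ℕ) → Fin (sk k) → MIdx d k → ℝ) (Q : MIdx d 2 → ℝ) (A : Fin d → ℝ)
    (i j : Option (SigIdx s D' sk)) :
    ∑ k, cc β Q A i k * cc β Q A j k = Sg (aa A) (fun i => Mat (vv β Q i)) i j := by
  rw [Fintype.sum_sum_type]
  unfold Sg
  rw [← Mat_iso]
  rfl

lemma zPG_eq {p Dσ : ℕ} (σa : Polynomial ℝ) (w : Fin p → Fin d → ℝ) (x : Fin d → ℝ)
    (gst θ : Fin p → ℝ) :
    dotp θ (zPG d p Dσ σa w x gst) = hCoef σa 0 * ∑ j, θ j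
      + dotp (fun i => hCoef σa 1 * ∑ j, θ j * w j i) x
      + dotp (fun κ => hCoef σa 2 * ∑ j, θ j * qvec d 2 (w j) κ) (hvec d 2 x)
      + muHigh σa Dσ * dotp θ gst := by
  unfold zPG dotp
  have e1 : ∑ i, (hCoef σa 1 * ∑ j, θ j * w j i) * x i =
      ∑ j, hCoef σa 1 * (θ j * ∑ i, w j i * x i) := by
    simp_rw [Finset.mul_sum, Finset.sum_mul]
    rw [Finset.sum_comm]
    exact Finset.sum_congr rfl fun j _ => Finset.sum_congr rfl fun i _ => by ring
  have e2 : ∑ κ, (hCoef σa 2 * ∑ j, θ j * qvec d 2 (w j) κ) * hvec d 2 x κ =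
      ∑ j, hCoef σa 2 * (θ j * ∑ κ, qvec d 2 (w j) κ * hvec d 2 x κ) := by
    simp_rw [Finset.mul_sum, Finset.sum_mul]
    rw [Finset.sum_comm]
    exact Finset.sum_congr rfl fun j _ => Finset.sum_congr rfl fun i _ => by ring
  rw [e1, e2, Finset.mul_sum, Finset.mul_sum, ← Finset.sum_add_distrib, ← Finset.sum_add_distrib,
    ← Finset.sum_add_distrib]
  exact Finset.sum_congr rfl fun j _ => by ring

lemma zCG_eq {p Dσ : ℕ} (σa : Polynomial ℝ) (w : Fin p → Fin d → ℝ) (xS : Fin s → ℝ)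
    (g : (k : Fin (D' + 3)) → MIdx d k.1 → ℝ) (g1 : Fin d → ℝ)
    (gst θ : Fin p → ℝ) (Q : MIdx d 2 → ℝ) (A : Fin d → ℝ)
    (hQ : Q = fun κ => hCoef σa 2 * ∑ j, θ j * qvec d 2 (w j) κ)
    (hA : A = fun i => hCoef σa 1 * ∑ j, θ j * w j i) :
    dotp θ (zCG d p s Dσ D' σa w xS g g1 gst) = hCoef σa 0 * ∑ j, θ j
      + dotp A (extend0 d s xS)
      + dotp (mskS s Q) (hvec d 2 (extend0 d s xS))
      + dotp (fun i : Fin d => if (i : ℕ) < s then 0 else A i) g1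
      + dotp (fun κ => Q κ - mskS s Q κ) (g ⟨2, by omega⟩)
      + muHigh σa Dσ * dotp θ gst := by
  unfold zCG dotp
  have e1 : ∀ y : Fin d → ℝ, ∑ i, A i * y i =
      ∑ j, hCoef σa 1 * (θ j * ∑ i, w j i * y i) := by
    intro y
    rw [hA]
    simp_rw [Finset.mul_sum, Finset.sum_mul]
    rw [Finset.sum_comm]
    exact Finset.sum_congr rfl fun j _ => Finset.sum_congr rfl fun i _ => by ring
  have e2 : ∀ y : MIdx d 2 → ℝ, ∑ κ, Q κ * y κ =
      ∑ j, hCoef σa 2 * (θ j * ∑ κ, qvec d 2 (w j) κ * y κ) := by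
    intro y
    rw [hQ]
    simp_rw [Finset.mul_sum, Finset.sum_mul]
    rw [Finset.sum_comm]
    exact Finset.sum_congr rfl fun j _ => Finset.sum_congr rfl fun i _ => by ring
  have f1 : ∑ κ, mskS s Q κ * hvec d 2 (extend0 d s xS) κ =
      ∑ κ, Q κ * (if ∀ i : Fin d, s ≤ (i : ℕ) → κ.1 i = 0 then
        hvec d 2 (extend0 d s xS) κ else 0) := by
    refine Finset.sum_congr rfl fun κ _ => ?_
    unfold mskS
    split_ifs <;> simp
  have f2 : ∑ κ, (Q κ - mskS s Q κ) * g ⟨2, by omega⟩ κ =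
      ∑ κ, Q κ * (if ∀ i : Fin d, s ≤ (i : ℕ) → κ.1 i = 0 then 0 else g ⟨2, by omega⟩ κ) := by
    refine Finset.sum_congr rfl fun κ _ => ?_
    unfold mskS
    split_ifs <;> simp
  have f3 : ∑ i : Fin d, (if (i : ℕ) < s then 0 else A i) * g1 i =
      ∑ i, A i * (if (i : ℕ) < s then 0 else g1 i) := by
    refine Finset.sum_congr rfl fun κ _ => ?_
    split_ifs <;> simp
  rw [f1, f2, f3, e1, e1, e2, e2, Finset.mul_sum, Finset.mul_sum, ← Finset.sum_add_distrib,
    ← Finset.sum_add_distrib, ← Finset.sum_add_distrib, ← Finset.sum_add_distrib,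
    ← Finset.sum_add_distrib]
  refine Finset.sum_congr rfl fun j _ => ?_
  have g1' : ∑ κ : MIdx d 2, (@ite ℝ (∀ i : Fin d, s ≤ (i : ℕ) → κ.1 i = 0)
      (Classical.propDecidable _) (qvec d 2 (w j) κ * hvec d 2 (extend0 d s xS) κ) 0) =
      ∑ κ : MIdx d 2, qvec d 2 (w j) κ * (if ∀ i : Fin d, s ≤ (i : ℕ) → κ.1 i = 0 then
        hvec d 2 (extend0 d s xS) κ else 0) := by
    refine Finset.sum_congr rfl fun κ _ => ?_
    split_ifs <;> simp
  have g2' : ∑ κ : MIdx d 2, (@ite ℝ (∀ i : Fin d, s ≤ (i : ℕ) → κ.1 i = 0)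
      (Classical.propDecidable _) 0 (qvec d 2 (w j) κ * g ⟨2, by omega⟩ κ)) =
      ∑ κ : MIdx d 2, qvec d 2 (w j) κ * (if ∀ i : Fin d, s ≤ (i : ℕ) → κ.1 i = 0 then
        0 else g ⟨2, by omega⟩ κ) := by
    refine Finset.sum_congr rfl fun κ _ => ?_
    split_ifs <;> simp
  have g3' : ∑ i : Fin d, (if (i : ℕ) < s then 0 else w j i * g1 i) =
      ∑ i, w j i * (if (i : ℕ) < s then 0 else g1 i) := by
    refine Finset.sum_congr rfl fun κ _ => ?_
    split_ifs <;> simp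
  rw [← g1', ← g2', ← g3']
  ring_nf
  try simp

lemma OpB.mono {I : Type*} [Fintype I] {M : I → I → ℝ} {τ κ : ℝ} (h : OpB M τ) (h0 : 0 ≤ τ)
    (h1 : τ ≤ κ) : OpB M κ := fun v =>
  (h v).trans (mul_le_mul_of_nonneg_right (pow_le_pow_left₀ h0 h1 2)
    (Finset.sum_nonneg fun _ _ => sq_nonneg _))

lemma OpB_zero {κ : ℝ} : OpB (Mat (fun _ : MIdx d 2 => 0)) κ := by
  intro v
  have : ∀ k, mv (Mat (fun _ : MIdx d 2 => 0)) v k = 0 := by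
    intro k; simp [mv, Mat]
  simp_rw [this]
  simp only [ne_eq, OfNat.ofNat_ne_zero, not_false_eq_true, zero_pow, Finset.sum_const_zero]
  exact mul_nonneg (sq_nonneg _) (Finset.sum_nonneg fun _ _ => sq_nonneg _)

lemma pg_inr {k : ℕ} (hk : 2 ≤ k) (β : MIdx d k → ℝ) (xS : Fin s → ℝ) (x : Fin d → ℝ) (t : ℝ) :
    (if k ≤ 2 then dotp β (hvec d k (glue d s xS x)) else t) -
      ((if k ≤ 2 then 0 else t) + dotp (msk s (res k β)) (hvec d 2 x)) =
    dotp (fun κ => res k β κ - msk s (res k β) κ) (hvec d 2 (glue d s xS x)) := by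
  rw [← dotp_msk_glue d s xS x]
  by_cases h : k = 2
  · subst h
    rw [res_two]
    simp only [le_refl, if_true]
    unfold dotp
    rw [zero_add, ← Finset.sum_sub_distrib]
    exact Finset.sum_congr rfl fun κ _ => by ring
  · have h2 : ¬ k ≤ 2 := by omega
    rw [res_ne h]
    simp [h2, dotp, msk]

lemma cg_inr {k : ℕ} (hk : k < D' + 3) (hk2 : 2 ≤ k) (β : MIdx d k → ℝ)
    (g : (k : Fin (D' + 3)) → MIdx d k.1 → ℝ) (y : MIdx d 2 → ℝ) :
    dotp β (Function.update g (⟨2, by omega⟩ : Fin (D' + 3)) y ⟨k, hk⟩) -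
      ((if k ≤ 2 then 0 else dotp β (g ⟨k, hk⟩)) + dotp (msk s (res k β)) y) =
    dotp (fun κ => res k β κ - msk s (res k β) κ) y := by
  by_cases h : k = 2
  · subst h
    rw [res_two]
    simp only [le_refl, if_true]
    rw [Function.update_self]
    unfold dotp
    rw [zero_add, ← Finset.sum_sub_distrib]
    exact Finset.sum_congr rfl fun κ _ => by ring
  · have h2 : ¬ k ≤ 2 := by omega
    have h3 : (⟨k, hk⟩ : Fin (D' + 3)) ≠ ⟨2, by omega⟩ := by
      intro h'; exact h (congrArg Fin.val h')
    rw [res_ne h, Function.update_of_ne h3]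
    simp [h2, dotp, msk]

end asmb

set_option linter.unusedSectionVars false

section fixd
variable {d s D' p : ℕ} {sk : ℕ → ℕ}

lemma allLp_gk (k : Fin (D' + 3)) (κ : MIdx d k.1) :
    AllLp (fun g : (k : Fin (D' + 3)) → MIdx d k.1 → ℝ => g k κ)
      (Measure.pi fun k : Fin (D' + 3) => stdG (MIdx d k.1)) :=
  (allLp_coord κ).comp (measurePreserving_eval (fun k : Fin (D' + 3) => stdG (MIdx d k.1)) k)

lemma allLp_gdot (k : Fin (D' + 3)) (β : MIdx d k.1 → ℝ) :
    AllLp (fun g : (k : Fin (D' + 3)) → MIdx d k.1 → ℝ => dotp β (g k))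
      (Measure.pi fun k : Fin (D' + 3) => stdG (MIdx d k.1)) :=
  AllLp.sum fun κ _ => (allLp_gk k κ).const_mul _

instance : IsProbabilityMeasure
    ((Measure.pi fun k : Fin (D' + 3) => stdG (MIdx d k.1)).prod (stdG (Fin p))) := inferInstance

instance : IsProbabilityMeasure
    ((Measure.pi fun k : Fin (D' + 3) => stdG (MIdx d k.1)).prod
      ((stdG (Fin d)).prod (stdG (Fin p)))) := inferInstance

lemma allLp_gdot1 (k : Fin (D' + 3)) (β : MIdx d k.1 → ℝ) :
    AllLp (fun r : ((k : Fin (D' + 3)) → MIdx d k.1 → ℝ) × (Fin p → ℝ) => dotp β (r.1 k))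
      ((Measure.pi fun k : Fin (D' + 3) => stdG (MIdx d k.1)).prod (stdG (Fin p))) :=
  allLp_fst (allLp_gdot k β)

lemma allLp_gdot2 (k : Fin (D' + 3)) (β : MIdx d k.1 → ℝ) :
    AllLp (fun r : ((k : Fin (D' + 3)) → MIdx d k.1 → ℝ) × ((Fin d → ℝ) × (Fin p → ℝ)) =>
        dotp β (r.1 k))
      ((Measure.pi fun k : Fin (D' + 3) => stdG (MIdx d k.1)).prod
        ((stdG (Fin d)).prod (stdG (Fin p)))) :=
  allLp_fst (allLp_gdot k β)

lemma allLp_bb (β : (k : ℕ) → Fin (sk k) → MIdx d k → ℝ) (Q : MIdx d 2 → ℝ) (A : Fin d → ℝ)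
    (m0 mh : ℝ) (θ : Fin p → ℝ) (i : Option (SigIdx s D' sk)) :
    AllLp (fun r => bb β Q A m0 mh θ r i) (rrMeas d p D' s) := by
  unfold rrMeas
  match i with
  | none =>
    have h1 : AllLp (fun r : RR d p D' s => dotp A (extend0 d s r.1)) (rrMeas d p D' s) :=
      allLp_fst (allLp_dotp_comp A (allLp_extend0 d s))
    have h2 : AllLp (fun r : RR d p D' s => dotp (mskS s Q) (hvec d 2 (extend0 d s r.1)))
        (rrMeas d p D' s) := allLp_fst (allLp_hv_comp _ (allLp_extend0 d s))
    have h3 : AllLp (fun r : RR d p D' s => dotp θ r.2.2) (rrMeas d p D' s) :=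
      allLp_snd (allLp_snd (allLp_dotp θ))
    exact (((AllLp.const m0).add h1).add h2).add (h3.const_mul mh)
  | some (Sum.inl i) => exact allLp_fst (allLp_coord i)
  | some (Sum.inr ki) =>
    by_cases h : ki.1.1 ≤ 2
    · simp only [bb, if_pos h]; exact AllLp.const _
    · simp only [bb, if_neg h]
      exact allLp_snd (allLp_gdot1 ⟨ki.1.1, by have h := (Finset.mem_Icc.mp ki.1.2).2; omega⟩ (β ki.1.1 ki.2))

lemma allLp_coordS (i : Fin s) : AllLp (fun x => coordS d s x i) (stdG (Fin d)) := by
  unfold coordS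
  by_cases h : (i : ℕ) < d
  · simp only [dif_pos h]; exact allLp_coord _
  · simp only [dif_neg h]; exact AllLp.const _

lemma allLp_hv' {k : ℕ} (h : k = 2) (β : MIdx d k → ℝ) :
    AllLp (fun x => dotp β (hvec d k x)) (stdG (Fin d)) := by
  subst h; exact allLp_hv β

lemma allLp_U1 {Dσ : ℕ} (β : (k : ℕ) → Fin (sk k) → MIdx d k → ℝ) (σa : Polynomial ℝ)
    (w : Fin p → Fin d → ℝ) (θ : Fin p → ℝ) (i : Option (SigIdx s D' sk)) :
    AllLp (fun ω : PGfeat d p D' => obs (fPG d s D' sk β ω.1 ω.2.1)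
      (dotp θ (zPG d p Dσ σa w ω.1 ω.2.2)) i) (PGfeatMeas d p D') := by
  match i with
  | none =>
    simp only [obs, zPG_eq]
    have h1 : AllLp (fun ω : PGfeat d p D' => dotp (fun i => hCoef σa 1 * ∑ j, θ j * w j i) ω.1)
      (PGfeatMeas d p D') := allLp_fst (allLp_dotp _)
    have h2 : AllLp (fun ω : PGfeat d p D' =>
      dotp (fun κ => hCoef σa 2 * ∑ j, θ j * qvec d 2 (w j) κ) (hvec d 2 ω.1))
      (PGfeatMeas d p D') := allLp_fst (allLp_hv _)
    have h3 : AllLp (fun ω : PGfeat d p D' => dotp θ ω.2.2) (PGfeatMeas d p D') :=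
      allLp_snd (allLp_snd (allLp_dotp θ))
    exact (((AllLp.const _).add h1).add h2).add (h3.const_mul _)
  | some (Sum.inl i) => exact allLp_fst (allLp_coordS i)
  | some (Sum.inr ki) =>
    have h2 := (Finset.mem_Icc.mp ki.1.2).1
    by_cases h : ki.1.1 ≤ 2
    · simp only [obs, fPG, if_pos h]; exact allLp_fst (allLp_hv' (by omega) _)
    · simp only [obs, fPG, if_neg h]
      exact allLp_snd (allLp_gdot1 ⟨ki.1.1, by have h := (Finset.mem_Icc.mp ki.1.2).2; omega⟩ (β ki.1.1 ki.2))

lemma allLp_U2 {Dσ : ℕ} (β : (k : ℕ) → Fin (sk k) → MIdx d k → ℝ) (σa : Polynomial ℝ)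
    (w : Fin p → Fin d → ℝ) (θ : Fin p → ℝ) (i : Option (SigIdx s D' sk)) :
    AllLp (fun ω : CGfeat d p D' s => obs (fCG d s D' sk β ω.1 ω.2.1)
      (dotp θ (zCG d p s Dσ D' σa w ω.1 ω.2.1 ω.2.2.1 ω.2.2.2)) i) (CGfeatMeas d p D' s) := by
  match i with
  | none =>
    simp only [obs]
    simp_rw [zCG_eq σa w _ _ _ _ θ _ _ rfl rfl]
    have h1 : AllLp (fun ω : CGfeat d p D' s =>
        dotp (fun i => hCoef σa 1 * ∑ j, θ j * w j i) (extend0 d s ω.1)) (CGfeatMeas d p D' s) :=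
      allLp_fst (allLp_dotp_comp _ (allLp_extend0 d s))
    have h2 : AllLp (fun ω : CGfeat d p D' s =>
        dotp (mskS s (fun κ => hCoef σa 2 * ∑ j, θ j * qvec d 2 (w j) κ))
          (hvec d 2 (extend0 d s ω.1))) (CGfeatMeas d p D' s) :=
      allLp_fst (allLp_hv_comp _ (allLp_extend0 d s))
    have h3 : AllLp (fun ω : CGfeat d p D' s => dotp (fun i : Fin d => if (i : ℕ) < s then 0 else
        hCoef σa 1 * ∑ j, θ j * w j i) ω.2.2.1) (CGfeatMeas d p D' s) :=
      allLp_snd (allLp_snd (allLp_fst (allLp_dotp _)))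
    have h4 : AllLp (fun ω : CGfeat d p D' s =>
        dotp (fun κ => (hCoef σa 2 * ∑ j, θ j * qvec d 2 (w j) κ) -
          mskS s (fun κ => hCoef σa 2 * ∑ j, θ j * qvec d 2 (w j) κ) κ)
          (ω.2.1 ⟨2, by omega⟩)) (CGfeatMeas d p D' s) :=
      allLp_snd (allLp_gdot2 ⟨2, by omega⟩ _)
    have h5 : AllLp (fun ω : CGfeat d p D' s => dotp θ ω.2.2.2) (CGfeatMeas d p D' s) :=
      allLp_snd (allLp_snd (allLp_snd (allLp_dotp θ)))
    exact (((((AllLp.const _).add h1).add h2).add h3).add h4).add (h5.const_mul _)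
  | some (Sum.inl i) => exact allLp_fst (allLp_coord i)
  | some (Sum.inr ki) =>
    unfold CGfeatMeas
    have h : AllLp (fun r : ((k : Fin (D' + 3)) → MIdx d k.1 → ℝ) × ((Fin d → ℝ) × (Fin p → ℝ)) =>
        dotp (β ki.1.1 ki.2) (r.1 ⟨ki.1.1, by have h := (Finset.mem_Icc.mp ki.1.2).2; omega⟩))
      ((Measure.pi fun k : Fin (D' + 3) => stdG (MIdx d k.1)).prod
        ((stdG (Fin d)).prod (stdG (Fin p)))) :=
      allLp_gdot2 (D' := D') ⟨ki.1.1, by have h := (Finset.mem_Icc.mp ki.1.2).2; omega⟩ (β ki.1.1 ki.2)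
    exact allLp_snd (μ := stdG (Fin s)) h

lemma int_glue_le (hs : s ≤ d) (γ : MIdx d 2 → ℝ) :
    ∫ z : RR d p D' s × (Fin d → ℝ), |dotp γ (hvec d 2 (glue d s z.1.1 z.2))|
      ∂((rrMeas d p D' s).prod (stdG (Fin d))) ≤ Real.sqrt (∑ κ, γ κ ^ 2) := by
  have h : MeasurePreserving (fun z : RR d p D' s × (Fin d → ℝ) => glue d s z.1.1 z.2)
      ((rrMeas d p D' s).prod (stdG (Fin d))) (stdG (Fin d)) := by
    have i2 : IsProbabilityMeasure
      ((Measure.pi fun k : Fin (D' + 3) => stdG (MIdx d k.1)).prod (stdG (Fin p))) := inferInstance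
    have h0 : MeasurePreserving (Prod.fst : PGfeat d p D' → (Fin d → ℝ)) (PGfeatMeas d p D')
        (stdG (Fin d)) := measurePreserving_fst
    exact h0.comp (mp_TT1 d p D' s hs)
  rw [integral_mp h (f := fun x => |dotp γ (hvec d 2 x)|) (allLp_hv γ).abs.aesm]
  exact int_abs_hv_le γ

lemma int_gauss_le (γ : MIdx d 2 → ℝ) :
    ∫ z : RR d p D' s × (Fin d ⊕ MIdx d 2 → ℝ), |dotp γ (fun κ => z.2 (Sum.inr κ))|
      ∂((rrMeas d p D' s).prod (stdG (Fin d ⊕ MIdx d 2))) ≤ Real.sqrt (∑ κ, γ κ ^ 2) := by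
  have e : ∀ y : Fin d ⊕ MIdx d 2 → ℝ, dotp γ (fun κ => y (Sum.inr κ)) =
      dotp (Sum.elim (fun _ => 0) γ) y := by
    intro y; unfold dotp; rw [Fintype.sum_sum_type]; simp
  simp_rw [e]
  rw [integral_mp (T := Prod.snd) measurePreserving_snd
    (f := fun y => |dotp (Sum.elim (fun _ => 0) γ) y|) (allLp_dotp _).abs.aesm]
  refine (int_abs_dotp_le _).trans (le_of_eq ?_)
  congr 1
  rw [Fintype.sum_sum_type]; simp

/-- Comparison at fixed dimension. -/
lemma fixed_clt (s D' : ℕ) (sk : ℕ → ℕ) : ∃ C : ℝ, 0 < C ∧ ∀ (d p Dσ : ℕ), s ≤ d →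
    ∀ (β : (k : ℕ) → Fin (sk k) → MIdx d k → ℝ) (σa : Polynomial ℝ) (w : Fin p → Fin d → ℝ)
      (θ : Fin p → ℝ) (Q : MIdx d 2 → ℝ),
      (Q = fun κ => hCoef σa 2 * ∑ j, θ j * qvec d 2 (w j) κ) →
    ∀ κ : ℝ, 0 ≤ κ → OpB (Mat (msk s Q)) κ →
    (2 ≤ D' → ∀ i : Fin (sk 2), enorm2 (β 2 i) = 1) →
    (2 ≤ D' → ∀ i : Fin (sk 2), OpB (Mat (β 2 i)) κ) →
    ∀ η : ℝ, 0 ≤ η → Real.sqrt (2 * s * κ ^ 2) ≤ η →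
    Real.sqrt (∑ κ', (Q κ' - msk s Q κ' - mskS s Q κ') ^ 2) ≤ η →
    ∀ L : ℝ, 0 ≤ L → ∀ Ψ : (Option (SigIdx s D' sk) → ℝ) → ℝ,
    (∀ u v, |Ψ u - Ψ v| ≤ L * ‖u - v‖) → ∀ δ : ℝ, 0 < δ →
    |(∫ ω : PGfeat d p D', Ψ (obs (fPG d s D' sk β ω.1 ω.2.1)
        (dotp θ (zPG d p Dσ σa w ω.1 ω.2.2))) ∂(PGfeatMeas d p D')) -
      (∫ ω : CGfeat d p D' s, Ψ (obs (fCG d s D' sk β ω.1 ω.2.1)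
        (dotp θ (zCG d p s Dσ D' σa w ω.1 ω.2.1 ω.2.2.1 ω.2.2.2))) ∂(CGfeatMeas d p D' s))| ≤
      C * L * (κ / δ + κ + δ + η) := by
  obtain ⟨C, hC, H⟩ := cond_clt (Option (SigIdx s D' sk))
  refine ⟨C, hC, ?_⟩
  intro d p Dσ hs β σa w θ Q hQ κ hκ hopQ hβ1 hβop η hη he1 he2 L hL Ψ hΨ δ hδ
  set A : Fin d → ℝ := fun i => hCoef σa 1 * ∑ j, θ j * w j i with hA
  have hres : ∀ (ki : (k : {k : ℕ // k ∈ Finset.Icc 2 D'}) × Fin (sk k.1)),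
      OpB (Mat (res ki.1.1 (β ki.1.1 ki.2))) κ ∧
        ∑ κ', res ki.1.1 (β ki.1.1 ki.2) κ' ^ 2 ≤ 1 := by
    rintro ⟨⟨k, hk⟩, i⟩
    have hk' := Finset.mem_Icc.mp hk
    by_cases h : k = 2
    · subst h
      simp only
      rw [res_two]
      refine ⟨hβop hk'.2 i, ?_⟩
      have := hβ1 hk'.2 i
      unfold enorm2 at this
      rw [Real.sqrt_eq_one] at this
      exact this.le
    · simp only
      rw [res_ne h]
      exact ⟨OpB_zero, by simp⟩
  have hresη : ∀ (ki : (k : {k : ℕ // k ∈ Finset.Icc 2 D'}) × Fin (sk k.1)),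
      Real.sqrt (∑ κ', (res ki.1.1 (β ki.1.1 ki.2) κ' -
        msk s (res ki.1.1 (β ki.1.1 ki.2)) κ') ^ 2) ≤ η := fun ki =>
    (Real.sqrt_le_sqrt (trunc_bound s _ κ (hres ki).1)).trans he1
  refine H (Fin d) (Fin d ⊕ MIdx d 2) (RR d p D' s) (PGfeat d p D') (CGfeat d p D' s)
    (rrMeas d p D' s) (PGfeatMeas d p D') (CGfeatMeas d p D' s)
    (aa A) (fun i => Mat (vv β Q i)) (fun i k l => Mat_symm _ k l) (cc β Q A) (cc_cov β Q A)
    κ hκ ?_ none ?_ (bb β Q A (hCoef σa 0 * ∑ j, θ j) (muHigh σa Dσ) θ) (allLp_bb _ _ _ _ _ _)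
    (TT1 d p D' s) (mp_TT1 d p D' s hs) (TT2 d p D' s) (mp_TT2 d p D' s)
    (fun ω => obs (fPG d s D' sk β ω.1 ω.2.1) (dotp θ (zPG d p Dσ σa w ω.1 ω.2.2)))
    (allLp_U1 β σa w θ)
    (fun ω => obs (fCG d s D' sk β ω.1 ω.2.1)
        (dotp θ (zCG d p s Dσ D' σa w ω.1 ω.2.1 ω.2.2.1 ω.2.2.2)))
    (allLp_U2 β σa w θ) η ?_ ?_ L hL Ψ hΨ δ hδ
  · rintro (_ | i | ki)
    · exact hopQ
    · exact OpB_zero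
    · exact (hres ki).1.msk
  · rintro (_ | i | ki) hne
    · exact absurd rfl hne
    · rw [← cc_cov, Fintype.sum_sum_type]; simp [cc, aa, vv]
    · rw [← cc_cov, Fintype.sum_sum_type]
      simp only [cc, aa, vv, Sum.elim_inl, Sum.elim_inr, mul_zero, Finset.sum_const_zero, zero_add]
      simp_rw [← pow_two]
      exact (msk_sum_sq_le s _).trans (hres ki).2
  · rintro (_ | i | ki)
    · refine le_trans (le_of_eq ?_) ((int_glue_le (p := p) (D' := D') hs
        (fun κ' => Q κ' - msk s Q κ' - mskS s Q κ')).trans he2)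
      congr 1
      funext z
      congr 1
      rw [Fv_eq]
      simp only [obs, TT1, bb, vv, aa]
      rw [zPG_eq, ← hA, ← hQ, ← dotp_mskS_glue d s z.1.1 z.2, ← dotp_msk_glue d s z.1.1 z.2]
      have eA : dotp A (glue d s z.1.1 z.2) = dotp A (extend0 d s z.1.1) +
          dotp (fun i : Fin d => if (i : ℕ) < s then 0 else A i) z.2 := by
        unfold dotp
        rw [← Finset.sum_add_distrib]
        refine Finset.sum_congr rfl fun i _ => ?_
        by_cases h : (i : ℕ) < s <;> simp [glue, extend0, h]
      have eQ : dotp (fun κ' => Q κ' - msk s Q κ' - mskS s Q κ') (hvec d 2 (glue d s z.1.1 z.2)) =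
          dotp Q (hvec d 2 (glue d s z.1.1 z.2)) - dotp (msk s Q) (hvec d 2 (glue d s z.1.1 z.2))
          - dotp (mskS s Q) (hvec d 2 (glue d s z.1.1 z.2)) := by
        unfold dotp
        rw [← Finset.sum_sub_distrib, ← Finset.sum_sub_distrib]
        exact Finset.sum_congr rfl fun i _ => by ring
      rw [eA, eQ]
      ring
    · refine le_trans (le_of_eq ?_) hη
      rw [← integral_zero (RR d p D' s × (Fin d → ℝ)) ℝ]
      congr 1
      funext z
      rw [Fv_eq]
      simp only [obs, TT1, bb, vv, aa, fPG, coordS_glue d s hs]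
      simp [dotp]
    · refine le_trans (le_of_eq ?_) ((int_glue_le (p := p) (D' := D') hs _).trans (hresη ki))
      congr 1
      funext z
      congr 1
      rw [Fv_eq]
      simp only [obs, TT1, bb, vv, aa, fPG]
      rw [← pg_inr (Finset.mem_Icc.mp ki.1.2).1 (β ki.1.1 ki.2) z.1.1 z.2
        (dotp (β ki.1.1 ki.2) (z.1.2.1 ⟨ki.1.1, by
          have h := (Finset.mem_Icc.mp ki.1.2).2; omega⟩))]
      simp [dotp]
  · rintro (_ | i | ki)
    · refine le_trans (le_of_eq ?_) ((int_gauss_le (p := p) (D' := D') (s := s)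
        (fun κ' => Q κ' - msk s Q κ' - mskS s Q κ')).trans he2)
      congr 1
      funext z
      congr 1
      rw [Nv_eq]
      simp only [obs, TT2, bb, vv, aa]
      rw [zCG_eq σa w _ _ _ _ θ Q A hQ hA, Function.update_self]
      have eQ : dotp (fun κ' => Q κ' - msk s Q κ' - mskS s Q κ') (fun κ => z.2 (Sum.inr κ)) =
          dotp (fun κ' => Q κ' - mskS s Q κ') (fun κ => z.2 (Sum.inr κ))
          - dotp (msk s Q) (fun κ => z.2 (Sum.inr κ)) := by
        unfold dotp
        rw [← Finset.sum_sub_distrib]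
        exact Finset.sum_congr rfl fun i _ => by ring
      rw [eQ]
      ring
    · refine le_trans (le_of_eq ?_) hη
      rw [← integral_zero (RR d p D' s × (Fin d ⊕ MIdx d 2 → ℝ)) ℝ]
      congr 1
      funext z
      rw [Nv_eq]
      simp only [obs, TT2, bb, vv, aa, fCG]
      simp [dotp]
    · refine le_trans (le_of_eq ?_) ((int_gauss_le (p := p) (D' := D') (s := s) _).trans (hresη ki))
      congr 1
      funext z
      congr 1
      rw [Nv_eq]
      simp only [obs, TT2, bb, vv, aa, fCG]
      rw [← cg_inr (D' := D') (s := s) (by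
          have h := (Finset.mem_Icc.mp ki.1.2).2; omega) (Finset.mem_Icc.mp ki.1.2).1
          (β ki.1.1 ki.2) z.1.2.1]
      simp [dotp]

end fixd

set_option linter.unusedSectionVars false

section final

lemma unif_prob (ι : Type*) [Fintype ι] : IsProbabilityMeasure (unifSphere ι) := by
  unfold unifSphere
  apply Measure.isProbabilityMeasure_map
  apply Measurable.aemeasurable
  unfold enorm2
  fun_prop

lemma opB_of_opNorm {d : ℕ} (M : Fin d → Fin d → ℝ) (ε : ℝ) (h : opNorm M ≤ ε) : OpB M ε := by
  intro v
  set V := ∑ k, v k ^ 2 with hV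
  have hV0 : 0 ≤ V := Finset.sum_nonneg fun _ _ => sq_nonneg _
  rcases hV0.eq_or_lt with h0 | hpos
  · have hv : ∀ k, v k = 0 := by
      intro k
      have := (Finset.sum_eq_zero_iff_of_nonneg (fun k _ => sq_nonneg (v k))).1 (hV ▸ h0.symm) k
        (Finset.mem_univ k)
      exact pow_eq_zero_iff (two_ne_zero) |>.1 this
    rw [← h0]
    simp [mv, hv]
  · have hbdd : BddAbove (Set.range fun v : {v : Fin d → ℝ // (∑ j, (v j) ^ 2) ≤ 1} =>
        Real.sqrt (∑ i, (∑ j, M i j * v.1 j) ^ 2)) := by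
      refine ⟨Real.sqrt (∑ i, ∑ j, M i j ^ 2), ?_⟩
      rintro _ ⟨⟨u, hu⟩, rfl⟩
      refine Real.sqrt_le_sqrt (Finset.sum_le_sum fun i _ => ?_)
      refine (Finset.sum_mul_sq_le_sq_mul_sq _ _ _).trans ?_
      exact mul_le_of_le_one_right (Finset.sum_nonneg fun _ _ => sq_nonneg _) hu
    have hsq : Real.sqrt V ^ 2 = V := Real.sq_sqrt hV0
    have hs : 0 < Real.sqrt V := Real.sqrt_pos.2 hpos
    have hu : ∑ j, ((Real.sqrt V)⁻¹ * v j) ^ 2 ≤ 1 := by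
      simp_rw [mul_pow]
      rw [← Finset.mul_sum, ← hV, inv_pow, hsq, inv_mul_cancel₀ hpos.ne']
    have h1 := (le_ciSup hbdd ⟨fun j => (Real.sqrt V)⁻¹ * v j, hu⟩).trans h
    simp only at h1
    have e : ∑ i, (∑ j, M i j * ((Real.sqrt V)⁻¹ * v j)) ^ 2 = V⁻¹ * ∑ k, mv M v k ^ 2 := by
      rw [Finset.mul_sum]
      refine Finset.sum_congr rfl fun i _ => ?_
      have : ∑ j, M i j * ((Real.sqrt V)⁻¹ * v j) = (Real.sqrt V)⁻¹ * mv M v i := by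
        unfold mv; rw [Finset.mul_sum]
        exact Finset.sum_congr rfl fun j _ => by ring
      rw [this, mul_pow, inv_pow, hsq]
    rw [e] at h1
    have h2 := Real.sqrt_le_left ((Real.sqrt_nonneg _).trans h1) |>.1 h1
    rw [inv_mul_le_iff₀ hpos] at h2
    linarith

lemma OpB.smul {d : ℕ} {M N : Fin d → Fin d → ℝ} {ε c : ℝ} (h : OpB M ε)
    (hN : ∀ i j, N i j = c * M i j) : OpB N (|c| * ε) := by
  intro v
  have : ∀ k, mv N v k = c * mv M v k := by
    intro k; unfold mv; rw [Finset.mul_sum]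
    exact Finset.sum_congr rfl fun j _ => by rw [hN]; ring
  simp_rw [this, mul_pow, ← Finset.mul_sum, sq_abs]
  rw [mul_assoc]
  exact mul_le_mul_of_nonneg_left (h v) (sq_nonneg _)

lemma hCoef_two_zero (σa : Polynomial ℝ) (h : σa.natDegree ≤ 1) : hCoef σa 2 = 0 := by
  obtain ⟨b, a, rfl⟩ := Polynomial.exists_eq_X_add_C_of_natDegree_le_one h
  have hx : AllLp (fun x : ℝ => x) (gaussianReal 0 1) := fun p =>
    memLp_id_gaussianReal' _ (by simp)
  have hf := gauss_ibp1 (fun x => (b * x + a) * x) (fun x => a + 2 * b * x) (by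
      intro t
      have := (((hasDerivAt_id t).const_mul b).add_const a).mul (hasDerivAt_id t)
      refine this.congr_deriv ?_
      simp; ring)
    (((hx.const_mul b).add (AllLp.const a)).mul hx).integrable
    (hx.mul (((hx.const_mul b).add (AllLp.const a)).mul hx)).integrable
    ((AllLp.const a).add (hx.const_mul (2 * b))).integrable
  unfold hCoef
  have e : ∀ g : ℝ, (Polynomial.C b * Polynomial.X + Polynomial.C a).eval g * He 2 g =
      (Real.sqrt 2)⁻¹ * ((g * ((b * g + a) * g) - (a + 2 * b * g)) + b * g) := by
    intro g; rw [He_two]; simp; ring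
  simp_rw [e]
  have i1 := (hx.mul (((hx.const_mul b).add (AllLp.const a)).mul hx)).sub
    ((AllLp.const a).add (hx.const_mul (2 * b)))
  rw [integral_const_mul, integral_add i1.integrable (hx.const_mul b).integrable,
    integral_sub (hx.mul (((hx.const_mul b).add (AllLp.const a)).mul hx)).integrable
    ((AllLp.const a).add (hx.const_mul (2 * b))).integrable, hf, integral_const_mul,
    integral_id_gaussianReal]
  simp

end final

set_option linter.unusedSectionVars false

lemma prob_of_forall {Ω : Type*} [MeasurableSpace Ω] (P : Measure Ω) [IsProbabilityMeasure P]
    (S : Set Ω) (a : ENNReal) (h : ∀ w, w ∈ S) : 1 - a ≤ P S := by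
  rw [Set.eq_univ_of_forall h, measure_univ]
  exact tsub_le_self

lemma Mat_smul {d : ℕ} (c : ℝ) (β : MIdx d 2 → ℝ) (i j : Fin d) :
    Mat (fun κ => c * β κ) i j = c * Mat β i j := by
  unfold Mat; ring

lemma Mat_Q {d p : ℕ} (c : ℝ) (w : Fin p → Fin d → ℝ) (θ : Fin p → ℝ) (i j : Fin d) :
    Mat (fun κ => c * ∑ n, θ n * qvec d 2 (w n) κ) i j = c * ∑ n, θ n * w n i * w n j := by
  rw [Mat_smul, Mat_sum]
  congr 1
  refine Finset.sum_congr rfl fun n _ => ?_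
  rw [Mat_qvec]; ring

lemma log_pow_bound (C6 ε0 : ℝ) (hC6 : 0 < C6) (hε0 : 0 < ε0) :
    ∃ C1 : ℝ, 1 ≤ C1 ∧ ∀ d : ℕ, 2 ≤ d → Real.log d ^ C6 ≤ C1 * (d : ℝ) ^ (ε0 / 2) := by
  set ε := ε0 / (2 * C6) with hε
  have hεp : 0 < ε := by positivity
  refine ⟨max 1 ((ε⁻¹) ^ C6), le_max_left _ _, fun d hd => ?_⟩
  have hd1 : (1 : ℝ) ≤ d := by exact_mod_cast (by omega : 1 ≤ d)
  have hd0 : (0 : ℝ) ≤ d := by linarith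
  have h1 : Real.log d ≤ ε⁻¹ * (d : ℝ) ^ ε := by
    have := Real.log_le_rpow_div hd0 hεp
    rwa [div_eq_inv_mul] at this
  have h2 := Real.rpow_le_rpow (Real.log_nonneg hd1) h1 hC6.le
  rw [Real.mul_rpow (by positivity) (by positivity), ← Real.rpow_mul hd0] at h2
  have e : ε * C6 = ε0 / 2 := by rw [hε]; field_simp
  rw [e] at h2
  exact h2.trans (mul_le_mul_of_nonneg_right (le_max_right _ _) (by positivity))

lemma psi_lip {ι : Type*} [Fintype ι] (L : ℝ) (hL : 0 < L) (φ : ((ι → ℝ) × ℝ) → ℝ)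
    (h : ∀ u v : (ι → ℝ) × ℝ, |φ u - φ v| ≤
      L * Real.sqrt ((∑ i, (u.1 i - v.1 i) ^ 2) + (u.2 - v.2) ^ 2))
    (u v : Option ι → ℝ) :
    |φ (fun i => u (some i), u none) - φ (fun i => v (some i), v none)| ≤
      (L * ((Fintype.card (Option ι) : ℕ) : ℝ)) * ‖u - v‖ := by
  refine (h _ _).trans ?_
  rw [mul_assoc]
  refine mul_le_mul_of_nonneg_left ?_ hL.le
  have hc : (1 : ℝ) ≤ ((Fintype.card (Option ι) : ℕ) : ℝ) := by
    exact_mod_cast Fintype.card_pos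
  refine Real.sqrt_le_iff.2 ⟨by positivity, ?_⟩
  have e : (∑ i, (u (some i) - v (some i)) ^ 2) + (u none - v none) ^ 2 =
      ∑ i : Option ι, (u i - v i) ^ 2 := by
    rw [Fintype.sum_option]; ring
  simp only
  rw [e]
  have : ∀ i ∈ (Finset.univ : Finset (Option ι)), (u i - v i) ^ 2 ≤ ‖u - v‖ ^ 2 := by
    intro i _
    have := norm_le_pi_norm (u - v) i
    rw [← sq_abs]
    exact pow_le_pow_left₀ (abs_nonneg _) (by simpa using this) 2
  refine (Finset.sum_le_sum this).trans ?_
  rw [Finset.sum_const, Finset.card_univ, nsmul_eq_mul, mul_pow]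
  refine mul_le_mul_of_nonneg_right ?_ (sq_nonneg _)
  nlinarith

/-- **Theorem 4.3**: uniform CLT over `Θ^CG_W(ε₀, K)` and all Lipschitz test functions,
replacing the non-signal second-order chaos of the PGE model by Gaussians (CGE model). -/
theorem uniform_clt_second_order_chaos
    (C0 C6 c6 c3 : ℝ) (hC0 : 0 < C0) (hC6 : 0 < C6) (hc6 : 0 < c6) (hc6' : c6 < 1 / 2)
    (hc3 : 0 < c3) (Dσ D' s : ℕ) (sk : ℕ → ℕ)
    (C K ε0 : ℝ) (hC : 0 < C) (hK : 0 < K) (hε0 : 0 < ε0) :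
    ∃ c C' : ℝ, 0 < c ∧ 0 < C' ∧ ∃ d₀ : ℕ, 0 < d₀ ∧
      ∀ d : ℕ, d₀ ≤ d → ∀ p : ℕ, s ≤ d →
      (C0⁻¹ ≤ (p : ℝ) / (d : ℝ) ^ 2 ∧ (p : ℝ) / (d : ℝ) ^ 2 ≤ C0) →
      ∀ β : (k : ℕ) → Fin (sk k) → MIdx d k → ℝ,
      (∀ k : ℕ, 2 ≤ k → k ≤ D' → ∀ i : Fin (sk k),
        enorm2 (β k i) = 1 ∧
        (∫ x, (dotp (β k i) (hvec d k x)) ^ 4 ∂(stdG (Fin d))) ≤ 3 + (d : ℝ) ^ (-c3)) →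
      ∀ σa : Polynomial ℝ,
      (σa.natDegree ≤ Dσ ∧
        Real.log d ^ (-C6) ≤ |hCoef σa 0| ∧ Real.log d ^ (-C6) ≤ |hCoef σa 2| ∧
        (d : ℝ) ^ (-c6) / C6 ≤ |hCoef σa 1| ∧ |hCoef σa 1| ≤ C6 * (d : ℝ) ^ (-c6) ∧
        (∀ k : ℕ, k ≤ Dσ → |hCoef σa k| ≤ Real.log d ^ C6)) →
      1 - ENNReal.ofReal ((d : ℝ) ^ (-C)) ≤
        (Measure.pi fun _ : Fin p => unifSphere (Fin d))
          {w | ∀ L : ℝ, 0 < L →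
            ∀ φ : ((SigIdx s D' sk → ℝ) × ℝ) → ℝ,
            (∀ u v : (SigIdx s D' sk → ℝ) × ℝ,
              |φ u - φ v| ≤
                L * Real.sqrt ((∑ i, (u.1 i - v.1 i) ^ 2) + (u.2 - v.2) ^ 2)) →
            ∀ θ : Fin p → ℝ, θ ∈ ThetaCG d p s ε0 K (hCoef σa 1) w →
              |(∫ ω : PGfeat d p D',
                    φ (fPG d s D' sk β ω.1 ω.2.1, dotp θ (zPG d p Dσ σa w ω.1 ω.2.2))
                    ∂(PGfeatMeas d p D')) -
                  (∫ ω : CGfeat d p D' s,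
                    φ (fCG d s D' sk β ω.1 ω.2.1,
                      dotp θ (zCG d p s Dσ D' σa w ω.1 ω.2.1 ω.2.2.1 ω.2.2.2))
                    ∂(CGfeatMeas d p D' s))| ≤
                C' * L / (d : ℝ) ^ c} := by
  obtain ⟨Cf, hCf, HF⟩ := fixed_clt s D' sk
  obtain ⟨C1, hC1, hlog⟩ := log_pow_bound C6 ε0 hC6 hε0
  set e := min (ε0 / 2) (c3 / 4) with he
  have hep : 0 < e := lt_min (by positivity) (by positivity)
  set N : ℝ := ((Fintype.card (Option (SigIdx s D' sk)) : ℕ) : ℝ) with hN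
  have hNp : 0 < N := by rw [hN]; exact_mod_cast Fintype.card_pos
  refine ⟨e / 2, Cf * N * ((2 * s + 5) * C1), by positivity, by positivity, 2, by norm_num, ?_⟩
  intro d hd p hsd _ β hβ σa hσ
  obtain ⟨hdeg, -, -, -, -, hμ⟩ := hσ
  have := unif_prob (Fin d)
  have hd1 : (1 : ℝ) ≤ d := by exact_mod_cast (by omega : 1 ≤ d)
  have hdp : (0 : ℝ) < d := by linarith
  have hμ2 : |hCoef σa 2| ≤ C1 * (d : ℝ) ^ (ε0 / 2) := by
    by_cases h2 : 2 ≤ Dσ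
    · exact (hμ 2 h2).trans (hlog d hd)
    · rw [hCoef_two_zero σa (by omega), abs_zero]
      positivity
  refine prob_of_forall _ _ _ ?_
  intro w L hL φ hφ θ hθ
  obtain ⟨-, hop, hcr⟩ := hθ
  set κ : ℝ := C1 * (d : ℝ) ^ (-e) with hκ
  have hκ0 : 0 ≤ κ := by positivity
  have hμκ : |hCoef σa 2| * (d : ℝ) ^ (-ε0) ≤ κ := by
    refine (mul_le_mul_of_nonneg_right hμ2 (by positivity)).trans ?_
    rw [mul_assoc, ← Real.rpow_add hdp]
    refine mul_le_mul_of_nonneg_left (Real.rpow_le_rpow_of_exponent_le hd1 ?_) (by linarith)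
    have := min_le_left (ε0 / 2) (c3 / 4)
    linarith
  have hsig : 2 ≤ D' → ∀ i, OpB (Mat (β 2 i)) κ := by
    intro hD i
    obtain ⟨h1, h4⟩ := hβ 2 le_rfl hD i
    have hτ : ((d : ℝ) ^ (-(c3 / 4))) ^ 4 = (d : ℝ) ^ (-c3) := by
      rw [← Real.rpow_natCast, ← Real.rpow_mul hdp.le]
      congr 1; push_cast; ring
    refine OpB.mono (opB_of_fourth (β 2 i) h1 ((d : ℝ) ^ (-(c3 / 4))) (by positivity)
      (by rw [hτ]; exact h4))
      (by positivity) ?_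
    have : (d : ℝ) ^ (-(c3 / 4)) ≤ (d : ℝ) ^ (-e) := by
      refine Real.rpow_le_rpow_of_exponent_le hd1 ?_
      have := min_le_right (ε0 / 2) (c3 / 4)
      linarith
    have h0 : (0 : ℝ) ≤ (d : ℝ) ^ (-e) := by positivity
    exact this.trans (le_mul_of_one_le_left h0 hC1)
  have hopQ : OpB (Mat (msk s (fun κ => hCoef σa 2 * ∑ j, θ j * qvec d 2 (w j) κ))) κ := by
    refine OpB.mono (OpB.smul (c := hCoef σa 2) (opB_of_opNorm _ _ hop) ?_) (by positivity) hμκ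
    intro i j
    rw [Mat_msk, Mat_Q]
    split_ifs <;> simp
  set η : ℝ := (2 * s + 2) * κ with hη
  have hη1 : Real.sqrt (2 * s * κ ^ 2) ≤ η := by
    refine Real.sqrt_le_iff.2 ⟨by positivity, ?_⟩
    have : (0 : ℝ) ≤ s := by positivity
    have h1 : (2 * (s : ℝ)) ≤ (2 * s + 2) ^ 2 := by nlinarith only [this]
    calc 2 * (s : ℝ) * κ ^ 2 ≤ (2 * s + 2) ^ 2 * κ ^ 2 :=
          mul_le_mul_of_nonneg_right h1 (sq_nonneg _)
      _ = η ^ 2 := by rw [hη]; ring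
  have hη2 : Real.sqrt (∑ κ', ((fun κ => hCoef σa 2 * ∑ j, θ j * qvec d 2 (w j) κ) κ' -
      msk s (fun κ => hCoef σa 2 * ∑ j, θ j * qvec d 2 (w j) κ) κ' -
      mskS s (fun κ => hCoef σa 2 * ∑ j, θ j * qvec d 2 (w j) κ) κ') ^ 2) ≤ η := by
    rw [cross_bound]
    refine Real.sqrt_le_iff.2 ⟨by positivity, ?_⟩
    have h3 := (Real.sqrt_le_iff.1 hcr).2
    set S := ∑ i : Fin d, ∑ i' : Fin d,
        (if (i : ℕ) < s ∧ s ≤ (i' : ℕ) then (∑ j, θ j * w j i * w j i') ^ 2 else 0) with hS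
    have e1 : (∑ i : Fin d, ∑ j : Fin d, if (i : ℕ) < s ∧ s ≤ (j : ℕ) then
        Mat (fun κ => hCoef σa 2 * ∑ j, θ j * qvec d 2 (w j) κ) i j ^ 2 else 0) =
        hCoef σa 2 ^ 2 * S := by
      rw [hS, Finset.mul_sum]
      refine Finset.sum_congr rfl fun i _ => ?_
      rw [Finset.mul_sum]
      refine Finset.sum_congr rfl fun j _ => ?_
      rw [Mat_Q]
      split_ifs
      · ring
      · simp
    have h4 : S ≤ ((d : ℝ) ^ (-ε0)) ^ 2 := by
      refine le_trans (le_of_eq ?_) h3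
      rw [hS]
    have h5 : hCoef σa 2 ^ 2 * S ≤ κ ^ 2 := by
      refine (mul_le_mul_of_nonneg_left h4 (sq_nonneg _)).trans ?_
      rw [← sq_abs (hCoef σa 2), ← mul_pow]
      exact pow_le_pow_left₀ (by positivity) hμκ 2
    have h6 : 2 * (hCoef σa 2 ^ 2 * S) ≤ η ^ 2 := by
      have : (0 : ℝ) ≤ s := by positivity
      have h7 : (2 : ℝ) ≤ (2 * s + 2) ^ 2 := by nlinarith only [this]
      calc 2 * (hCoef σa 2 ^ 2 * S) ≤ 2 * κ ^ 2 := by linarith only [h5]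
        _ ≤ (2 * s + 2) ^ 2 * κ ^ 2 := mul_le_mul_of_nonneg_right h7 (sq_nonneg _)
        _ = η ^ 2 := by rw [hη]; ring
    refine le_trans (le_of_eq ?_) h6
    rw [← e1]
  have hδ : 0 < (d : ℝ) ^ (-(e / 2)) := by positivity
  have key := HF d p Dσ hsd β σa w θ _ rfl κ hκ0 hopQ (fun hD i => (hβ 2 le_rfl hD i).1) hsig η
    (by positivity) hη1 hη2 (L * N) (by positivity)
    (fun v => φ (fun i => v (some i), v none)) (psi_lip L hL φ hφ) _ hδ
  refine le_trans key ?_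
  have hfrac : κ / (d : ℝ) ^ (-(e / 2)) = C1 * (d : ℝ) ^ (-(e / 2)) := by
    rw [hκ, mul_div_assoc, ← Real.rpow_sub hdp]
    congr 2; ring
  have hκδ : κ ≤ C1 * (d : ℝ) ^ (-(e / 2)) := by
    refine mul_le_mul_of_nonneg_left (Real.rpow_le_rpow_of_exponent_le hd1 ?_) (by linarith)
    linarith
  have hs0 : (0 : ℝ) ≤ s := by positivity
  have hsum : κ / (d : ℝ) ^ (-(e / 2)) + κ + (d : ℝ) ^ (-(e / 2)) + η ≤
      (2 * s + 5) * C1 * (d : ℝ) ^ (-(e / 2)) := by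
    have h1 : η ≤ (2 * s + 2) * (C1 * (d : ℝ) ^ (-(e / 2))) :=
      mul_le_mul_of_nonneg_left hκδ (by positivity)
    have h2 : (d : ℝ) ^ (-(e / 2)) ≤ C1 * (d : ℝ) ^ (-(e / 2)) := le_mul_of_one_le_left hδ.le hC1
    rw [hfrac]
    linarith only [h1, h2, hκδ]
  refine (mul_le_mul_of_nonneg_left hsum (by positivity)).trans (le_of_eq ?_)
  rw [Real.rpow_neg hdp.le, div_eq_mul_inv]
  ring
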